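/- Let Z ⊂ P^n_ℂ be a smooth closed subvariety whose homogeneous ideal I_Z is generated by homogeneous polynomials of degree ≤ (d+1)/2, and let f ∈ S^d be a homogeneous polynomial of degree d whose partial derivatives ∂f/∂X_i all vanish on Z and generate the ideal sheaf of Z (so that the hypersurface X_f is singular exactly along Z and the relevant linear system becomes base-point free after blowing up Z). Then for every k < (n − dim Z + 1)(d−3)/2, the dimension of R_f^k equals its value for a generic degree-d polynomial, namely dim_ℂ R_f^k = Σ_{i=0}^{n+1} (−1)^i · binom(n+1, i) · dim_ℂ S^{k−i(d−1)}, where dim_ℂ S^m = binom(m+n, n) for m ≥ 0 and 0 for m < 0. -/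

import Mathlib

open MvPolynomial

noncomputable section

abbrev S (n : ℕ) : Type := MvPolynomial (Fin (n + 1)) ℂ

/-- The Jacobian ideal of `f`, generated by its partial derivatives. -/
def jacobianIdeal {n : ℕ} (f : S n) : Ideal (S n) :=
  Ideal.span (Set.range fun i => MvPolynomial.pderiv i f)

/-- The degree-`k` graded piece of `S/I`: the image of the homogeneous degree-`k`
polynomials in the quotient. -/
def quotPiece {n : ℕ} (I : Ideal (S n)) (k : ℕ) : Submodule ℂ (S n ⧸ I) :=
  (MvPolynomial.homogeneousSubmodule (Fin (n + 1)) ℂ k).map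
    (Ideal.Quotient.mkₐ ℂ I).toLinearMap

/-- The degree-`k` graded piece `R_f^k` of the Jacobian ring `R_f = S/J_f`. -/
def Rpiece {n : ℕ} (f : S n) (k : ℕ) : Submodule ℂ (S n ⧸ jacobianIdeal f) :=
  quotPiece (jacobianIdeal f) k

/-- `f` defines a smooth hypersurface: its partial derivatives have no common
zero in `ℂ^{n+1} \ {0}`. -/
def SmoothHyp {n : ℕ} (f : S n) : Prop :=
  ∀ v : Fin (n + 1) → ℂ, (∀ i, MvPolynomial.eval v (MvPolynomial.pderiv i f) = 0) → v = 0

/-- A polynomial function on a complex vector space: an element of the algebra of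
functions generated by the linear functionals. -/
def IsPolyFun {M : Type} [AddCommGroup M] [Module ℂ M] (φ : M → ℂ) : Prop :=
  φ ∈ Algebra.adjoin ℂ {ψ : M → ℂ | ∃ l : M →ₗ[ℂ] ℂ, ψ = ⇑l}

/-- A property `P` holds for generic points of `M`: it holds on a nonempty
Zariski-open subset, i.e. on the nonvanishing locus of some polynomial function
that is not identically zero. -/
def GenericallyHolds {M : Type} [AddCommGroup M] [Module ℂ M] (P : M → Prop) : Prop :=
  ∃ φ : M → ℂ, IsPolyFun φ ∧ (∃ x, φ x ≠ 0) ∧ ∀ x, φ x ≠ 0 → P x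

/-- Substitution of the linear change of coordinates given by the matrix `A`. -/
def substLin {n : ℕ} (A : Matrix (Fin (n + 1)) (Fin (n + 1)) ℂ) (f : S n) : S n :=
  MvPolynomial.aeval (fun i => ∑ j, A i j • MvPolynomial.X j) f

/-- A regular sequence: each `f i` is a nonzerodivisor modulo the previous ones. -/
def IsRegularSeq {n c : ℕ} (f : Fin c → S n) : Prop :=
  ∀ (i : Fin c) (g : S n),
    f i * g ∈ Ideal.span (f '' {j | j < i}) → g ∈ Ideal.span (f '' {j | j < i})

/-- Zariski-closed subset of a complex vector space: common zero locus of a set of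
polynomial functions. -/
def IsZariskiClosed {M : Type} [AddCommGroup M] [Module ℂ M] (T : Set M) : Prop :=
  ∃ 𝒮 : Set (M → ℂ), (∀ φ ∈ 𝒮, IsPolyFun φ) ∧ T = {x | ∀ φ ∈ 𝒮, φ x = 0}

/-- An irreducible Zariski-closed subset. -/
def IsIrredClosed {M : Type} [AddCommGroup M] [Module ℂ M] (Z : Set M) : Prop :=
  IsZariskiClosed Z ∧ Z.Nonempty ∧
    ∀ C₁ C₂ : Set M, IsZariskiClosed C₁ → IsZariskiClosed C₂ →
      Z ⊆ C₁ ∪ C₂ → Z ⊆ C₁ ∨ Z ⊆ C₂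

/-- The (Krull) dimension of the algebraic set `T` is at least `m`: there is a strictly
increasing chain of `m+1` irreducible closed subsets contained in `T`. -/
def algDimGE {M : Type} [AddCommGroup M] [Module ℂ M] (T : Set M) (m : ℕ) : Prop :=
  ∃ Z : Fin (m + 1) → Set M, StrictMono Z ∧ (∀ i, IsIrredClosed (Z i)) ∧
    Z (Fin.last m) ⊆ T


namespace JacSing

section

/-- The Čech differential on cochains indexed by lists of indices. -/
def cechD {ι V : Type*} [AddCommGroup V] : (List ι → V) → List ι → V
  | _, [] => 0
  | c, α :: l => c l - cechD (fun l' => c (α :: l')) l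

section Cech
variable {ι V W : Type*} [AddCommGroup V] [AddCommGroup W]

@[simp] lemma cechD_nil (c : List ι → V) : cechD c [] = 0 := by simp [cechD]

lemma cechD_cons (c : List ι → V) (α : ι) (l : List ι) :
    cechD c (α :: l) = c l - cechD (fun l' => c (α :: l')) l := by
  rw [cechD]

lemma cechD_add (c c' : List ι → V) (l : List ι) :
    cechD (fun l => c l + c' l) l = cechD c l + cechD c' l := by
  induction l generalizing c c' with
  | nil => simp
  | cons α l ih => simp only [cechD_cons, ih]; abel

lemma cechD_map (φ : V →+ W) (c : List ι → V) (l : List ι) :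
    cechD (fun l => φ (c l)) l = φ (cechD c l) := by
  induction l generalizing c with
  | nil => simp
  | cons α l ih => simp only [cechD_cons, ih, map_sub]

lemma cechD_neg (c : List ι → V) (l : List ι) :
    cechD (fun l => - c l) l = - cechD c l :=
  cechD_map (-AddMonoidHom.id V) c l

lemma cechD_sub (c c' : List ι → V) (l : List ι) :
    cechD (fun l => c l - c' l) l = cechD c l - cechD c' l := by
  simp only [sub_eq_add_neg, cechD_add, cechD_neg]

lemma cechD_zero (l : List ι) : cechD (fun _ : List ι => (0 : V)) l = 0 := by
  simpa using cechD_map (0 : V →+ V) (fun _ => 0) l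

lemma cechD_sum {κ : Type*} (s : Finset κ) (c : κ → List ι → V) (l : List ι) :
    cechD (fun l => ∑ j ∈ s, c j l) l = ∑ j ∈ s, cechD (c j) l := by
  classical
  induction s using Finset.induction_on with
  | empty => simpa using cechD_zero l
  | insert a s ha ih => simp only [Finset.sum_insert ha, cechD_add, ih]

lemma cechD_cechD (c : List ι → V) (l : List ι) : cechD (cechD c) l = 0 := by
  induction l generalizing c with
  | nil => simp
  | cons α l ih =>
    rw [cechD_cons]
    have : (fun l' => cechD c (α :: l')) = fun l' => c l' - cechD (fun l' => c (α :: l')) l' := by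
      funext l'; rw [cechD_cons]
    rw [this, cechD_sub, ih]; simp

/-- The differential at `l` only depends on the cochain at the faces of `l`. -/
lemma cechD_congr (c c' : List ι → V) (l : List ι)
    (h : ∀ l', l'.Sublist l → l'.length + 1 = l.length → c l' = c' l') :
    cechD c l = cechD c' l := by
  induction l generalizing c c' with
  | nil => simp
  | cons α l ih =>
    rw [cechD_cons, cechD_cons, h l (List.sublist_cons_self α l) (by simp)]
    congr 1
    apply ih
    intro l' hl' hlen
    exact h (α :: l') (hl'.cons_cons α) (by simp [hlen])

/-- Membership of the differential from membership on the faces. -/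
lemma cechD_mem {P : AddSubgroup V} (c : List ι → V) (l : List ι)
    (h : ∀ l', l'.Sublist l → l'.length + 1 = l.length → c l' ∈ P) :
    cechD c l ∈ P := by
  induction l generalizing c with
  | nil => simp [P.zero_mem]
  | cons α l ih =>
    rw [cechD_cons]
    refine P.sub_mem (h l (List.sublist_cons_self α l) (by simp)) (ih _ ?_)
    intro l' hl' hlen
    exact h (α :: l') (hl'.cons_cons α) (by simp [hlen])

end Cech

section Homotopy
variable {ι V : Type*} [LinearOrder ι] [AddCommGroup V]

/-- Contraction of Čech cochains by the index `i`. -/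
def cechH (i : ι) : (List ι → V) → List ι → V
  | c, [] => c [i]
  | c, α :: l => if i < α then c (i :: α :: l) else if i = α then 0
      else - cechH i (fun l' => c (α :: l')) l

lemma cechH_of_lt (i : ι) (c : List ι → V) (l : List ι) (h : ∀ j ∈ l, i < j) :
    cechH i c l = c (i :: l) := by
  cases l with
  | nil => simp [cechH]
  | cons α l => simp [cechH, h α (by simp)]

lemma cechH_neg_sub (i : ι) (c c' : List ι → V) (l : List ι) :
    cechH i (fun l => c l - c' l) l = cechH i c l - cechH i c' l := by
  induction l generalizing c c' with
  | nil => simp [cechH]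
  | cons α l ih =>
    simp only [cechH]
    split_ifs
    · rfl
    · simp
    · rw [ih]; abel

lemma cechD_cechH (i : ι) (c : List ι → V) (l : List ι) (hl : l.Pairwise (· < ·)) :
    cechD (cechH i c) l + cechH i (cechD c) l = c l := by
  induction l generalizing c with
  | nil => simp [cechH, cechD_cons]
  | cons α l ih =>
    have hl' := List.pairwise_cons.1 hl
    rw [cechD_cons]
    rcases lt_trichotomy i α with h | h | h
    · have h1 : cechH i c l = c (i :: l) :=
        cechH_of_lt i c l fun j hj => h.trans (hl'.1 j hj)
      have h2 : cechD (fun l' => cechH i c (α :: l')) l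
          = cechD (fun l' => c (i :: α :: l')) l := by
        refine congrArg (fun g => cechD g l) ?_
        funext l'
        simp [cechH, h]
      have h3 : cechH i (cechD c) (α :: l) = cechD c (i :: α :: l) := by simp [cechH, h]
      rw [h1, h2, h3, cechD_cons, cechD_cons]; abel
    · subst h
      have h1 : cechH i c l = c (i :: l) := cechH_of_lt i c l hl'.1
      have h2 : (fun l' => cechH i c (i :: l')) = fun _ => 0 := by
        funext l'; simp [cechH]
      have h3 : cechH i (cechD c) (i :: l) = 0 := by simp [cechH]
      rw [h1, h2, h3, cechD_zero]; abel
    · have hn : ¬ i < α := not_lt.2 h.le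
      have hn' : ¬ i = α := h.ne'
      have h2 : (fun l' => cechH i c (α :: l')) = fun l' => -cechH i (fun l' => c (α :: l')) l' := by
        funext l'; simp [cechH, hn, hn']
      have h3 : cechH i (cechD c) (α :: l)
          = - (cechH i c l - cechH i (cechD fun l' => c (α :: l')) l) := by
        simp only [cechH, hn, hn', if_false]
        rw [← cechH_neg_sub]
        congr 2
      rw [h2, h3, cechD_neg]
      have := ih (fun l' => c (α :: l')) hl'.2
      rw [← this]; abel

/-- The value of the contraction is, up to sign, a value of the cochain at a list obtained by
inserting `i`. -/
lemma cechH_mem {P : AddSubgroup V} (i : ι) (c : List ι → V) (l : List ι)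
    (hl : l.Pairwise (· < ·))
    (h : ∀ l' : List ι, l'.Pairwise (· < ·) → l'.length = l.length + 1 →
      (∀ j, j ∈ l' ↔ j = i ∨ j ∈ l) → c l' ∈ P) : cechH i c l ∈ P := by
  induction l generalizing c with
  | nil => exact h [i] (by simp) (by simp) (by simp)
  | cons α l ih =>
    have hl' := List.pairwise_cons.1 hl
    simp only [cechH]
    split_ifs with h1 h2
    · refine h _ ?_ (by simp) (by simp)
      refine List.pairwise_cons.2 ⟨?_, hl⟩
      intro j hj
      rcases List.mem_cons.1 hj with rfl | hj
      · exact h1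
      · exact h1.trans (hl'.1 j hj)
    · exact P.zero_mem
    · refine P.neg_mem (ih _ hl'.2 ?_)
      intro l' hp hlen hmem
      refine h (α :: l') ?_ (by simp [hlen]) ?_
      · refine List.pairwise_cons.2 ⟨?_, hp⟩
        intro j hj
        rcases (hmem j).1 hj with rfl | hj
        · exact lt_of_le_of_ne (not_lt.1 h1) (Ne.symm h2)
        · exact hl'.1 j hj
      · intro j
        simp only [List.mem_cons, hmem]
        tauto

end Homotopy

end

section

/-- Laurent polynomials. -/
abbrev Laur (B ι : Type) [CommRing B] : Type := AddMonoidAlgebra B (ι → ℤ)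

section Laur
variable {B ι : Type} [CommRing B]

/-- Laurent polynomials all of whose exponents satisfy `P`. -/
def lsup (B : Type) [CommRing B] {ι : Type} (P : (ι → ℤ) → Prop) : AddSubgroup (Laur B ι) where
  carrier := {a | ∀ u, a.coeff u ≠ 0 → P u}
  zero_mem' := by intro u hu; simp at hu
  add_mem' := by
    intro a b ha hb u hu
    by_cases h : a.coeff u = 0
    · exact hb u (by intro h'; apply hu; simp [h, h'])
    · exact ha u h
  neg_mem' := by
    intro a ha u hu
    exact ha u (by intro h; apply hu; simp [h])

lemma mem_lsup {P : (ι → ℤ) → Prop} {a : Laur B ι} :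
    a ∈ lsup B P ↔ ∀ u, a.coeff u ≠ 0 → P u := Iff.rfl

lemma single_mem_lsup {P : (ι → ℤ) → Prop} {u : ι → ℤ} (b : B) (h : P u) :
    (AddMonoidAlgebra.single u b : Laur B ι) ∈ lsup B P := by
  classical
  intro v hv
  rw [AddMonoidAlgebra.coeff_single, Finsupp.single_apply] at hv
  split_ifs at hv with h'
  · exact h' ▸ h
  · exact absurd rfl hv

lemma lsup_mono {P Q : (ι → ℤ) → Prop} (h : ∀ u, P u → Q u) : lsup B P ≤ lsup B Q :=
  fun _ ha u hu => h u (ha u hu)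

/-- The exponents in `lsup` are generated by monomials. -/
lemma lsup_induction {P : (ι → ℤ) → Prop} {motive : Laur B ι → Prop} (a : Laur B ι)
    (ha : a ∈ lsup B P) (h0 : motive 0) (hadd : ∀ a b, motive a → motive b → motive (a + b))
    (hs : ∀ u b, P u → motive (AddMonoidAlgebra.single u b)) : motive a := by
  have : a = ∑ u ∈ a.coeff.support, AddMonoidAlgebra.single u (a.coeff u) :=
    (AddMonoidAlgebra.sum_coeff_single a).symm
  rw [this]
  refine Finset.sum_induction _ motive hadd h0 ?_
  intro u hu
  exact hs u _ (ha u (Finsupp.mem_support_iff.1 hu))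

lemma mul_mem_lsup {P Q R : (ι → ℤ) → Prop} (h : ∀ u v, P u → Q v → R (u + v))
    {a b : Laur B ι} (ha : a ∈ lsup B P) (hb : b ∈ lsup B Q) : a * b ∈ lsup B R := by
  refine lsup_induction (motive := fun a => a * b ∈ lsup B R) a ha (by rw [zero_mul]; exact AddSubgroup.zero_mem _) ?_ ?_
  · intro a a' h h'; rw [add_mul]; exact AddSubgroup.add_mem _ h h'
  intro u c hu
  refine lsup_induction (motive := fun b => AddMonoidAlgebra.single u c * b ∈ lsup B R) b hb (by rw [mul_zero]; exact AddSubgroup.zero_mem _) ?_ ?_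
  · intro a a' h h'; rw [mul_add]; exact AddSubgroup.add_mem _ h h'
  intro v c' hv
  rw [AddMonoidAlgebra.single_mul_single]
  exact single_mem_lsup _ (h u v hu hv)

open Classical in
/-- The projection to the monomials with exponents satisfying `P`. -/
def lproj (B : Type) [CommRing B] {ι : Type} (P : (ι → ℤ) → Prop) : Laur B ι →ₗ[B] Laur B ι where
  toFun a := AddMonoidAlgebra.ofCoeff (a.coeff.filter P)
  map_add' a b := by
    apply AddMonoidAlgebra.coeff_injective
    simp [Finsupp.filter_add]
  map_smul' c a := by
    apply AddMonoidAlgebra.coeff_injective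
    simp [Finsupp.filter_smul]

open Classical in
lemma lproj_coeff (P : (ι → ℤ) → Prop) (a : Laur B ι) (u : ι → ℤ) :
    (lproj B P a).coeff u = if P u then a.coeff u else 0 := by
  change (a.coeff.filter P) u = _
  rw [Finsupp.filter_apply]

lemma lproj_single_of {P : (ι → ℤ) → Prop} {u : ι → ℤ} (b : B) (h : P u) :
    lproj B P (AddMonoidAlgebra.single u b) = AddMonoidAlgebra.single u b := by
  classical
  ext v
  rw [lproj_coeff, AddMonoidAlgebra.coeff_single, Finsupp.single_apply]
  split_ifs with h1 h2 h2 <;> simp_all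

lemma lproj_single_not {P : (ι → ℤ) → Prop} {u : ι → ℤ} (b : B) (h : ¬ P u) :
    lproj B P (AddMonoidAlgebra.single u b) = 0 := by
  classical
  ext v
  rw [lproj_coeff, AddMonoidAlgebra.coeff_single, Finsupp.single_apply]
  split_ifs with h1 h2 h2 <;> simp_all

lemma lproj_mem (P Q : (ι → ℤ) → Prop) {a : Laur B ι} (ha : a ∈ lsup B Q) :
    lproj B P a ∈ lsup B (fun u => P u ∧ Q u) := by
  classical
  intro u hu
  rw [lproj_coeff] at hu
  split_ifs at hu with h
  · exact ⟨h, ha u hu⟩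
  · exact absurd rfl hu

lemma lproj_eq_self {P : (ι → ℤ) → Prop} {a : Laur B ι} (ha : a ∈ lsup B P) :
    lproj B P a = a := by
  refine lsup_induction (motive := fun a => lproj B P a = a) a ha (map_zero _) ?_ ?_
  · intro a b h h'; rw [map_add, h, h']
  · intro u b h; exact lproj_single_of b h

/-- Homogeneous degree condition together with denominators only in the variables in `l`. -/
def degPred [Fintype ι] (l : List ι) (t : ℤ) (u : ι → ℤ) : Prop :=
  ∑ i, u i = t ∧ ∀ i, i ∉ l → 0 ≤ u i

/-- Homogeneous degree-`t` elements with denominators only in the variables in `l`. -/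
abbrev lhom (B : Type) [CommRing B] {ι : Type} [Fintype ι] (l : List ι) (t : ℤ) :
    AddSubgroup (Laur B ι) := lsup B (degPred l t)

variable [Fintype ι]

lemma degPred_add {l l' : List ι} {s t : ℤ} (u v : ι → ℤ) (hu : degPred l s u)
    (hv : degPred l' t v) (h : ∀ i, i ∈ l → i ∈ l') : degPred l' (s + t) (u + v) := by
  refine ⟨by simp [Finset.sum_add_distrib, hu.1, hv.1], fun i hi => ?_⟩
  exact add_nonneg (hu.2 i fun h' => hi (h i h')) (hv.2 i hi)

lemma lhom_mul {l : List ι} {s t : ℤ} {a b : Laur B ι} (ha : a ∈ lhom B l s)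
    (hb : b ∈ lhom B l t) : a * b ∈ lhom B l (s + t) :=
  mul_mem_lsup (fun u v hu hv => degPred_add u v hu hv fun _ h => h) ha hb

lemma lhom_mono {l l' : List ι} (h : ∀ i, i ∈ l → i ∈ l') (t : ℤ) :
    lhom B l t ≤ lhom B l' t :=
  lsup_mono fun _ hu => ⟨hu.1, fun i hi => hu.2 i fun h' => hi (h i h')⟩

end Laur

section Free
variable {B : Type} [CommRing B] {n : ℕ}

lemma length_le_of_sorted (l : List (Fin (n + 1))) (hl : l.Pairwise (· < ·)) :
    l.length ≤ n + 1 := by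
  have hnd : l.Nodup := hl.imp (fun h => h.ne)
  simpa using hnd.length_le_card

lemma all_mem_of_sorted (l : List (Fin (n + 1))) (hl : l.Pairwise (· < ·))
    (h : n + 1 ≤ l.length) (i : Fin (n + 1)) : i ∈ l := by
  classical
  have hnd : l.Nodup := hl.imp (fun h => h.ne)
  have : l.toFinset = Finset.univ := by
    apply Finset.eq_univ_of_card
    rw [List.toFinset_card_of_nodup hnd]
    have := length_le_of_sorted l hl
    simp; omega
  have h2 : i ∈ l.toFinset := by rw [this]; simp
  simpa using h2

lemma exists_nonneg_of_degPred {l : List (Fin (n + 1))} {a : ℕ}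
    (hlen : l.length = a + 1) {t : ℤ} (hat : a < n ∨ -(n : ℤ) ≤ t) {u : Fin (n + 1) → ℤ}
    (hu : degPred l t u) : ∃ i, 0 ≤ u i := by
  by_contra! hneg
  have hall : ∀ i, i ∈ l := fun i => by
    by_contra h
    exact absurd (hu.2 i h) (not_le.2 (hneg i))
  have h1 : n + 1 ≤ l.length := by
    classical
    have : (Finset.univ : Finset (Fin (n+1))) ⊆ l.toFinset := fun i _ => by simp [hall i]
    have := (Finset.card_le_card this).trans (List.toFinset_card_le l)
    simpa using this
  have h2 : ∑ i, u i ≤ ∑ _i : Fin (n+1), (-1 : ℤ) :=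
    Finset.sum_le_sum fun i _ => by have := hneg i; omega
  simp at h2
  rw [hu.1] at h2
  omega

/-- Vanishing of the intermediate cohomology of line bundles on projective space. -/
lemma cech_free (a : ℕ) (t : ℤ) (hat : a < n ∨ -(n : ℤ) ≤ t)
    (c : List (Fin (n + 1)) → Laur B (Fin (n + 1)))
    (hc : ∀ l : List (Fin (n + 1)), l.Pairwise (· < ·) → l.length = a + 1 → c l ∈ lhom B l t)
    (hd : ∀ l : List (Fin (n + 1)), l.Pairwise (· < ·) → l.length = a + 2 → cechD c l = 0) :
    ∃ b : List (Fin (n + 1)) → Laur B (Fin (n + 1)),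
      (∀ l : List (Fin (n + 1)), l.Pairwise (· < ·) → l.length = a → b l ∈ lhom B l t) ∧
      ∀ l : List (Fin (n + 1)), l.Pairwise (· < ·) → l.length = a + 1 → cechD b l = c l := by
  classical
  let i0 : (Fin (n + 1) → ℤ) → Fin (n + 1) := fun u => if h : ∃ i, 0 ≤ u i then h.choose else 0
  have hi0 : ∀ u : Fin (n + 1) → ℤ, (∃ i, 0 ≤ u i) → 0 ≤ u (i0 u) := fun u h => by
    simp only [i0, dif_pos h]; exact h.choose_spec
  let pr : Fin (n + 1) → Laur B (Fin (n + 1)) →+ Laur B (Fin (n + 1)) := fun i =>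
    (lproj B fun u => i0 u = i).toAddMonoidHom
  have hsum : ∀ x, ∑ i, pr i x = x := fun x => by
    ext u
    rw [AddMonoidAlgebra.coeff_sum, Finsupp.finsetSum_apply]
    have : ∀ i, (pr i x).coeff u = if i0 u = i then x.coeff u else 0 := fun i => by
      rw [show pr i x = lproj B (fun u => i0 u = i) x from rfl, lproj_coeff]; congr
    simp [this]
  refine ⟨fun l => ∑ i, cechH i (fun l => pr i (c l)) l, ?_, ?_⟩
  · intro l hl hlen
    refine AddSubgroup.sum_mem _ fun i _ => ?_
    refine cechH_mem i _ l hl fun l' hl' hlen' hmem u hu => ?_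
    have hcl := hc l' hl' (by omega)
    have h1 := lproj_mem (fun u => i0 u = i) _ hcl u hu
    refine ⟨h1.2.1, fun j hj => ?_⟩
    by_cases hji : j = i
    · rw [hji, ← h1.1]
      exact hi0 u (exists_nonneg_of_degPred (hlen'.trans (by rw [hlen])) hat h1.2)
    · exact h1.2.2 j (by rw [hmem]; tauto)
  · intro l hl hlen
    rw [cechD_sum]
    rw [← hsum (c l)]
    refine Finset.sum_congr rfl fun i _ => ?_
    have h1 := cechD_cechH i (fun l => pr i (c l)) l hl
    have h2 : cechH i (cechD fun l => pr i (c l)) l ∈ (⊥ : AddSubgroup (Laur B (Fin (n+1)))) := by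
      refine cechH_mem i _ l hl fun l' hl' hlen' _ => ?_
      rw [cechD_map, hd l' hl' (by omega), map_zero]
      exact AddSubgroup.zero_mem _
    rw [AddSubgroup.mem_bot] at h2
    rw [h2, add_zero] at h1
    exact h1

end Free

end

section

section Serre
variable {B : Type} [CommRing B] {n : ℕ}

/-- The product of the variables in `l`, to the power `N`. -/
def lmon {ι : Type} [DecidableEq ι] (B : Type) [CommRing B] (l : List ι) (N : ℤ) : Laur B ι :=
  AddMonoidAlgebra.single (fun i => if i ∈ l then N else 0) 1

lemma lmon_mul_neg {ι : Type} [DecidableEq ι] (l : List ι) (N : ℤ) :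
    lmon B l (-N) * lmon B l N = 1 := by
  rw [lmon, lmon, AddMonoidAlgebra.single_mul_single, mul_one, AddMonoidAlgebra.one_def]
  congr 1
  funext i
  by_cases h : i ∈ l <;> simp [h]

lemma lmon_mem {l : List (Fin (n + 1))} (N : ℤ) :
    ∃ s : ℤ, lmon B l N ∈ lhom B l s ∧ lmon B l (-N) ∈ lhom B l (-s) := by
  refine ⟨∑ i, if i ∈ l then N else 0, single_mem_lsup _ ⟨rfl, fun i hi => by simp [hi]⟩,
    single_mem_lsup _ ⟨?_, fun i hi => by simp [hi]⟩⟩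
  rw [← Finset.sum_neg_distrib]
  exact Finset.sum_congr rfl fun i _ => by by_cases h : i ∈ l <;> simp [h]

/-- Denominators can be cleared. -/
lemma exists_lmon_mul_mem (l : List (Fin (n + 1))) (t : ℤ) (a : Laur B (Fin (n + 1)))
    (ha : a ∈ lhom B l t) : ∃ N : ℕ, ∀ M : ℤ, (N : ℤ) ≤ M → ∀ s, lmon B l M ∈ lhom B l s →
      lmon B l M * a ∈ lhom B [] (s + t) := by
  classical
  refine ⟨∑ u ∈ a.coeff.support, ∑ i, (u i).natAbs, fun M hM s hs => ?_⟩
  have hsub : lmon B l M * a ∈ lhom B l (s + t) := lhom_mul hs ha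
  refine fun v hv => ⟨(hsub v hv).1, fun i _ => ?_⟩
  by_cases hi : i ∈ l
  · have h1 := AddMonoidAlgebra.support_coeff_single_mul_subset a (1 : B)
      (fun i => if i ∈ l then M else 0) (Finsupp.mem_support_iff.2 hv)
    obtain ⟨u, hu, rfl⟩ := Finset.mem_image.1 h1
    have h2 : (u i).natAbs ≤ ∑ u ∈ a.coeff.support, ∑ i, (u i).natAbs :=
      (Finset.single_le_sum (f := fun i => (u i).natAbs) (fun _ _ => Nat.zero_le _)
        (Finset.mem_univ i)).trans
      (Finset.single_le_sum (f := fun u : Fin (n+1) → ℤ => ∑ i, (u i).natAbs)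
        (fun _ _ => Nat.zero_le _) hu)
    simp only [Pi.add_apply, hi, if_true]
    omega
  · exact (hsub v hv).2 i hi

/-- Elements of weight `w`, with denominators in `l`, of the module generated by a family. -/
def FamL {V κ : Type} [AddCommGroup V] [Module (Laur B (Fin (n + 1))) V] [Fintype κ]
    (g : κ → V) (wt : κ → ℤ) (l : List (Fin (n + 1))) (w : ℤ) (v : V) : Prop :=
  ∃ a : κ → Laur B (Fin (n + 1)), (∀ i, a i ∈ lhom B l (w - wt i)) ∧ v = ∑ i, a i • g i

/-- The polynomial subring of Laurent polynomials. -/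
def polySub (B : Type) [CommRing B] (n : ℕ) : Subalgebra B (Laur B (Fin (n + 1))) :=
  (MvPolynomial.aeval (R := B)
    (fun i : Fin (n + 1) => (AddMonoidAlgebra.single (Pi.single i (1 : ℤ)) (1 : B) :
      Laur B (Fin (n + 1))))).range

instance [IsNoetherianRing B] : IsNoetherianRing (polySub B n) :=
  isNoetherianRing_of_surjective _ _ _ (AlgHom.rangeRestrict_surjective _)

lemma single_mem_polySub (u : Fin (n + 1) → ℤ) (hu : ∀ i, 0 ≤ u i) (b : B) :
    (AddMonoidAlgebra.single u b : Laur B (Fin (n + 1))) ∈ polySub B n := by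
  have h1 : (AddMonoidAlgebra.single u b : Laur B (Fin (n + 1)))
      = b • ∏ i, (AddMonoidAlgebra.single (Pi.single i (1 : ℤ)) (1 : B) :
        Laur B (Fin (n + 1))) ^ (u i).toNat := by
    have h2 : ∀ s : Finset (Fin (n + 1)),
        ∏ i ∈ s, (AddMonoidAlgebra.single (Pi.single i (1 : ℤ)) (1 : B) :
        Laur B (Fin (n + 1))) ^ (u i).toNat
        = AddMonoidAlgebra.single (∑ i ∈ s, Pi.single i (u i)) 1 := by
      intro s
      classical
      induction s using Finset.induction_on with
      | empty => simp [AddMonoidAlgebra.one_def]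
      | insert i s hi ih =>
        rw [Finset.prod_insert hi, ih, AddMonoidAlgebra.single_pow,
          AddMonoidAlgebra.single_mul_single, Finset.sum_insert hi]
        congr 1
        · congr 1
          rw [← Pi.single_smul]
          simp [hu i]
        · simp
    rw [h2, Finset.univ_sum_single, AddMonoidAlgebra.smul_single]
    simp
  rw [h1]
  refine Subalgebra.smul_mem _ (Subalgebra.prod_mem _ fun i _ => Subalgebra.pow_mem _ ?_ _) _
  exact ⟨MvPolynomial.X i, by simp⟩

lemma lhom_nil_le_polySub {t : ℤ} {a : Laur B (Fin (n + 1))} (ha : a ∈ lhom B [] t) :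
    a ∈ polySub B n :=
  lsup_induction a ha (Subalgebra.zero_mem _) (fun _ _ h h' => Subalgebra.add_mem _ h h')
    fun u b hu => single_mem_polySub u (fun i => hu.2 i (by simp)) b

lemma mem_lsup_of_mem_polySub {a : Laur B (Fin (n + 1))} (ha : a ∈ polySub B n) :
    a ∈ lsup B (fun u => ∀ i, 0 ≤ u i) := by
  obtain ⟨q, rfl⟩ := ha
  induction q using MvPolynomial.induction_on with
  | C b =>
    simp only [AlgHom.toRingHom_eq_coe, RingHom.coe_coe, algHom_C]
    exact single_mem_lsup b (by simp)
  | add p q hp hq => rw [map_add]; exact AddSubgroup.add_mem _ hp hq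
  | mul_X p i hp =>
    rw [map_mul]
    refine mul_mem_lsup (P := fun u : Fin (n + 1) → ℤ => ∀ i, 0 ≤ u i)
      (Q := fun u : Fin (n + 1) → ℤ => ∀ i, 0 ≤ u i) (fun u v hu hv j => add_nonneg (hu j) (hv j)) hp ?_
    simp only [AlgHom.toRingHom_eq_coe, RingHom.coe_coe, aeval_X]
    refine single_mem_lsup _ fun j => ?_
    by_cases h : j = i
    · subst h; simp
    · simp [h]

/-- Homogeneous relations with polynomial coefficients are generated by finitely many. -/
lemma exists_relations [IsNoetherianRing B] {V κ : Type} [AddCommGroup V]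
    [Module (Laur B (Fin (n + 1))) V] [Fintype κ] (g : κ → V) (wt : κ → ℤ) :
    ∃ (κ' : Type) (_ : Fintype κ') (ρ : κ' → κ → Laur B (Fin (n + 1))) (wt' : κ' → ℤ),
      (∀ j, ∑ i, ρ j i • g i = 0) ∧ (∀ j i, ρ j i ∈ lhom B [] (wt' j - wt i)) ∧
      ∀ (l : List (Fin (n + 1))) (w : ℤ) (r : κ → Laur B (Fin (n + 1))),
        (∀ i, r i ∈ lhom B l (w - wt i)) → ∑ i, r i • g i = 0 → FamL (B := B) (n := n) ρ wt' l w r := by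
  classical
  let P := polySub B n
  let Rel : Set (κ → P) := {r | ∃ w, (∀ i, (r i : Laur B (Fin (n + 1))) ∈ lhom B [] (w - wt i)) ∧
    ∑ i, (r i : Laur B (Fin (n + 1))) • g i = 0}
  obtain ⟨s, hs, hspan⟩ := (Submodule.fg_span_iff_fg_span_finset_subset (R := P) Rel).1
    (IsNoetherian.noetherian _)
  choose w' hw' hrel using fun r : s => hs r.2
  refine ⟨s, inferInstance, fun r i => (r.1 i : Laur B (Fin (n + 1))), w', hrel, hw', ?_⟩
  intro l w r hr hr0
  -- clear denominators
  choose N hN using fun i => exists_lmon_mul_mem l _ (r i) (hr i)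
  let M : ℤ := ∑ i, (N i : ℤ)
  obtain ⟨m, hm, hm'⟩ := lmon_mem (B := B) (l := l) M
  have hMi : ∀ i, (N i : ℤ) ≤ M := fun i =>
    Finset.single_le_sum (f := fun i => (N i : ℤ)) (fun _ _ => Int.natCast_nonneg _)
      (Finset.mem_univ i)
  have hq : ∀ i, lmon B l M * r i ∈ lhom B [] (m + w - wt i) := fun i => by
    have := hN i M (hMi i) m hm
    rwa [← add_sub_assoc] at this
  let q : κ → P := fun i => ⟨lmon B l M * r i, lhom_nil_le_polySub (hq i)⟩
  have hqmem : q ∈ Submodule.span P (s : Set (κ → P)) := by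
    rw [← hspan]
    refine Submodule.subset_span ⟨m + w, hq, ?_⟩
    simp only [q, mul_smul]
    rw [← Finset.smul_sum, hr0, smul_zero]
  obtain ⟨f, hf⟩ := Submodule.mem_span_finset'.1 hqmem
  -- homogeneous components of the coefficients
  refine ⟨fun j => lmon B l (-M) *
    lproj B (fun u => ∑ i, u i = m + w - w' j) (f j : Laur B (Fin (n + 1))), ?_, ?_⟩
  · intro j
    have h1 : lproj B (fun u => ∑ i, u i = m + w - w' j) (f j : Laur B (Fin (n + 1)))
        ∈ lhom B l (m + w - w' j) :=
      lsup_mono (fun u hu => ⟨hu.1, fun i _ => hu.2 i⟩)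
        (lproj_mem _ _ (mem_lsup_of_mem_polySub (f j).2))
    have := lhom_mul hm' h1
    rwa [show -m + (m + w - w' j) = w - w' j by ring] at this
  · funext i
    have h1 : lmon B l M * r i =
        ∑ j : s, lproj B (fun u => ∑ i, u i = m + w - w' j) (f j : Laur B (Fin (n + 1))) *
          (j.1 i : Laur B (Fin (n + 1))) := by
      have h2 : lmon B l M * r i = ∑ j : s, (f j : Laur B (Fin (n + 1))) *
          (j.1 i : Laur B (Fin (n + 1))) := by
        have := congrArg (fun x : κ → P => ((x i : P) : Laur B (Fin (n + 1)))) hf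
        simp only [Finset.sum_apply, Pi.smul_apply, smul_eq_mul, AddSubmonoidClass.coe_finsetSum,
          MulMemClass.coe_mul, q] at this
        exact this.symm
      have h3 := lproj_eq_self (lsup_mono (Q := fun u => ∑ i, u i = m + w - wt i)
        (fun u hu => hu.1) (hq i))
      rw [← h3, h2, map_sum]
      refine Finset.sum_congr rfl fun j _ => ?_
      -- projection of a product with a homogeneous element
      have key : ∀ a : Laur B (Fin (n + 1)), ∀ t t' : ℤ, ∀ b ∈ lhom B ([] : List (Fin (n+1))) t',
          lproj B (fun u => ∑ i, u i = t + t') (a * b) = lproj B (fun u => ∑ i, u i = t) a * b := by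
        intro a t t' b hb
        refine lsup_induction (P := fun _ => True) (motive := fun a =>
          lproj B (fun u => ∑ i, u i = t + t') (a * b) = lproj B (fun u => ∑ i, u i = t) a * b)
          a (fun _ _ => trivial) (by simp) ?_ ?_
        · intro a a' h h'; rw [add_mul, map_add, map_add, add_mul, h, h']
        intro u c _
        refine lsup_induction (motive := fun b =>
          lproj B (fun u => ∑ i, u i = t + t') (AddMonoidAlgebra.single u c * b) =
            lproj B (fun u => ∑ i, u i = t) (AddMonoidAlgebra.single u c) * b)
          b hb (by simp) ?_ ?_
        · intro a a' h h'; rw [mul_add, map_add, mul_add, h, h']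
        intro v c' hv
        rw [AddMonoidAlgebra.single_mul_single]
        by_cases h : ∑ i, u i = t
        · rw [lproj_single_of _ (by simp [Finset.sum_add_distrib, h, hv.1]), lproj_single_of _ h,
            AddMonoidAlgebra.single_mul_single]
        · rw [lproj_single_not _ (by simpa [Finset.sum_add_distrib, hv.1] using h),
            lproj_single_not _ h, zero_mul]
      have := key (f j : Laur B (Fin (n + 1))) (m + w - w' j) (w' j - wt i) _ (hw' j i)
      rw [← this]
      congr 2
      funext u
      congr 1
      ring
    calc r i = lmon B l (-M) * (lmon B l M * r i) := by rw [← mul_assoc, lmon_mul_neg, one_mul]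
      _ = _ := by
        rw [h1, Finset.mul_sum, Finset.sum_apply]
        refine Finset.sum_congr rfl fun j _ => ?_
        rw [Pi.smul_apply, smul_eq_mul, mul_assoc]

/-- Serre vanishing, for graded modules given by generators. -/
theorem serre_vanishing [IsNoetherianRing B] (a : ℕ) {V κ : Type} [AddCommGroup V]
    [Module (Laur B (Fin (n + 1))) V] [Fintype κ] (g : κ → V) (wt : κ → ℤ) :
    ∃ t0 : ℤ, ∀ w : ℤ, t0 ≤ w → ∀ c : List (Fin (n + 1)) → V,
      (∀ l : List (Fin (n + 1)), l.Pairwise (· < ·) → l.length = a + 1 → FamL (B := B) (n := n) g wt l w (c l)) →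
      (∀ l : List (Fin (n + 1)), l.Pairwise (· < ·) → l.length = a + 2 → cechD c l = 0) →
      ∃ b : List (Fin (n + 1)) → V,
        (∀ l : List (Fin (n + 1)), l.Pairwise (· < ·) → l.length = a → FamL (B := B) (n := n) g wt l w (b l)) ∧
        ∀ l : List (Fin (n + 1)), l.Pairwise (· < ·) → l.length = a + 1 → cechD b l = c l := by
  classical
  obtain ⟨k, hk⟩ : ∃ k, n + 1 ≤ a + k := ⟨n + 1, by omega⟩
  induction k generalizing a V κ with
  | zero =>
    refine ⟨0, fun w _ c _ _ => ⟨0, ?_, ?_⟩⟩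
    · intro l hl hlen
      exact ⟨0, fun i => AddSubgroup.zero_mem _, by simp⟩
    · intro l hl hlen
      have := length_le_of_sorted l hl
      omega
  | succ k ih =>
    obtain ⟨κ', _, ρ, wt', hρ, hρw, hrel⟩ := exists_relations (B := B) (n := n) g wt
    obtain ⟨t1, ht1⟩ := ih (a + 1) (g := ρ) wt' (by omega)
    refine ⟨max t1 (∑ i, |wt i|), fun w hw c hc hd => ?_⟩
    have hwt : ∀ i, -(n : ℤ) ≤ w - wt i := fun i => by
      have h1 : |wt i| ≤ ∑ i, |wt i| :=
        Finset.single_le_sum (f := fun i => |wt i|) (fun _ _ => abs_nonneg _) (Finset.mem_univ i)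
      have h2 := le_abs_self (wt i)
      have h3 := le_max_right t1 (∑ i, |wt i|)
      omega
    let c' : List (Fin (n + 1)) → κ → Laur B (Fin (n + 1)) := fun l =>
      if h : l.Pairwise (· < ·) ∧ l.length = a + 1 then (hc l h.1 h.2).choose else 0
    have hc'1 : ∀ l : List (Fin (n + 1)), l.Pairwise (· < ·) → l.length = a + 1 →
        ∀ i, c' l i ∈ lhom B l (w - wt i) := fun l h1 h2 => by
      simp only [c', dif_pos (And.intro h1 h2)]
      exact (hc l h1 h2).choose_spec.1
    have hc'2 : ∀ l : List (Fin (n + 1)), l.Pairwise (· < ·) → l.length = a + 1 →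
        c l = ∑ i, c' l i • g i := fun l h1 h2 => by
      simp only [c', dif_pos (And.intro h1 h2)]
      exact (hc l h1 h2).choose_spec.2
    let π : (κ → Laur B (Fin (n + 1))) →ₗ[Laur B (Fin (n + 1))] V :=
      Fintype.linearCombination (Laur B (Fin (n + 1))) g
    have hπ : ∀ x, π x = ∑ i, x i • g i := fun x => Fintype.linearCombination_apply _ _ _
    have hcongr : ∀ l : List (Fin (n + 1)), l.Pairwise (· < ·) → l.length = a + 2 →
        π (cechD c' l) = 0 := fun l h1 h2 => by
      rw [← hd l h1 h2, ← LinearMap.toAddMonoidHom_coe, ← cechD_map]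
      refine cechD_congr _ _ l fun l' hl' hlen => ?_
      rw [hc'2 l' (h1.sublist hl') (by omega)]
      exact hπ _
    have happ : ∀ (x : List (Fin (n + 1)) → κ → Laur B (Fin (n + 1))) l i,
        cechD x l i = cechD (fun l => x l i) l := fun x l i =>
      (cechD_map (Pi.evalAddMonoidHom (fun _ : κ => Laur B (Fin (n + 1))) i) x l).symm
    have hmem : ∀ l : List (Fin (n + 1)), l.Pairwise (· < ·) → l.length = a + 2 →
        ∀ i, cechD c' l i ∈ lhom B l (w - wt i) := fun l h1 h2 i => by
      rw [happ]
      refine cechD_mem _ l fun l' hl' hlen => ?_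
      exact lhom_mono (fun j hj => hl'.subset hj) _ (hc'1 l' (h1.sublist hl') (by omega) i)
    obtain ⟨b', hb'1, hb'2⟩ := ht1 w ((le_max_left _ _).trans hw) (cechD c')
      (fun l h1 h2 => hrel l w _ (hmem l h1 h2) (by rw [← hπ]; exact hcongr l h1 h2))
      (fun l _ _ => cechD_cechD c' l)
    have hb'3 : ∀ l : List (Fin (n + 1)), l.Pairwise (· < ·) → l.length = a + 1 →
        ∀ i, b' l i ∈ lhom B l (w - wt i) := fun l h1 h2 i => by
      obtain ⟨s, hs, hs'⟩ := hb'1 l h1 h2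
      rw [hs', Finset.sum_apply]
      refine AddSubgroup.sum_mem _ fun j _ => ?_
      rw [Pi.smul_apply, smul_eq_mul]
      have := lhom_mul (hs j) (lhom_mono (l' := l) (by simp) _ (hρw j i))
      rwa [show w - wt' j + (wt' j - wt i) = w - wt i by ring] at this
    have hb'4 : ∀ l : List (Fin (n + 1)), l.Pairwise (· < ·) → l.length = a + 1 →
        π (b' l) = 0 := fun l h1 h2 => by
      obtain ⟨s, hs, hs'⟩ := hb'1 l h1 h2
      rw [hs', map_sum]
      refine Finset.sum_eq_zero fun j _ => ?_
      rw [map_smul, hπ, hρ, smul_zero]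
    choose b hb1 hb2 using fun i => cech_free (B := B) a (w - wt i) (Or.inr (hwt i))
      (fun l => c' l i - b' l i)
      (fun l h1 h2 => AddSubgroup.sub_mem _ (hc'1 l h1 h2 i) (hb'3 l h1 h2 i))
      (fun l h1 h2 => by rw [cechD_sub, ← happ, ← happ, hb'2 l h1 h2, sub_self])
    refine ⟨fun l => π fun i => b i l, fun l h1 h2 => ⟨fun i => b i l, fun i => hb1 i l h1 h2,
      hπ _⟩, fun l h1 h2 => ?_⟩
    have h3 : cechD (fun l => π fun i => b i l) l = π (cechD (fun l i => b i l) l) :=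
      cechD_map π.toAddMonoidHom _ l
    have h4 : cechD (fun l i => b i l) l = c' l - b' l := by
      funext i
      rw [happ]
      exact hb2 i l h1 h2
    rw [h3, h4, map_sub, hb'4 l h1 h2, sub_zero, hπ, hc'2 l h1 h2]

end Serre

end

section

/-- The Koszul differential on cochains indexed by lists of indices. -/
def kosD {ι V : Type*} [AddCommGroup V] (φ : ι → V →+ V) : (List ι → V) → List ι → V
  | _, [] => 0
  | c, α :: l => φ α (c l) - kosD φ (fun l' => c (α :: l')) l

section Koszul
variable {ι V W : Type*} [AddCommGroup V] [AddCommGroup W] (φ : ι → V →+ V)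

@[simp] lemma kosD_nil (c : List ι → V) : kosD φ c [] = 0 := by simp [kosD]

lemma kosD_cons (c : List ι → V) (α : ι) (l : List ι) :
    kosD φ c (α :: l) = φ α (c l) - kosD φ (fun l' => c (α :: l')) l := by
  rw [kosD]

lemma kosD_map (φ' : ι → W →+ W) (ψ : V →+ W) (h : ∀ i x, ψ (φ i x) = φ' i (ψ x))
    (c : List ι → V) (l : List ι) :
    kosD φ' (fun l => ψ (c l)) l = ψ (kosD φ c l) := by
  induction l generalizing c with
  | nil => simp
  | cons α l ih => simp only [kosD_cons, ih, map_sub, h]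

lemma kosD_add (c c' : List ι → V) (l : List ι) :
    kosD φ (fun l => c l + c' l) l = kosD φ c l + kosD φ c' l := by
  induction l generalizing c c' with
  | nil => simp
  | cons α l ih => simp only [kosD_cons, ih, map_add]; abel

lemma kosD_sub (c c' : List ι → V) (l : List ι) :
    kosD φ (fun l => c l - c' l) l = kosD φ c l - kosD φ c' l := by
  induction l generalizing c c' with
  | nil => simp
  | cons α l ih => simp only [kosD_cons, ih, map_sub]; abel

lemma kosD_zero (l : List ι) : kosD φ (fun _ : List ι => (0 : V)) l = 0 := by
  simpa using kosD_sub φ (fun _ => (0 : V)) (fun _ => 0) l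

lemma kosD_kosD (h : ∀ i j x, φ i (φ j x) = φ j (φ i x)) (c : List ι → V) (l : List ι) :
    kosD φ (kosD φ c) l = 0 := by
  induction l generalizing c with
  | nil => simp
  | cons α l ih =>
    rw [kosD_cons]
    have : (fun l' => kosD φ c (α :: l')) =
        fun l' => φ α (c l') - kosD φ (fun l' => c (α :: l')) l' := by
      funext l'; rw [kosD_cons]
    rw [this, kosD_sub, ih, kosD_map φ φ (φ α) (fun i x => h _ _ _)]; simp

lemma kosD_congr (c c' : List ι → V) (l : List ι)
    (h : ∀ l', l'.Sublist l → l'.length + 1 = l.length → c l' = c' l') :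
    kosD φ c l = kosD φ c' l := by
  induction l generalizing c c' with
  | nil => simp
  | cons α l ih =>
    rw [kosD_cons, kosD_cons, h l (List.sublist_cons_self α l) (by simp)]
    congr 1
    apply ih
    intro l' hl' hlen
    exact h (α :: l') (hl'.cons_cons α) (by simp [hlen])

lemma kosD_mem {P Q : AddSubgroup V} (hPQ : ∀ i, ∀ x ∈ P, φ i x ∈ Q) (c : List ι → V)
    (l : List ι) (h : ∀ l', l'.Sublist l → l'.length + 1 = l.length → c l' ∈ P) :
    kosD φ c l ∈ Q := by
  induction l generalizing c with
  | nil => simp [Q.zero_mem]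
  | cons α l ih =>
    rw [kosD_cons]
    refine Q.sub_mem (hPQ _ _ (h l (List.sublist_cons_self α l) (by simp))) (ih _ ?_)
    intro l' hl' hlen
    exact h (α :: l') (hl'.cons_cons α) (by simp [hlen])

/-- The Čech and Koszul differentials commute. -/
lemma cechD_kosD {κ : Type*} (c : List κ → List ι → V) (l : List κ) (m : List ι) :
    cechD (fun l => kosD φ (c l)) l m = kosD φ (cechD c l) m := by
  induction l generalizing c with
  | nil => rw [cechD_nil, cechD_nil]; exact (kosD_zero φ m).symm
  | cons α l ih =>
    rw [cechD_cons, cechD_cons, Pi.sub_apply, ih fun l' => c (α :: l')]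
    exact (kosD_sub φ _ _ m).symm

lemma cechD_apply {κ : Type*} (c : List κ → List ι → V) (l : List κ) (m : List ι) :
    cechD c l m = cechD (fun l => c l m) l :=
  (cechD_map (Pi.evalAddMonoidHom (fun _ : List ι => V) m) c l).symm

variable [LinearOrder ι]

lemma kosD_cechH (i : ι) (c : List ι → V) (l : List ι) (hl : l.Pairwise (· < ·)) :
    kosD φ (cechH i c) l + cechH i (kosD φ c) l = φ i (c l) := by
  induction l generalizing c with
  | nil => simp [cechH, kosD_cons]
  | cons α l ih =>
    have hl' := List.pairwise_cons.1 hl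
    rw [kosD_cons]
    rcases lt_trichotomy i α with h | h | h
    · have h1 : cechH i c l = c (i :: l) :=
        cechH_of_lt i c l fun j hj => h.trans (hl'.1 j hj)
      have h2 : kosD φ (fun l' => cechH i c (α :: l')) l
          = kosD φ (fun l' => c (i :: α :: l')) l := by
        refine congrArg (fun g => kosD φ g l) ?_
        funext l'
        simp [cechH, h]
      have h3 : cechH i (kosD φ c) (α :: l) = kosD φ c (i :: α :: l) := by simp [cechH, h]
      rw [h1, h2, h3, kosD_cons, kosD_cons]; abel
    · subst h
      have h1 : cechH i c l = c (i :: l) := cechH_of_lt i c l hl'.1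
      have h2 : (fun l' => cechH i c (i :: l')) = fun _ => 0 := by
        funext l'; simp [cechH]
      have h3 : cechH i (kosD φ c) (i :: l) = 0 := by simp [cechH]
      rw [h1, h2, h3, kosD_zero]; abel
    · have hn : ¬ i < α := not_lt.2 h.le
      have hn' : ¬ i = α := h.ne'
      have h2 : (fun l' => cechH i c (α :: l')) = fun l' => -cechH i (fun l' => c (α :: l')) l' := by
        funext l'; simp [cechH, hn, hn']
      have h3 : cechH i (kosD φ c) (α :: l)
          = - (φ α (cechH i c l) - cechH i (kosD φ fun l' => c (α :: l')) l) := by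
        have hmap : ∀ (ψ : V →+ V) (c : List ι → V) (l : List ι),
            cechH i (fun l => ψ (c l)) l = ψ (cechH i c l) := by
          intro ψ c l
          induction l generalizing c with
          | nil => simp [cechH]
          | cons β l ih => simp only [cechH]; split_ifs <;> simp [ih]
        simp only [cechH, hn, hn', if_false]
        rw [← hmap, ← cechH_neg_sub]
        congr 2
      have h4 : kosD φ (fun l' => -cechH i (fun l' => c (α :: l')) l') l
          = -kosD φ (cechH i (fun l' => c (α :: l'))) l :=
        kosD_map φ φ (-AddMonoidHom.id V) (by simp) _ l
      rw [h2, h3, h4]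
      have := ih (fun l' => c (α :: l')) hl'.2
      rw [← this]; abel

/-- Koszul complexes with an invertible operator are exact. -/
lemma kosD_exact {P Q : AddSubgroup V} (i : ι) (ψ : V →+ V) (hψ : ∀ x, φ i (ψ x) = x)
    (hψ' : ∀ j x, ψ (φ j x) = φ j (ψ x)) (hP : ∀ x ∈ P, ψ x ∈ Q)
    (s : ℕ) (c : List ι → V)
    (hc : ∀ m : List ι, m.Pairwise (· < ·) → m.length = s + 1 → c m ∈ P)
    (hd : ∀ m : List ι, m.Pairwise (· < ·) → m.length = s + 2 → kosD φ c m = 0) :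
    ∃ b : List ι → V, (∀ m : List ι, m.Pairwise (· < ·) → m.length = s → b m ∈ Q) ∧
      ∀ m : List ι, m.Pairwise (· < ·) → m.length = s + 1 → kosD φ b m = c m := by
  refine ⟨fun l => ψ (cechH i c l), fun m hm hlen => hP _ ?_, fun m hm hlen => ?_⟩
  · exact cechH_mem i c m hm fun l' h1 h2 _ => hc l' h1 (by omega)
  · rw [kosD_map φ φ ψ hψ' (cechH i c)]
    have h1 := kosD_cechH φ i c m hm
    have h2 : cechH i (kosD φ c) m ∈ (⊥ : AddSubgroup V) :=
      cechH_mem i _ m hm fun l' h1 h2 _ => by rw [hd l' h1 (by omega)]; exact AddSubgroup.zero_mem _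
    rw [AddSubgroup.mem_bot] at h2
    rw [h2, add_zero] at h1
    rw [h1, hψ', hψ]

end Koszul

end

section

section ToL
variable {B : Type} [CommRing B] {n : ℕ}

/-- Projection onto a graded piece commutes with multiplication by homogeneous elements. -/
lemma lproj_mul (t t' : ℤ) (a b : Laur B (Fin (n + 1)))
    (hb : b ∈ lsup B fun u => ∑ i, u i = t') :
    lproj B (fun u => ∑ i, u i = t + t') (a * b) = lproj B (fun u => ∑ i, u i = t) a * b := by
  refine lsup_induction (P := fun _ => True) (motive := fun a =>
    lproj B (fun u => ∑ i, u i = t + t') (a * b) = lproj B (fun u => ∑ i, u i = t) a * b)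
    a (fun _ _ => trivial) (by simp) ?_ ?_
  · intro a a' h h'; rw [add_mul, map_add, map_add, add_mul, h, h']
  intro u c _
  refine lsup_induction (motive := fun b =>
    lproj B (fun u => ∑ i, u i = t + t') (AddMonoidAlgebra.single u c * b) =
      lproj B (fun u => ∑ i, u i = t) (AddMonoidAlgebra.single u c) * b)
    b hb (by simp) ?_ ?_
  · intro a a' h h'; rw [mul_add, map_add, mul_add, h, h']
  intro v c' hv
  rw [AddMonoidAlgebra.single_mul_single]
  by_cases h : ∑ i, u i = t
  · rw [lproj_single_of _ (by simp [Finset.sum_add_distrib, h, hv]), lproj_single_of _ h,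
      AddMonoidAlgebra.single_mul_single]
  · rw [lproj_single_not _ (by simpa [Finset.sum_add_distrib, hv] using h),
      lproj_single_not _ h, zero_mul]

/-- Polynomials as Laurent polynomials. -/
def toL (B : Type) [CommRing B] (n : ℕ) :
    MvPolynomial (Fin (n + 1)) B →ₐ[B] Laur B (Fin (n + 1)) :=
  MvPolynomial.aeval fun i : Fin (n + 1) =>
    (AddMonoidAlgebra.single (Pi.single i (1 : ℤ)) (1 : B) : Laur B (Fin (n + 1)))

lemma toL_X (i : Fin (n + 1)) : toL B n (X i) = AddMonoidAlgebra.single (Pi.single i (1 : ℤ)) 1 := by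
  simp [toL]

lemma toL_monomial (u : Fin (n + 1) →₀ ℕ) (b : B) :
    toL B n (monomial u b) = AddMonoidAlgebra.single (fun i => (u i : ℤ)) b := by
  induction u using Finsupp.induction_linear generalizing b with
  | zero =>
    change toL B n (C b) = _
    rw [toL, MvPolynomial.aeval_C]
    rfl
  | add u v hu hv =>
    have : monomial (u + v) b = monomial u b * monomial v (1 : B) := by simp
    rw [this, map_mul, hu, hv, AddMonoidAlgebra.single_mul_single, mul_one]
    congr 1
  | single i k =>
    have : monomial (Finsupp.single i k) b = C b * X i ^ k := by
      rw [MvPolynomial.C_mul_X_pow_eq_monomial]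
    rw [this, map_mul, map_pow, toL_X, AddMonoidAlgebra.single_pow, toL, MvPolynomial.aeval_C]
    change AddMonoidAlgebra.single 0 b * _ = _
    rw [AddMonoidAlgebra.single_mul_single]
    congr 1
    · funext j
      by_cases h : j = i
      · subst h; simp
      · simp [h]
    · simp

lemma toL_coeff (p : MvPolynomial (Fin (n + 1)) B) (u : Fin (n + 1) →₀ ℕ) :
    (toL B n p).coeff (fun i => (u i : ℤ)) = p.coeff u := by
  classical
  induction p using MvPolynomial.induction_on' with
  | monomial v b =>
    rw [toL_monomial, AddMonoidAlgebra.coeff_single, Finsupp.single_apply, MvPolynomial.coeff_monomial]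
    have : (fun i => (v i : ℤ)) = (fun i => (u i : ℤ)) ↔ v = u := by
      constructor
      · intro h; ext i; exact_mod_cast congrFun h i
      · rintro rfl; rfl
    simp [this]
  | add p q hp hq => simp [hp, hq]

lemma toL_injective : Function.Injective (toL B n) := by
  intro p q h
  ext u
  rw [← toL_coeff, h, toL_coeff]

lemma toL_mem_lsup (p : MvPolynomial (Fin (n + 1)) B) :
    toL B n p ∈ lsup B (fun u => ∀ i, 0 ≤ u i) := by
  induction p using MvPolynomial.induction_on' with
  | monomial v b => rw [toL_monomial]; exact single_mem_lsup _ fun i => by simp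
  | add p q hp hq => rw [map_add]; exact AddSubgroup.add_mem _ hp hq

lemma exists_toL {a : Laur B (Fin (n + 1))} (ha : a ∈ lsup B (fun u => ∀ i, 0 ≤ u i)) :
    ∃ p, toL B n p = a := by
  refine lsup_induction (motive := fun a => ∃ p, toL B n p = a) a ha ⟨0, map_zero _⟩ ?_ ?_
  · rintro _ _ ⟨p, rfl⟩ ⟨q, rfl⟩; exact ⟨p + q, map_add _ _ _⟩
  · intro u b hu
    refine ⟨monomial (Finsupp.equivFunOnFinite.symm fun i => (u i).toNat) b, ?_⟩
    rw [toL_monomial]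
    congr 1; funext i; simp [hu i]

lemma toL_mem_lhom {p : MvPolynomial (Fin (n + 1)) B} {d : ℕ} (hp : p.IsHomogeneous d)
    (l : List (Fin (n + 1))) : toL B n p ∈ lhom B l d := by
  rw [p.as_sum, map_sum]
  refine AddSubgroup.sum_mem _ fun u hu => ?_
  rw [toL_monomial]
  refine single_mem_lsup _ ⟨?_, fun i _ => by simp⟩
  have := hp (MvPolynomial.mem_support_iff.1 hu)
  rw [← this, Finsupp.weight_apply, Finsupp.sum_fintype _ _ (by simp)]
  simp

lemma isHomogeneous_of_toL_mem {p : MvPolynomial (Fin (n + 1)) B} {d : ℕ}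
    (hp : toL B n p ∈ lsup B fun u => ∑ i, u i = (d : ℤ)) : p.IsHomogeneous d := by
  intro u hu
  have : ∑ i, (u i : ℤ) = d := hp (fun i => (u i : ℤ)) (by rwa [toL_coeff])
  rw [Finsupp.weight_apply, Finsupp.sum_fintype _ _ (by simp)]
  simpa using (by exact_mod_cast this : ∑ i, u i = d)

lemma lproj_toL (p : MvPolynomial (Fin (n + 1)) B) (t : ℤ) :
    lproj B (fun u => ∑ i, u i = t) (toL B n p)
      = if 0 ≤ t then toL B n (homogeneousComponent t.toNat p) else 0 := by
  induction p using MvPolynomial.induction_on' with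
  | monomial v b =>
    have hsum : v.degree = ∑ i, v i := by rw [Finsupp.degree_eq_sum]
    have hh : (monomial v b).IsHomogeneous (∑ i, v i) := by
      rw [← hsum]; exact isHomogeneous_monomial b rfl
    rw [homogeneousComponent_of_mem hh, toL_monomial]
    by_cases h : ∑ i, (v i : ℤ) = t
    · have h1 : t.toNat = ∑ i, v i := by rw [← h]; norm_cast
      have h0 : 0 ≤ t := by rw [← h]; positivity
      rw [lproj_single_of _ h, if_pos h0, h1, if_pos rfl, toL_monomial]
    · rw [lproj_single_not _ h]
      split_ifs with h0 h1
      · exfalso; apply h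
        have : (t.toNat : ℤ) = t := Int.toNat_of_nonneg h0
        rw [← this, h1]; push_cast; rfl
      · simp
      · rfl
  | add p q hp hq => rw [map_add, map_add, hp, hq, map_add]; split_ifs <;> simp

/-- The power of the product of the variables in `l`. -/
def pmon (B : Type) [CommRing B] (l : List (Fin (n + 1))) (M : ℕ) : MvPolynomial (Fin (n + 1)) B :=
  monomial (Finsupp.equivFunOnFinite.symm fun i => if i ∈ l then M else 0) 1

lemma toL_pmon (l : List (Fin (n + 1))) (M : ℕ) : toL B n (pmon B l M) = lmon B l M := by
  rw [pmon, toL_monomial, lmon]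
  congr 1; funext i; simp

lemma pmon_add (l : List (Fin (n + 1))) (M M' : ℕ) :
    pmon B l (M + M') = pmon B l M * pmon B l M' := by
  rw [pmon, pmon, pmon, MvPolynomial.monomial_mul, mul_one]
  congr 2; ext i; rw [Finsupp.add_apply]; by_cases h : i ∈ l <;> simp [h]

lemma lmon_add (l : List (Fin (n + 1))) (M M' : ℤ) :
    lmon B l (M + M') = lmon B l M * lmon B l M' := by
  rw [lmon, lmon, lmon, AddMonoidAlgebra.single_mul_single, mul_one]
  congr 1; funext i; simp only [Pi.add_apply]; split_ifs <;> simp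

lemma lmon_zero (l : List (Fin (n + 1))) : lmon B l 0 = 1 := by
  rw [lmon, AddMonoidAlgebra.one_def]; congr 1; funext i; simp

lemma lmon_cancel (l : List (Fin (n + 1))) (M : ℤ) {x y : Laur B (Fin (n + 1))}
    (h : lmon B l M * x = lmon B l M * y) : x = y := by
  have := congrArg (fun z => lmon B l (-M) * z) h
  simpa [← mul_assoc, lmon_mul_neg] using this

/-- Degree of `lmon`. -/
lemma lmon_mem' (l : List (Fin (n + 1))) (M : ℤ) (l' : List (Fin (n + 1)))
    (h : 0 ≤ M ∨ ∀ i ∈ l, i ∈ l') :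
    lmon B l M ∈ lhom B l' (∑ i, if i ∈ l then M else 0) := by
  refine single_mem_lsup _ ⟨rfl, fun i hi => ?_⟩
  rcases h with h | h
  · dsimp only; split_ifs <;> simp [h]
  · have : i ∉ l := fun h' => hi (h i h')
    simp [this]

/-- The degree-`t` part of the localization of an ideal at the product of variables in `l`. -/
def GG (𝔞 : Ideal (MvPolynomial (Fin (n + 1)) B)) (l : List (Fin (n + 1))) (t : ℤ) :
    AddSubgroup (Laur B (Fin (n + 1))) where
  carrier := {x | x ∈ lhom B l t ∧ ∃ M : ℕ, ∃ p ∈ 𝔞, lmon B l M * x = toL B n p}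
  zero_mem' := ⟨AddSubgroup.zero_mem _, 0, 0, 𝔞.zero_mem, by simp⟩
  add_mem' := by
    rintro x y ⟨hx, M, p, hp, hxp⟩ ⟨hy, M', p', hp', hyp⟩
    refine ⟨AddSubgroup.add_mem _ hx hy, M + M', pmon B l M' * p + pmon B l M * p',
      𝔞.add_mem (𝔞.mul_mem_left _ hp) (𝔞.mul_mem_left _ hp'), ?_⟩
    rw [map_add, map_mul, map_mul, toL_pmon, toL_pmon, ← hxp, ← hyp]
    push_cast
    rw [lmon_add]; ring
  neg_mem' := by
    rintro x ⟨hx, M, p, hp, hxp⟩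
    exact ⟨AddSubgroup.neg_mem _ hx, M, -p, 𝔞.neg_mem hp, by rw [mul_neg, hxp, map_neg]⟩

variable {𝔞 𝔟 : Ideal (MvPolynomial (Fin (n + 1)) B)} {l l' : List (Fin (n + 1))} {t : ℤ}

lemma GG_le_lhom : GG 𝔞 l t ≤ lhom B l t := fun _ h => h.1

lemma exists_forall_GG {x : Laur B (Fin (n + 1))} (hx : x ∈ GG 𝔞 l t) :
    ∃ M0 : ℕ, ∀ M, M0 ≤ M → ∃ p ∈ 𝔞, lmon B l M * x = toL B n p := by
  obtain ⟨-, M0, p, hp, hxp⟩ := hx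
  refine ⟨M0, fun M hM => ⟨pmon B l (M - M0) * p, 𝔞.mul_mem_left _ hp, ?_⟩⟩
  rw [map_mul, toL_pmon, ← hxp, ← mul_assoc, ← lmon_add]
  congr 2; omega

lemma GG_mono_ideal (h : 𝔞 ≤ 𝔟) : GG 𝔞 l t ≤ GG 𝔟 l t :=
  fun _ ⟨hx, M, p, hp, hxp⟩ => ⟨hx, M, p, h hp, hxp⟩

lemma mem_GG_of_mul {x : Laur B (Fin (n + 1))} (hx : x ∈ lhom B l t)
    (p : MvPolynomial (Fin (n + 1)) B) (hp : p ∈ 𝔞)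
    (v : Fin (n + 1) →₀ ℕ) (hv : ∀ i, v i ≠ 0 → i ∈ l)
    (h : AddMonoidAlgebra.single (fun i => (v i : ℤ)) 1 * x = toL B n p) : x ∈ GG 𝔞 l t := by
  refine ⟨hx, ∑ i, v i, monomial (Finsupp.equivFunOnFinite.symm fun i =>
    if i ∈ l then ∑ i, v i - v i else 0) 1 * p, 𝔞.mul_mem_left _ hp, ?_⟩
  rw [map_mul, ← h, toL_monomial, ← mul_assoc, AddMonoidAlgebra.single_mul_single, lmon, mul_one]
  congr 2; funext i
  have : v i ≤ ∑ i, v i := Finset.single_le_sum (f := fun i => v i) (fun _ _ => Nat.zero_le _) (Finset.mem_univ i)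
  by_cases hi : i ∈ l
  · have h2 : ((∑ i, v i - v i : ℕ) : ℤ) = ((∑ i, v i : ℕ) : ℤ) - v i := Nat.cast_sub this
    simp only [Finsupp.coe_equivFunOnFinite_symm, Pi.add_apply, hi, if_true, h2]; ring
  · have : v i = 0 := by by_contra h'; exact hi (hv i h')
    simp [hi, this]

lemma GG_mono_list (h : ∀ i ∈ l, i ∈ l') : GG 𝔞 l t ≤ GG 𝔞 l' t := by
  rintro x ⟨hx, M, p, hp, hxp⟩
  refine mem_GG_of_mul (lhom_mono h t hx) p hp
    (Finsupp.equivFunOnFinite.symm fun i => if i ∈ l then M else 0) ?_ ?_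
  · intro i hi
    by_contra h'
    have : i ∉ l := fun h'' => h' (h i h'')
    simp [this] at hi
  · rw [← hxp, lmon]; congr 2; funext i; simp

lemma GG_top : GG (⊤ : Ideal (MvPolynomial (Fin (n + 1)) B)) l t = lhom B l t := by
  refine le_antisymm GG_le_lhom fun x hx => ⟨hx, ?_⟩
  obtain ⟨N, hN⟩ := exists_lmon_mul_mem l t x hx
  obtain ⟨s, hs, -⟩ := lmon_mem (B := B) (l := l) (N : ℤ)
  obtain ⟨p, hp⟩ := exists_toL (lsup_mono (fun u hu i => hu.2 i (by simp)) (hN N le_rfl s hs))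
  exact ⟨N, p, trivial, hp.symm⟩

lemma GG_mul {x y : Laur B (Fin (n + 1))} {s : ℤ} (hx : x ∈ GG 𝔞 l s) (hy : y ∈ GG 𝔟 l t) :
    x * y ∈ GG (𝔞 * 𝔟) l (s + t) := by
  obtain ⟨hx, M, p, hp, hxp⟩ := hx
  obtain ⟨hy, M', p', hp', hyp⟩ := hy
  refine ⟨lhom_mul hx hy, M + M', p * p', Ideal.mul_mem_mul hp hp', ?_⟩
  rw [map_mul, ← hxp, ← hyp]
  push_cast
  rw [lmon_add]; ring

lemma GG_mul_left {x y : Laur B (Fin (n + 1))} {s : ℤ} (hx : x ∈ lhom B l s) (hy : y ∈ GG 𝔟 l t) :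
    x * y ∈ GG 𝔟 l (s + t) := by
  rw [← GG_top] at hx
  simpa [Ideal.top_mul] using GG_mul hx hy

lemma toL_mem_GG {p : MvPolynomial (Fin (n + 1)) B} {d : ℕ} (hp : p.IsHomogeneous d)
    (hpa : p ∈ 𝔞) : toL B n p ∈ GG 𝔞 l d :=
  ⟨toL_mem_lhom hp l, 0, p, hpa, by simp [lmon_zero]⟩

/-- Clearing denominators in one variable. -/
lemma GG_clear {x : Laur B (Fin (n + 1))} (j : Fin (n + 1)) (hl : ∀ i ∈ l', i = j ∨ i ∈ l)
    (hx : x ∈ GG 𝔞 l' t) : ∃ P0 : ℕ, ∀ P, P0 ≤ P →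
      toL B n (X j ^ P) * x ∈ GG 𝔞 l (t + P) := by
  obtain ⟨P0, hP0⟩ := exists_lmon_mul_mem l' t x hx.1
  have hxl := hx.1
  obtain ⟨-, M, p, hp, hxp⟩ := hx
  have hX : ∀ P : ℕ, toL B n (X j ^ P) = AddMonoidAlgebra.single (Pi.single j (P : ℤ)) 1 := by
    intro P
    rw [map_pow, toL_X, AddMonoidAlgebra.single_pow, ← Pi.single_smul]; simp
  refine ⟨P0 + M, fun P hP => ?_⟩
  have hmem : toL B n (X j ^ P) * x ∈ lhom B l (t + P) := by
    have h1 : toL B n (X j ^ P) * x ∈ lhom B l' (P + t) :=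
      lhom_mul (toL_mem_lhom (isHomogeneous_X_pow j P) _) hxl
    rw [add_comm (P : ℤ) t] at h1
    refine fun v hv => ⟨(h1 v hv).1, fun i hi => ?_⟩
    by_cases hi' : i ∈ l'
    · obtain rfl : i = j := (hl i hi').resolve_right hi
      rw [hX] at hv
      have h2 := AddMonoidAlgebra.support_coeff_single_mul_subset x (1 : B)
        (Pi.single i (P : ℤ)) (Finsupp.mem_support_iff.2 hv)
      obtain ⟨u, hu, rfl⟩ := Finset.mem_image.1 h2
      obtain ⟨s, hs, -⟩ := lmon_mem (B := B) (l := l') (P0 : ℤ)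
      have h3 := hP0 P0 le_rfl s hs
      have h4 : (lmon B l' (P0 : ℤ) * x).coeff ((fun i => if i ∈ l' then (P0 : ℤ) else 0) + u) ≠ 0 := by
        rw [lmon, AddMonoidAlgebra.coeff_single_mul_add]
        simpa using Finsupp.mem_support_iff.1 hu
      have h5 := (h3 _ h4).2 i (by simp)
      simp only [Pi.add_apply, hi', if_true] at h5
      simp only [Pi.add_apply, Pi.single_eq_same]
      omega
    · exact (h1 v hv).2 i hi'
  refine mem_GG_of_mul hmem (X j ^ (P - (if j ∈ l' ∧ j ∉ l then M else 0)) * p)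
    (𝔞.mul_mem_left _ hp)
    (Finsupp.equivFunOnFinite.symm fun i => if i ∈ l' ∧ i ∈ l then M else 0) ?_ ?_
  · intro i hi
    by_contra h'
    simp [h'] at hi
  · rw [map_mul, ← hxp, ← mul_assoc, ← mul_assoc, hX, hX, lmon, AddMonoidAlgebra.single_mul_single,
      AddMonoidAlgebra.single_mul_single]
    congr 2; funext i
    by_cases hij : i = j
    · subst hij
      by_cases h1 : i ∈ l' <;> by_cases h2 : i ∈ l <;> simp [h1, h2]
      · ring
      · have : M ≤ P := by omega
        rw [Nat.cast_sub this]; ring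
    · by_cases h1 : i ∈ l'
      · have h2 := (hl i h1).resolve_left hij
        simp [h1, h2, hij]
      · simp [h1, hij]

attribute [local instance] MvPolynomial.gradedAlgebra in
lemma lproj_mem_GG (ha : 𝔞.IsHomogeneous (homogeneousSubmodule (Fin (n + 1)) B))
    {x : Laur B (Fin (n + 1))} {M : ℕ} {p : MvPolynomial (Fin (n + 1)) B} (hp : p ∈ 𝔞)
    (hxp : lmon B l M * x = toL B n p) : lproj B (fun u => ∑ i, u i = t) x ∈ GG 𝔞 l t := by
  have hm := lmon_mem' (B := B) l M l (Or.inr fun _ h => h)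
  set s : ℤ := ∑ i, if i ∈ l then (M : ℤ) else 0
  have h0 : lmon B l M * lproj B (fun u => ∑ i, u i = t) x
      = lproj B (fun u => ∑ i, u i = t + s) (toL B n p) := by
    rw [← hxp, mul_comm (lmon B l M) x, lproj_mul t s x _ (lsup_mono (fun _ h => h.1) hm), mul_comm]
  have hm' := lmon_mem' (B := B) l (-M) l (Or.inr fun _ h => h)
  have hs : (∑ i, if i ∈ l then (-M : ℤ) else 0) = -s := by
    rw [← Finset.sum_neg_distrib]
    exact Finset.sum_congr rfl fun i _ => by split_ifs <;> simp
  rw [hs] at hm'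
  refine ⟨?_, ?_⟩
  · have h1 : lproj B (fun u => ∑ i, u i = t) x = lmon B l (-M) *
        lproj B (fun u => ∑ i, u i = t + s) (toL B n p) := by
      rw [← h0, ← mul_assoc, lmon_mul_neg, one_mul]
    rw [h1]
    have := lhom_mul hm' (b := lproj B (fun u => ∑ i, u i = t + s) (toL B n p)) (t := t + s)
      (lsup_mono (fun u hu => ⟨hu.1, fun i _ => hu.2 i⟩) (lproj_mem _ _ (toL_mem_lsup p)))
    rwa [neg_add_cancel_comm_assoc] at this
  · rw [lproj_toL] at h0
    split_ifs at h0 with h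
    · exact ⟨M, _, homogeneousComponent_mem_of_mem ha hp _, h0⟩
    · exact ⟨M, 0, 𝔞.zero_mem, by rw [h0, map_zero]⟩

/-- Ideals which agree on a nonempty localization. -/
lemma GG_le_of_pow_mul_mem {I J : Ideal (MvPolynomial (Fin (n + 1)) B)} (M : ℕ)
    (a : Fin (n + 1)) (hIJ : ∀ p ∈ I, X a ^ M * p ∈ J) (hl : a ∈ l) (N : ℕ) :
    GG (I ^ N) l t ≤ GG (J ^ N) l t := by
  rintro x ⟨hx, M', p, hp, hxp⟩
  have h1 : X a ^ (M * N) * p ∈ J ^ N := by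
    have h2 : Ideal.span {(X a : MvPolynomial (Fin (n + 1)) B) ^ M} * I ≤ J := by
      rw [Ideal.span_singleton_mul_le_iff]
      exact hIJ
    have h3 := Ideal.pow_right_mono h2 N
    rw [mul_pow, Ideal.span_singleton_pow, ← pow_mul] at h3
    exact h3 (Ideal.mul_mem_mul (Ideal.mem_span_singleton_self _) hp)
  refine mem_GG_of_mul hx _ h1
    (Finsupp.equivFunOnFinite.symm fun i => (if i ∈ l then M' else 0) + Pi.single (M := fun _ => ℕ) a (M * N) i) ?_ ?_
  · intro i hi
    by_contra h'
    have : i ≠ a := fun h => h' (h ▸ hl)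
    simp [h', this] at hi
  · rw [map_mul, ← hxp, ← mul_assoc, map_pow, toL_X, AddMonoidAlgebra.single_pow, lmon,
      AddMonoidAlgebra.single_mul_single, ← Pi.single_smul]
    congr 2
    · funext i
      by_cases h : i = a
      · subst h; simp; ring
      · simp [h]
    · simp

end ToL

end

section

section Double
variable {ι V : Type} [LinearOrder ι] [AddCommGroup V]

/-- Double cochains with values in the given groups, on increasing lists. -/
def DCoch (E : List ι → ℕ → AddSubgroup V) (a s : ℕ) (c : List ι → List ι → V) : Prop :=
  ∀ l : List ι, l.Pairwise (· < ·) → l.length = a → ∀ m : List ι, m.Pairwise (· < ·) →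
    m.length = s → c l m ∈ E l s

/-- Equality of double cochains in a given bidegree. -/
def DEq (a s : ℕ) (c c' : List ι → List ι → V) : Prop :=
  ∀ l : List ι, l.Pairwise (· < ·) → l.length = a → ∀ m : List ι, m.Pairwise (· < ·) →
    m.length = s → c l m = c' l m

variable {E : List ι → ℕ → AddSubgroup V} {φ : ι → V →+ V} {a s : ℕ}
  {c c' c'' : List ι → List ι → V}

lemma DEq.trans (h : DEq a s c c') (h' : DEq a s c' c'') : DEq a s c c'' :=
  fun l hl hl' m hm hm' => (h l hl hl' m hm hm').trans (h' l hl hl' m hm hm')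

lemma DEq.symm (h : DEq a s c c') : DEq a s c' c :=
  fun l hl hl' m hm hm' => (h l hl hl' m hm hm').symm

lemma DEq.cech (h : DEq a s c c') : DEq (a + 1) s (cechD c) (cechD c') := by
  intro l hl hlen m hm hm'
  rw [cechD_apply, cechD_apply c']
  exact cechD_congr _ _ l fun l' h1 h2 => h l' (hl.sublist h1) (by omega) m hm hm'

lemma DEq.kos (h : DEq a s c c') :
    DEq a (s + 1) (fun l => kosD φ (c l)) (fun l => kosD φ (c' l)) := by
  intro l hl hlen m hm hm'
  exact kosD_congr φ _ _ m fun m' h1 h2 => h l hl hlen m' (hm.sublist h1) (by omega)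

lemma DEq.cech_kos : DEq a s (cechD fun l => kosD φ (c l)) (fun l => kosD φ (cechD c l)) :=
  fun l _ _ m _ _ => cechD_kosD φ c l m

lemma DCoch.cech (hE : ∀ l l' : List ι, l'.Sublist l → ∀ s, E l' s ≤ E l s)
    (h : DCoch E a s c) : DCoch E (a + 1) s (cechD c) := by
  intro l hl hlen m hm hm'
  rw [cechD_apply]
  exact cechD_mem _ l fun l' h1 h2 => hE l l' h1 s (h l' (hl.sublist h1) (by omega) m hm hm')

lemma DCoch.kos (hφ : ∀ l s i, ∀ x ∈ E l s, φ i x ∈ E l (s + 1)) (h : DCoch E a s c) :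
    DCoch E a (s + 1) (fun l => kosD φ (c l)) := by
  intro l hl hlen m hm hm'
  exact kosD_mem φ (fun i x => hφ l s i x) _ m
    fun m' h1 h2 => h l hl hlen m' (hm.sublist h1) (by omega)

lemma DCoch.sub (h : DCoch E a s c) (h' : DCoch E a s c') :
    DCoch E a s (fun l m => c l m - c' l m) :=
  fun l hl hlen m hm hm2 => AddSubgroup.sub_mem _ (h l hl hlen m hm hm2) (h' l hl hlen m hm hm2)

/-- Exactness of the Čech complex at a given place. -/
def RowExact (E : List ι → ℕ → AddSubgroup V) (a s : ℕ) : Prop :=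
  ∀ c : List ι → V, (∀ l : List ι, l.Pairwise (· < ·) → l.length = a + 1 → c l ∈ E l s) →
    (∀ l : List ι, l.Pairwise (· < ·) → l.length = a + 2 → cechD c l = 0) →
    ∃ b : List ι → V, (∀ l : List ι, l.Pairwise (· < ·) → l.length = a → b l ∈ E l s) ∧
      ∀ l : List ι, l.Pairwise (· < ·) → l.length = a + 1 → cechD b l = c l

/-- Exactness of the Koszul complex at a given place. -/
def ColExact (φ : ι → V →+ V) (E : ℕ → AddSubgroup V) (s : ℕ) : Prop :=
  ∀ c : List ι → V, (∀ m : List ι, m.Pairwise (· < ·) → m.length = s + 1 → c m ∈ E (s + 1)) →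
    (∀ m : List ι, m.Pairwise (· < ·) → m.length = s + 2 → kosD φ c m = 0) →
    ∃ b : List ι → V, (∀ m : List ι, m.Pairwise (· < ·) → m.length = s → b m ∈ E s) ∧
      ∀ m : List ι, m.Pairwise (· < ·) → m.length = s + 1 → kosD φ b m = c m

lemma RowExact.double (h : RowExact E a s) (hc : DCoch E (a + 1) s c)
    (hd : DEq (a + 2) s (cechD c) 0) : ∃ b, DCoch E a s b ∧ DEq (a + 1) s (cechD b) c := by
  have : ∀ m : List ι, ∃ b : List ι → V, m.Pairwise (· < ·) → m.length = s →
      (∀ l : List ι, l.Pairwise (· < ·) → l.length = a → b l ∈ E l s) ∧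
      ∀ l : List ι, l.Pairwise (· < ·) → l.length = a + 1 → cechD b l = c l m := by
    intro m
    by_cases hm : m.Pairwise (· < ·) ∧ m.length = s
    · obtain ⟨b, hb⟩ := h (fun l => c l m) (fun l hl hl' => hc l hl hl' m hm.1 hm.2)
        (fun l hl hl' => by rw [← cechD_apply]; exact hd l hl hl' m hm.1 hm.2)
      exact ⟨b, fun _ _ => hb⟩
    · exact ⟨0, fun h1 h2 => absurd ⟨h1, h2⟩ hm⟩
  choose b hb using this
  refine ⟨fun l m => b m l, fun l hl hl' m hm hm' => (hb m hm hm').1 l hl hl',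
    fun l hl hl' m hm hm' => ?_⟩
  rw [cechD_apply]
  exact (hb m hm hm').2 l hl hl'

lemma ColExact.double (h : ∀ l : List ι, l.Pairwise (· < ·) → l.length = a → ColExact φ (E l) s)
    (hc : DCoch E a (s + 1) c) (hd : DEq a (s + 2) (fun l => kosD φ (c l)) 0) :
    ∃ b, DCoch E a s b ∧ DEq a (s + 1) (fun l => kosD φ (b l)) c := by
  have : ∀ l : List ι, ∃ b : List ι → V, l.Pairwise (· < ·) → l.length = a →
      (∀ m : List ι, m.Pairwise (· < ·) → m.length = s → b m ∈ E l s) ∧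
      ∀ m : List ι, m.Pairwise (· < ·) → m.length = s + 1 → kosD φ b m = c l m := by
    intro l
    by_cases hl : l.Pairwise (· < ·) ∧ l.length = a
    · obtain ⟨b, hb⟩ := h l hl.1 hl.2 (c l) (hc l hl.1 hl.2) (hd l hl.1 hl.2)
      exact ⟨b, fun _ _ => hb⟩
    · exact ⟨0, fun h1 h2 => absurd ⟨h1, h2⟩ hl⟩
  choose b hb using this
  exact ⟨b, fun l hl hl' => (hb l hl hl').1, fun l hl hl' => (hb l hl hl').2⟩

lemma exists_kos_eq (hE : ∀ l l' : List ι, l'.Sublist l → ∀ s, E l' s ≤ E l s)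
    (hφ : ∀ l s i, ∀ x ∈ E l s, φ i x ∈ E l (s + 1))
    (hcomm : ∀ i j x, φ i (φ j x) = φ j (φ i x))
    (hrow : ∀ a s, RowExact E a s)
    (hcol : ∀ l : List ι, l.Pairwise (· < ·) → l ≠ [] → ∀ s, ColExact φ (E l) s)
    (hinj : ∀ l : List ι, l.Pairwise (· < ·) → l ≠ [] → ∀ x, (∀ i, φ i x = 0) → x = 0)
    (hc : DCoch E (a + 1) s c)
    (hd : DEq (a + 2) (s + 1) (fun l => kosD φ (cechD c l)) 0) :
    ∃ b, DCoch E a s b ∧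
      DEq (a + 1) (s + 1) (fun l => kosD φ (c l)) (fun l => kosD φ (cechD b l)) := by
  have hne : ∀ (a : ℕ) (l : List ι), l.length = a + 1 → l ≠ [] := by
    rintro a l hl rfl; simp at hl
  induction s generalizing a c with
  | zero =>
    have h1 : DEq (a + 2) 0 (cechD c) 0 := by
      intro l hl hlen m hm hm'
      obtain rfl : m = [] := List.eq_nil_of_length_eq_zero hm'
      refine hinj l hl (hne _ l hlen) _ fun i => ?_
      have := hd l hl hlen [i] (by simp) rfl
      simpa [kosD_cons] using this
    obtain ⟨b, hb, hb'⟩ := (hrow a 0).double hc h1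
    exact ⟨b, hb, hb'.symm.kos⟩
  | succ s ih =>
    obtain ⟨c', hc', hcc'⟩ := ColExact.double (c := cechD c) (a := a + 2)
      (fun l hl hlen => hcol l hl (hne _ l hlen) s) (hc.cech hE) hd
    obtain ⟨b, hb, hbc⟩ := ih hc' (by
      refine DEq.trans (DEq.symm DEq.cech_kos) (hcc'.cech.trans ?_)
      intro l hl hlen m hm hm'
      exact congrFun (cechD_cechD c l) m)
    have h1 : DEq (a + 2) (s + 1) (cechD c) (cechD fun l => kosD φ (b l)) :=
      hcc'.symm.trans (hbc.trans DEq.cech_kos.symm)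
    obtain ⟨b2, hb2, hb2'⟩ := (hrow a (s + 1)).double (hc.sub (hb.kos hφ)) (by
      intro l hl hlen m hm hm'
      have h2 := h1 l hl hlen m hm hm'
      rw [cechD_apply] at h2 ⊢
      rw [cechD_apply (fun l => kosD φ (b l))] at h2
      rw [cechD_sub, h2, sub_self]; rfl)
    refine ⟨b2, hb2, ?_⟩
    refine DEq.trans ?_ hb2'.symm.kos
    intro l hl hlen m hm hm'
    dsimp only
    rw [kosD_sub, kosD_kosD φ hcomm, sub_zero]

/-- Koszul exactness of the global sections, from that of the localizations. -/
lemma colExact_nil (hE : ∀ l l' : List ι, l'.Sublist l → ∀ s, E l' s ≤ E l s)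
    (hφ : ∀ l s i, ∀ x ∈ E l s, φ i x ∈ E l (s + 1))
    (hcomm : ∀ i j x, φ i (φ j x) = φ j (φ i x))
    (hrow : ∀ a s, RowExact E a s)
    (hcol : ∀ l : List ι, l.Pairwise (· < ·) → l ≠ [] → ∀ s, ColExact φ (E l) s)
    (hinj : ∀ l : List ι, l.Pairwise (· < ·) → l ≠ [] → ∀ x, (∀ i, φ i x = 0) → x = 0)
    [Nonempty ι] (s : ℕ) : ColExact φ (E []) s := by
  intro ω hω hd
  have hne : ∀ (l : List ι), l.length = 1 → l ≠ [] := by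
    rintro l hl rfl; simp at hl
  have h0 : DCoch E 0 (s + 1) (fun _ => ω) := by
    intro l hl hlen m hm hm'
    obtain rfl : l = [] := List.eq_nil_of_length_eq_zero hlen
    exact hω m hm hm'
  have hk : DEq 0 (s + 2) (fun _ => kosD φ ω) 0 := fun l _ _ m hm hm' => hd m hm hm'
  obtain ⟨η, hη, hη'⟩ := ColExact.double (c := cechD fun _ => ω) (a := 1) (E := E)
    (fun l hl hlen => hcol l hl (hne l hlen) s) (h0.cech hE)
    (DEq.cech_kos.symm.trans (hk.cech.trans fun l _ _ m _ _ => by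
      rw [cechD_apply]; exact cechD_zero l))
  obtain ⟨ζ, hζ, hζ'⟩ := exists_kos_eq hE hφ hcomm hrow hcol hinj hη
    (DEq.cech_kos.symm.trans (hη'.cech.trans fun l _ _ m _ _ => congrFun (cechD_cechD _ l) m))
  refine ⟨ζ [], hζ [] (by simp) rfl, fun m hm hm' => ?_⟩
  have h1 := hη'.symm.trans (hζ'.trans DEq.cech_kos.symm)
  let i : ι := Classical.arbitrary ι
  have h2 := h1 [i] (by simp) rfl m hm hm'
  rw [cechD_apply, cechD_apply] at h2
  simpa [cechD_cons] using h2.symm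

end Double

end

section

/-- Serre vanishing for the image of a ring homomorphism. -/
theorem serre_hom {B A : Type} [CommRing B] [IsNoetherianRing B] [CommRing A] {n : ℕ}
    (ψ : Laur B (Fin (n + 1)) →+* A) :
    ∃ t0 : ℤ, ∀ w : ℤ, t0 ≤ w → ∀ a : ℕ, ∀ c : List (Fin (n + 1)) → A,
      (∀ l : List (Fin (n + 1)), l.Pairwise (· < ·) → l.length = a + 1 →
        c l ∈ (lhom B l w).map ψ.toAddMonoidHom) →
      (∀ l : List (Fin (n + 1)), l.Pairwise (· < ·) → l.length = a + 2 → cechD c l = 0) →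
      ∃ b : List (Fin (n + 1)) → A,
        (∀ l : List (Fin (n + 1)), l.Pairwise (· < ·) → l.length = a →
          b l ∈ (lhom B l w).map ψ.toAddMonoidHom) ∧
        ∀ l : List (Fin (n + 1)), l.Pairwise (· < ·) → l.length = a + 1 → cechD b l = c l := by
  let _ : Module (Laur B (Fin (n + 1))) A := Module.compHom A ψ
  have hsm : ∀ (r : Laur B (Fin (n + 1))) (v : A), r • v = ψ r * v := fun _ _ => rfl
  have key : ∀ l w v, FamL (B := B) (n := n) (fun _ : Unit => (1 : A)) (fun _ => 0) l w v ↔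
      v ∈ (lhom B l w).map ψ.toAddMonoidHom := by
    intro l w v
    constructor
    · rintro ⟨a, ha, rfl⟩
      exact ⟨a (), by simpa using ha (), by simp [hsm]⟩
    · rintro ⟨a, ha, rfl⟩
      exact ⟨fun _ => a, fun _ => by simpa using ha, by simp [hsm]⟩
  choose t0 ht0 using fun a => serre_vanishing (B := B) (n := n) a (fun _ : Unit => (1 : A)) (fun _ => 0)
  refine ⟨∑ a ∈ Finset.range (n + 1), |t0 a|, fun w hw a c hc hd => ?_⟩
  by_cases ha : a < n + 1
  · have h1 : t0 a ≤ w := by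
      refine le_trans (le_trans (le_abs_self _) ?_) hw
      exact Finset.single_le_sum (f := fun a => |t0 a|) (fun _ _ => abs_nonneg _) (Finset.mem_range.2 ha)
    simp only [← key] at hc ⊢
    exact ht0 a w h1 c hc hd
  · refine ⟨0, fun l _ _ => AddSubgroup.zero_mem _, fun l hl hlen => ?_⟩
    have := length_le_of_sorted l hl
    omega

/-- The ring homomorphism from Laurent polynomials given by units. -/
def evalUnits {R K ι : Type} [CommRing R] [CommRing K] [Fintype ι] (ρ : R →+* K) (y : ι → Kˣ) :
    Laur R ι →+* K :=
  letI := ρ.toAlgebra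
  (AddMonoidAlgebra.lift R K (ι → ℤ) (
    { toFun := fun u => ((∏ i, y i ^ (Multiplicative.toAdd u i) : Kˣ) : K)
      map_one' := by simp
      map_mul' := fun u v => by
        simp [zpow_add, Finset.prod_mul_distrib] } : Multiplicative (ι → ℤ) →* K)).toRingHom

lemma evalUnits_single {R K ι : Type} [CommRing R] [CommRing K] [Fintype ι] (ρ : R →+* K)
    (y : ι → Kˣ) (u : ι → ℤ) (b : R) :
    evalUnits ρ y (AddMonoidAlgebra.single u b) = ρ b * ((∏ i, y i ^ u i : Kˣ) : K) := by
  let _ := ρ.toAlgebra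
  simp [evalUnits, AddMonoidAlgebra.lift_single, Algebra.smul_def]
  rfl

/-- Koszul complexes of powers become exact after twisting with high powers of the ideal. -/
theorem koszul_powers {R : Type} [CommRing R] [IsDomain R] [IsNoetherianRing R] {n : ℕ}
    (f : Fin (n + 1) → R) (hf : ∃ i, f i ≠ 0) :
    ∃ C0 : ℕ, ∀ C, C0 ≤ C → ∀ q s : ℕ,
      ColExact (fun i => AddMonoidHom.mulLeft (f i ^ q))
        (fun s => (Ideal.span (Set.range f) ^ (s * q + C)).toAddSubgroup) s := by
  classical
  obtain ⟨i0, hi0⟩ := hf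
  let K := FractionRing R
  let ρ : R →+* K := algebraMap R K
  have hρ : Function.Injective ρ := IsFractionRing.injective R K
  let σ : Fin (n + 1) → Fin (n + 1) := fun i => if f i ≠ 0 then i else i0
  have hσ : ∀ i, f (σ i) ≠ 0 := fun i => by
    by_cases h : f i = 0
    · simp [σ, h, hi0]
    · simpa [σ, h] using h
  have hσ' : ∀ i, f i = 0 ∨ σ i = i := fun i => by
    by_cases h : f i = 0
    · exact Or.inl h
    · exact Or.inr (by simp [σ, h])
  let y : Fin (n + 1) → Kˣ := fun i => Units.mk0 (ρ (f (σ i)))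
    (by rw [Ne, map_eq_zero_iff _ hρ]; exact hσ i)
  let ψ := evalUnits ρ y
  obtain ⟨t0, ht0⟩ := serre_hom ψ
  let E : List (Fin (n + 1)) → ℤ → AddSubgroup K := fun l N => (lhom R l N).map ψ.toAddMonoidHom
  have hEmul : ∀ l s t, ∀ x ∈ E l s, ∀ x' ∈ E l t, x * x' ∈ E l (s + t) := by
    rintro l s t _ ⟨a, ha, rfl⟩ _ ⟨b, hb, rfl⟩
    exact ⟨a * b, lhom_mul ha hb, map_mul ψ a b⟩
  have hEmono : ∀ l l' : List (Fin (n + 1)), l'.Sublist l → ∀ N, E l' N ≤ E l N :=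
    fun l l' h N => AddSubgroup.map_mono (lhom_mono (fun i hi => h.subset hi) N)
  have hE0 : ∀ l r, ρ r ∈ E l 0 := fun l r =>
    ⟨AddMonoidAlgebra.single 0 r, single_mem_lsup _ ⟨by simp, by simp⟩, by
      change ψ _ = _; simp [ψ, evalUnits_single]⟩
  have hy : ∀ l i (q : ℤ), (0 ≤ q ∨ i ∈ l) → ((y i ^ q : Kˣ) : K) ∈ E l q := by
    intro l i q h
    refine ⟨AddMonoidAlgebra.single (Pi.single i q) 1, single_mem_lsup _ ⟨by simp, fun j hj => ?_⟩, ?_⟩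
    · by_cases hji : j = i
      · subst hji; simpa using h.resolve_right hj
      · simp [hji]
    · change ψ _ = _
      rw [evalUnits_single, map_one, one_mul, Finset.prod_eq_single i]
      · simp
      · intro j _ hj; simp [hj]
      · simp
  have hyv : ∀ i, ((y i : Kˣ) : K) = ρ (f (σ i)) := fun i => rfl
  have hE1 : ∀ l i, ρ (f i) ∈ E l 1 := by
    intro l i
    rcases hσ' i with h | h
    · rw [h, map_zero]; exact AddSubgroup.zero_mem _
    · have := hy l i 1 (by simp)
      rwa [zpow_one, hyv, h] at this
  have hEq : ∀ l i (q : ℕ), ρ (f i ^ q) ∈ E l q := by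
    intro l i q
    induction q with
    | zero => simpa using hE0 l 1
    | succ q ih =>
      rw [pow_succ, map_mul]; push_cast; exact hEmul _ _ _ _ ih _ (hE1 l i)
  set J := Ideal.span (Set.range f)
  have hJ1 : ∀ r ∈ J, ρ r ∈ E [] 1 := by
    intro r hr
    induction hr using Submodule.span_induction with
    | mem x hx => obtain ⟨i, rfl⟩ := hx; exact hE1 _ i
    | zero => rw [map_zero]; exact AddSubgroup.zero_mem _
    | add x y _ _ hx hy => rw [map_add]; exact AddSubgroup.add_mem _ hx hy
    | smul a x _ hx =>
      rw [smul_eq_mul, map_mul]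
      have := hEmul _ _ _ _ (hE0 [] a) _ hx
      rwa [zero_add] at this
  have hJN : ∀ N : ℕ, ∀ r ∈ J ^ N, ρ r ∈ E [] N := by
    intro N
    induction N with
    | zero => intro r _; exact hE0 [] r
    | succ N ih =>
      intro r hr
      rw [pow_succ] at hr
      refine Submodule.mul_induction_on hr ?_ ?_
      · intro a ha b hb
        rw [map_mul]; push_cast; exact hEmul _ _ _ _ (ih a ha) _ (hJ1 b hb)
      · intro a b ha hb; rw [map_add]; exact AddSubgroup.add_mem _ ha hb
  have hprod : ∀ (s : Finset (Fin (n + 1))) (v : Fin (n + 1) → ℕ),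
      ∏ i ∈ s, f (σ i) ^ v i ∈ J ^ (∑ i ∈ s, v i) := by
    intro s v
    rw [← Finset.prod_pow_eq_pow_sum]
    exact Ideal.prod_mem_prod fun i _ => Ideal.pow_mem_pow (Ideal.subset_span (Set.mem_range_self (σ i))) _
  have hNJ : ∀ N : ℕ, ∀ x ∈ E [] N, ∃ r ∈ J ^ N, ρ r = x := by
    rintro N _ ⟨a, ha, rfl⟩
    refine lsup_induction (motive := fun a => ∃ r ∈ J ^ N, ρ r = ψ.toAddMonoidHom a) a ha
      ⟨0, Ideal.zero_mem _, by simp⟩ ?_ ?_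
    · rintro a b ⟨r, hr, hra⟩ ⟨r', hr', hrb⟩
      exact ⟨r + r', Ideal.add_mem _ hr hr', by rw [map_add, map_add, hra, hrb]⟩
    · intro u b hu
      have hu0 : ∀ i, ((u i).toNat : ℤ) = u i := fun i => Int.toNat_of_nonneg (hu.2 i (by simp))
      refine ⟨b * ∏ i, f (σ i) ^ (u i).toNat, Ideal.mul_mem_left _ _ ?_, ?_⟩
      · have := hprod Finset.univ fun i => (u i).toNat
        have h2 : ∑ i, (u i).toNat = N := by
          have := hu.1
          rw [← Finset.sum_congr rfl fun i _ => hu0 i] at this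
          exact_mod_cast this
        rwa [h2] at this
      · change _ = ψ _
        rw [evalUnits_single, map_mul, map_prod, Units.coe_prod]
        congr 1
        refine Finset.prod_congr rfl fun i _ => ?_
        conv_rhs => rw [← hu0 i, zpow_natCast, Units.val_pow_eq_pow_val, hyv]
        rw [map_pow]
  refine ⟨t0.toNat, fun C hC q s => ?_⟩
  let φ : Fin (n + 1) → K →+ K := fun i => AddMonoidHom.mulLeft (ρ (f i ^ q))
  let E' : List (Fin (n + 1)) → ℕ → AddSubgroup K := fun l s => E l (s * q + C : ℕ)
  have hφE : ∀ l s i, ∀ x ∈ E' l s, φ i x ∈ E' l (s + 1) := by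
    intro l s i x hx
    have := hEmul _ _ _ _ (hEq l i q) _ hx
    have h2 : ((q : ℤ) + (s * q + C : ℕ)) = ((s + 1) * q + C : ℕ) := by push_cast; ring
    rwa [h2] at this
  have hmain : ColExact φ (E' []) s := by
    refine colExact_nil (E := E') (fun l l' h s => hEmono l l' h _) hφE
      (fun i j x => mul_left_comm _ _ _) (fun a s c hc hd => ?_) (fun l hl hne s c hc hd => ?_) 
      (fun l hl hne x hx => ?_) s
    · refine ht0 _ ?_ a c hc hd
      have : t0 ≤ t0.toNat := Int.self_le_toNat t0
      push_cast
      have : (0 : ℤ) ≤ s * q := by positivity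
      have : (t0.toNat : ℤ) ≤ C := by exact_mod_cast hC
      linarith
    · obtain ⟨a, ha⟩ := List.exists_mem_of_ne_nil l hne
      refine kosD_exact φ (P := E' l (s + 1)) (Q := E' l s) (σ a)
        (AddMonoidHom.mulLeft ((y a ^ (-q : ℤ) : Kˣ) : K)) ?_ (fun j x => mul_left_comm _ _ _) ?_ s c hc hd
      · intro x
        change ρ (f (σ a) ^ q) * (((y a ^ (-q : ℤ) : Kˣ) : K) * x) = x
        rw [map_pow, ← hyv, ← Units.val_pow_eq_pow_val, ← mul_assoc, ← Units.val_mul,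
          ← zpow_natCast, ← zpow_add]
        simp
      · intro x hx
        have := hEmul _ _ _ _ (hy l a (-q) (Or.inr ha)) _ hx
        have h2 : (-(q : ℤ) + ((s + 1) * q + C : ℕ)) = (s * q + C : ℕ) := by push_cast; ring
        rwa [h2] at this
    · have := hx i0
      change ρ (f i0 ^ q) * x = 0 at this
      refine (mul_eq_zero.1 this).resolve_left ?_
      rw [map_eq_zero_iff _ hρ]
      exact pow_ne_zero _ hi0
  intro c hc hd
  obtain ⟨b, hb, hb'⟩ := hmain (fun l => ρ (c l)) (fun m hm hm' => hJN _ _ (hc m hm hm'))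
    (fun m hm hm' => by
      have := kosD_map (fun i => AddMonoidHom.mulLeft (f i ^ q)) φ ρ.toAddMonoidHom
        (fun i x => by simp [φ]) c m
      rw [hd m hm hm', map_zero] at this
      exact this)
  have : ∀ m : List (Fin (n + 1)), ∃ r : R, m.Pairwise (· < ·) → m.length = s →
      r ∈ J ^ (s * q + C) ∧ ρ r = b m := by
    intro m
    by_cases hm : m.Pairwise (· < ·) ∧ m.length = s
    · obtain ⟨r, hr, hr'⟩ := hNJ _ _ (hb m hm.1 hm.2)
      exact ⟨r, fun _ _ => ⟨hr, hr'⟩⟩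
    · exact ⟨0, fun h1 h2 => absurd ⟨h1, h2⟩ hm⟩
  choose r hr using this
  refine ⟨r, fun m hm hm' => (hr m hm hm').1, fun m hm hm' => hρ ?_⟩
  rw [← hb' m hm hm']
  have := kosD_map (fun i => AddMonoidHom.mulLeft (f i ^ q)) φ ρ.toAddMonoidHom
        (fun i x => by simp [φ]) r m
  refine this.symm.trans ?_
  exact kosD_congr φ _ _ m fun m' h1 h2 => (hr m' (hm.sublist h1) (by omega)).2

end

section

lemma lproj_eq_zero {B ι : Type} [CommRing B] {P Q : (ι → ℤ) → Prop} (h : ∀ u, Q u → ¬ P u)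
    {a : Laur B ι} (ha : a ∈ lsup B Q) : lproj B P a = 0 := by
  refine lsup_induction (motive := fun a => lproj B P a = 0) a ha (map_zero _) ?_ ?_
  · intro a b h h'; rw [map_add, h, h', add_zero]
  · intro u b hu; exact lproj_single_not b (h u hu)

/-- Variables are units in the ring of Laurent polynomials. -/
def xUnit (B : Type) [CommRing B] (n : ℕ) (i : Fin (n + 1)) : (Laur B (Fin (n + 1)))ˣ where
  val := AddMonoidAlgebra.single (Pi.single i 1) 1
  inv := AddMonoidAlgebra.single (Pi.single i (-1)) 1
  val_inv := by
    rw [AddMonoidAlgebra.single_mul_single, ← Pi.single_add, AddMonoidAlgebra.one_def]; simp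
  inv_val := by
    rw [AddMonoidAlgebra.single_mul_single, ← Pi.single_add, AddMonoidAlgebra.one_def]; simp

lemma xUnit_zpow (B : Type) [CommRing B] (n : ℕ) (i : Fin (n + 1)) (k : ℤ) :
    ((xUnit B n i ^ k : (Laur B (Fin (n + 1)))ˣ) : Laur B (Fin (n + 1))) =
      AddMonoidAlgebra.single (Pi.single i k) 1 := by
  have hnat : ∀ k : ℕ, ∀ a : ℤ, (AddMonoidAlgebra.single (Pi.single i a) 1 : Laur B (Fin (n + 1))) ^ k
      = AddMonoidAlgebra.single (Pi.single i (k * a)) 1 := fun k a => by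
    rw [AddMonoidAlgebra.single_pow, ← Pi.single_smul]; simp
  obtain ⟨k, rfl | rfl⟩ := k.eq_nat_or_neg
  · rw [zpow_natCast, Units.val_pow_eq_pow_val]
    exact (hnat k 1).trans (by simp)
  · rw [zpow_neg, zpow_natCast, ← inv_pow, Units.val_pow_eq_pow_val]
    exact (hnat k (-1)).trans (by simp)

lemma prod_xUnit (B : Type) [CommRing B] (n : ℕ) (u : Fin (n + 1) → ℤ) :
    ((∏ i, xUnit B n i ^ u i : (Laur B (Fin (n + 1)))ˣ) : Laur B (Fin (n + 1))) =
      AddMonoidAlgebra.single u 1 := by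
  have : ∀ s : Finset (Fin (n + 1)), ∏ i ∈ s, (AddMonoidAlgebra.single (Pi.single i (u i)) 1 :
      Laur B (Fin (n + 1))) = AddMonoidAlgebra.single (∑ i ∈ s, Pi.single i (u i)) 1 := by
    intro s
    classical
    induction s using Finset.induction_on with
    | empty => simp [AddMonoidAlgebra.one_def]
    | insert i s hi ih =>
      rw [Finset.prod_insert hi, ih, AddMonoidAlgebra.single_mul_single, Finset.sum_insert hi, mul_one]
  rw [Units.coe_prod]
  simp only [xUnit_zpow]
  rw [this, Finset.univ_sum_single]

/-- Serre vanishing for powers of an ideal generated by forms of degree `e`, uniformly. -/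
theorem serre_powers {κ : Type} [CommRing κ] [IsNoetherianRing κ] {n c : ℕ}
    (h : Fin c → MvPolynomial (Fin (n + 1)) κ) (e : ℕ) (he : 1 ≤ e)
    (hh : ∀ j, (h j).IsHomogeneous e) :
    ∃ u0 : ℤ, ∀ u, u0 ≤ u → ∀ (N s a : ℕ), 
      RowExact (fun l _ => GG (Ideal.span (Set.range h) ^ N) l (e * N + u)) a s := by
  classical
  let B := MvPolynomial (Fin c) κ
  let L := Laur κ (Fin (n + 1))
  let ρ : B →+* L := (toL κ n).toRingHom.comp (MvPolynomial.aeval h).toRingHom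
  let ψ : Laur B (Fin (n + 1)) →+* L := evalUnits ρ (xUnit κ n)
  have hψ : ∀ u b, ψ (AddMonoidAlgebra.single u b) = ρ b * AddMonoidAlgebra.single u 1 := by
    intro u b
    simp only [ψ]
    rw [evalUnits_single, prod_xUnit]
  have hρX : ∀ j, ρ (X j) = toL κ n (h j) := fun j => by
    change toL κ n (MvPolynomial.aeval h (X j)) = _; rw [aeval_X]
  have hρC : ∀ a, ρ (C a) = toL κ n (C a) := fun a => by
    change toL κ n (MvPolynomial.aeval h (C a)) = _; rw [aeval_C, algebraMap_eq]
  have hCL : ∀ (a : κ) (u : Fin (n + 1) → ℤ), toL κ n (C a) * AddMonoidAlgebra.single u 1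
      = AddMonoidAlgebra.single u a := by
    intro a u
    have := toL_monomial (n := n) (0 : Fin (n + 1) →₀ ℕ) a
    change toL κ n (C a) = _ at this
    rw [this, AddMonoidAlgebra.single_mul_single, mul_one]
    congr 1; funext i; simp
  obtain ⟨u0, hu0⟩ := serre_hom ψ
  let E : List (Fin (n + 1)) → ℤ → AddSubgroup L := fun l N => (lhom B l N).map ψ.toAddMonoidHom
  have hEmul : ∀ l s t, ∀ x ∈ E l s, ∀ x' ∈ E l t, x * x' ∈ E l (s + t) := by
    rintro l s t _ ⟨a, ha, rfl⟩ _ ⟨b, hb, rfl⟩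
    exact ⟨a * b, lhom_mul ha hb, map_mul ψ a b⟩
  have hEmono : ∀ l N, E [] N ≤ E l N :=
    fun l N => AddSubgroup.map_mono (lhom_mono (fun i hi => by simp at hi) N)
  have hsingle : ∀ l t u a, degPred l t u → (AddMonoidAlgebra.single u a : L) ∈ E l t := by
    intro l t u a hu
    refine ⟨AddMonoidAlgebra.single u (C a), single_mem_lsup _ hu, ?_⟩
    change ψ _ = _
    rw [hψ, hρC, hCL]
  have hlhom : ∀ l t, lhom κ l t ≤ E l t := fun l t x hx =>
    lsup_induction (motive := fun x => x ∈ E l t) x hx (AddSubgroup.zero_mem _)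
      (fun _ _ h h' => AddSubgroup.add_mem _ h h') fun u a hu => hsingle l t u a hu
  have hE0 : ∀ l b, ρ b ∈ E l 0 := fun l b =>
    ⟨AddMonoidAlgebra.single 0 b, single_mem_lsup _ ⟨by simp, by simp⟩, by
      change ψ _ = _; rw [hψ, ← AddMonoidAlgebra.one_def, mul_one]⟩
  set I := Ideal.span (Set.range h)
  have hhl : ∀ j, toL κ n (h j) ∈ lsup κ fun u : Fin (n + 1) → ℤ => ∑ i, u i = e := fun j =>
    lsup_mono (fun u hu => hu.1) (toL_mem_lhom (hh j) [])
  have hfwd : ∀ N : ℕ, ∀ p ∈ I ^ N, ∀ D : ℤ,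
      lproj κ (fun u => ∑ i, u i = D) (toL κ n p) ∈ E [] (D - e * N) := by
    intro N
    induction N with
    | zero =>
      intro p _ D
      simp only [Nat.cast_zero, mul_zero, sub_zero]
      exact hlhom _ _ (lsup_mono (fun u hu => ⟨hu.1, fun i _ => hu.2 i⟩)
        (lproj_mem _ _ (toL_mem_lsup p)))
    | succ N ih =>
      have h1 : ∀ b ∈ I, ∀ z ∈ I ^ N, ∀ D : ℤ,
          lproj κ (fun u => ∑ i, u i = D) (toL κ n (z * b)) ∈ E [] (D - e * (N + 1 : ℕ)) := by
        intro b hb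
        induction hb using Submodule.span_induction with
        | mem x hx =>
          obtain ⟨j, rfl⟩ := hx
          intro z hz D
          have h2 := lproj_mul (D - e) e (toL κ n z) _ (hhl j)
          rw [sub_add_cancel] at h2
          rw [map_mul, h2]
          have := hEmul _ _ _ _ (ih z hz (D - e)) _ (hE0 [] (X j))
          rw [hρX] at this
          convert this using 2
          push_cast; ring
        | zero => intro z _ D; simp
        | add x y _ _ hx hy =>
          intro z hz D
          rw [mul_add, map_add, map_add]; exact AddSubgroup.add_mem _ (hx z hz D) (hy z hz D)
        | smul a x _ hx =>
          intro z hz D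
          rw [smul_eq_mul, ← mul_assoc]
          exact hx _ (Ideal.mul_mem_right _ _ hz) D
      intro p hp
      rw [pow_succ] at hp
      refine Submodule.mul_induction_on hp (fun z hz b hb => h1 b hb z hz) ?_
      intro x y hx hy D
      rw [map_add, map_add]; exact AddSubgroup.add_mem _ (hx D) (hy D)
  have hGE : ∀ (N : ℕ) u l, ∀ x ∈ GG (I ^ N) l (e * N + u), x ∈ E l u := by
    rintro N u l x ⟨hx, M, p, hp, hxp⟩
    have hm := lmon_mem' (B := κ) l M l (Or.inr fun _ h => h)
    have hm' := lmon_mem' (B := κ) l (-M) l (Or.inr fun _ h => h)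
    set s : ℤ := ∑ i, if i ∈ l then (M : ℤ) else 0
    have hs : (∑ i, if i ∈ l then (-M : ℤ) else 0) = -s := by
      rw [← Finset.sum_neg_distrib]
      exact Finset.sum_congr rfl fun i _ => by split_ifs <;> simp
    rw [hs] at hm'
    have h1 : lmon κ l M * x ∈ lhom κ l (s + (e * N + u)) := lhom_mul hm hx
    have h2 := hfwd N p hp (s + (e * N + u))
    rw [← hxp, lproj_eq_self (lsup_mono (fun u hu => hu.1) h1)] at h2
    have h3 := hEmul _ _ _ _ (hlhom l _ hm') _ (hEmono l _ h2)
    rw [← mul_assoc, lmon_mul_neg, one_mul] at h3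
    convert h3 using 2
    ring
  have hEG : ∀ (N : ℕ) u l, ∀ x ∈ E l u,
      lproj κ (fun v => ∑ i, v i = e * N + u) x ∈ GG (I ^ N) l (e * N + u) := by
    rintro N u l _ ⟨a, ha, rfl⟩
    refine lsup_induction (motive := fun a => lproj κ (fun v => ∑ i, v i = e * N + u)
      (ψ.toAddMonoidHom a) ∈ GG (I ^ N) l (e * N + u)) a ha (by simp) ?_ ?_
    · intro a b h h'; rw [map_add, map_add]; exact AddSubgroup.add_mem _ h h'
    intro v b hv
    change lproj κ _ (ψ _) ∈ _
    rw [hψ]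
    induction b using MvPolynomial.induction_on' with
    | add p q hp hq => rw [map_add, add_mul, map_add]; exact AddSubgroup.add_mem _ hp hq
    | monomial w k =>
      have h1 : ρ (monomial w k) = toL κ n (C k * ∏ j, h j ^ w j) := by
        change toL κ n (MvPolynomial.aeval h (monomial w k)) = _
        rw [aeval_monomial, Finsupp.prod_fintype _ _ (by simp), algebraMap_eq]
      have hhom : (C k * ∏ j, h j ^ w j).IsHomogeneous (e * ∑ j, w j) := by
        have h2 : (∏ j, h j ^ w j).IsHomogeneous (∑ j, e * w j) :=
          IsHomogeneous.prod _ _ _ fun j _ => (hh j).pow _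
        rw [← Finset.mul_sum] at h2
        simpa using (isHomogeneous_C (Fin (n + 1)) k).mul h2
      rw [h1, mul_comm (toL κ n _) _]
      have hvs : (AddMonoidAlgebra.single v 1 : L) ∈ lhom κ l u := single_mem_lsup _ hv
      by_cases hN : ∑ j, w j = N
      · have h3 : (C k * ∏ j, h j ^ w j) ∈ I ^ N := by
          refine Ideal.mul_mem_left _ _ ?_
          rw [← hN, ← Finset.prod_pow_eq_pow_sum]
          exact Ideal.prod_mem_prod fun i _ =>
            Ideal.pow_mem_pow (Ideal.subset_span (Set.mem_range_self i)) _
        have h4 := GG_mul_left hvs (toL_mem_GG (l := l) hhom h3)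
        rw [hN] at h4
        push_cast at h4
        rw [add_comm u] at h4
        rw [lproj_eq_self (lsup_mono (fun u hu => hu.1) (GG_le_lhom h4))]
        exact h4
      · have h4 := lhom_mul hvs (toL_mem_lhom hhom l)
        rw [lproj_eq_zero ?_ h4]
        · exact AddSubgroup.zero_mem _
        · intro v' hv' hv2
          have h5 := hv'.1.symm.trans hv2
          push_cast at h5
          have h6 : (e : ℤ) * ((∑ j, w j : ℕ) : ℤ) = e * N := by push_cast; linarith
          have h7 : e * ∑ j, w j = e * N := by exact_mod_cast h6
          exact hN (Nat.eq_of_mul_eq_mul_left (by omega) h7)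
  refine ⟨u0, fun u hu N s a c hc hd => ?_⟩
  obtain ⟨b, hb, hb'⟩ := hu0 u hu a c (fun l hl hlen => hGE N u l _ (hc l hl hlen)) hd
  refine ⟨fun l => lproj κ (fun v => ∑ i, v i = e * N + u) (b l),
    fun l hl hlen => hEG N u l _ (hb l hl hlen), fun l hl hlen => ?_⟩
  have := cechD_map (lproj κ (fun v : Fin (n + 1) → ℤ => ∑ i, v i = e * N + u)).toAddMonoidHom b l
  refine this.trans ?_
  rw [hb' l hl hlen]
  exact lproj_eq_self (lsup_mono (fun u hu => hu.1) (GG_le_lhom (hc l hl hlen)))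

end

section

attribute [local instance] MvPolynomial.gradedAlgebra

lemma length_le_of_sorted_ge {n : ℕ} (b : ℕ) (l : List (Fin (n + 1))) (hl : l.Pairwise (· < ·))
    (hb : ∀ i ∈ l, b ≤ (i : ℕ)) : l.length + b ≤ n + 1 ∨ l = [] := by
  classical
  by_cases h0 : l = []
  · exact Or.inr h0
  left
  have hnd : (l.map fun i : Fin (n + 1) => (i : ℕ)).Nodup :=
    List.Nodup.map Fin.val_injective (hl.imp (fun h => h.ne))
  have h1 : (l.map fun i : Fin (n + 1) => (i : ℕ)).toFinset ⊆ Finset.Ico b (n + 1) := by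
    intro x hx
    simp only [List.mem_toFinset, List.mem_map] at hx
    obtain ⟨i, hi, rfl⟩ := hx
    exact Finset.mem_Ico.2 ⟨hb i hi, i.2⟩
  have h2 := Finset.card_le_card h1
  rw [List.toFinset_card_of_nodup hnd, Nat.card_Ico, List.length_map] at h2
  have : 0 < l.length := List.length_pos_iff.2 h0
  omega

lemma isHomogeneous_ideal_pow {κ : Type} [CommRing κ] {n : ℕ}
    {I : Ideal (MvPolynomial (Fin (n + 1)) κ)}
    (hI : I.IsHomogeneous (homogeneousSubmodule (Fin (n + 1)) κ)) (N : ℕ) :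
    (I ^ N).IsHomogeneous (homogeneousSubmodule (Fin (n + 1)) κ) := by
  induction N with
  | zero => rw [pow_zero, Ideal.one_eq_top]; exact Ideal.IsHomogeneous.top _
  | succ N ih => rw [pow_succ]; exact ih.mul hI

/-- A homogeneous partition of unity modulo a power of an ideal. -/
lemma exists_partition {κ : Type} [Field κ] {n : ℕ} {I : Ideal (MvPolynomial (Fin (n + 1)) κ)}
    (hI : I.IsHomogeneous (homogeneousSubmodule (Fin (n + 1)) κ)) (α : Fin (n + 1)) (c : ℕ)
    (T : Finset (Fin (n + 1)))
    (hc : X α ^ c ∈ I ⊔ Ideal.span (X '' (T : Set (Fin (n + 1))))) (N P : ℕ) :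
    ∃ g : Fin (n + 1) → Laur κ (Fin (n + 1)), (∀ i, g i ∈ lhom κ [α] (-P)) ∧
      1 - ∑ i ∈ T, g i * toL κ n (X i ^ P) ∈ GG (I ^ N) [α] 0 := by
  classical
  set K : Ideal (MvPolynomial (Fin (n + 1)) κ) := Ideal.span (X '' (T : Set (Fin (n + 1))))
  set Q : Ideal (MvPolynomial (Fin (n + 1)) κ) := Ideal.span ((fun i => X i ^ P) '' (T : Set (Fin (n + 1))))
  have hKQ : K ≤ Q.radical := by
    refine Ideal.span_le.2 ?_
    rintro _ ⟨i, hi, rfl⟩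
    exact ⟨P, Ideal.subset_span ⟨i, hi, rfl⟩⟩
  obtain ⟨M, hM⟩ := Ideal.exists_pow_le_of_le_radical_of_fg hKQ (IsNoetherian.noetherian K)
  have h1 : (X α : MvPolynomial (Fin (n + 1)) κ) ^ (c * (N + M)) ∈ I ^ N ⊔ Q := by
    rw [pow_mul]
    have := Ideal.pow_mem_pow hc (N + M)
    exact (sup_le_sup_left hM _) (Ideal.sup_pow_add_le_pow_sup_pow this)
  obtain ⟨p, hp, q, hq, hpq⟩ := Submodule.mem_sup.1 h1
  obtain ⟨w, hw⟩ : ∃ w : Fin (n + 1) → MvPolynomial (Fin (n + 1)) κ, q = ∑ i ∈ T, w i * X i ^ P := by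
    obtain ⟨w, hw⟩ := (Submodule.mem_span_image_finset_iff_exists_fun' _).1 hq
    exact ⟨w, by simpa using hw.symm⟩
  set M' := c * (N + M)
  have hlm : toL κ n (X α ^ M') = lmon κ [α] (M' : ℤ) := by
    rw [map_pow, toL_X, AddMonoidAlgebra.single_pow, lmon, one_pow]
    congr 1; funext i; by_cases h : i = α
    · subst h; simp
    · simp [h]
  have hone : (1 : Laur κ (Fin (n + 1))) = lmon κ [α] (-M') * toL κ n p
      + ∑ i ∈ T, (lmon κ [α] (-M') * toL κ n (w i)) * toL κ n (X i ^ P) := by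
    simp only [mul_assoc, ← map_mul, ← Finset.mul_sum, ← map_sum]
    rw [← mul_add, ← map_add, ← hw, hpq, hlm, lmon_mul_neg]
  refine ⟨fun i => lproj κ (fun u => ∑ i, u i = (-P : ℤ)) (lmon κ [α] (-M') * toL κ n (w i)),
    fun i => ?_, ?_⟩
  · have h2 : lmon κ [α] (-M') * toL κ n (w i) ∈ lsup κ (fun u => ∀ i, i ∉ [α] → 0 ≤ u i) :=
      mul_mem_lsup (P := fun u => ∀ i, i ∉ [α] → 0 ≤ u i) (Q := fun u => ∀ i, 0 ≤ u i)
        (fun u v hu hv i hi => add_nonneg (hu i hi) (hv i))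
        (single_mem_lsup _ fun i hi => by simp only [hi]; simp) (toL_mem_lsup _)
    exact lproj_mem _ _ h2
  · have h3 := congrArg (lproj κ (fun u => ∑ i, u i = (0 : ℤ))) hone
    rw [lproj_eq_self (a := 1) (single_mem_lsup _ (by simp)), map_add, map_sum] at h3
    have h4 : ∀ i, lproj κ (fun u => ∑ i, u i = (0 : ℤ))
        ((lmon κ [α] (-M') * toL κ n (w i)) * toL κ n (X i ^ P)) = 
        lproj κ (fun u => ∑ i, u i = (-P : ℤ)) (lmon κ [α] (-M') * toL κ n (w i)) *
          toL κ n (X i ^ P) := fun i => by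
      have := lproj_mul (-P) P (lmon κ [α] (-M') * toL κ n (w i)) (toL κ n (X i ^ P))
        (lsup_mono (fun u hu => hu.1) (toL_mem_lhom (isHomogeneous_X_pow i P) []))
      rwa [neg_add_cancel] at this
    rw [Finset.sum_congr rfl fun i _ => h4 i] at h3
    rw [h3, add_sub_cancel_right]
    refine lproj_mem_GG (M := M') ?_ hp ?_
    · exact isHomogeneous_ideal_pow hI N
    · rw [← mul_assoc, mul_comm (lmon κ [α] _), lmon_mul_neg, one_mul]


/-- Čech cochains of large degree with coboundary in a power of an ideal of small dimension can be
moved into that power by a coboundary. -/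
theorem cech_dimension {κ : Type} [Field κ] {n : ℕ} {I : Ideal (MvPolynomial (Fin (n + 1)) κ)}
    (hI : I.IsHomogeneous (homogeneousSubmodule (Fin (n + 1)) κ)) (r : ℕ) (hr : r ≤ n)
    (hc : ∀ α : Fin (n + 1), ∃ c : ℕ, 
      X α ^ c ∈ I ⊔ Ideal.span (X '' {i : Fin (n + 1) | r ≤ (i : ℕ)})) (N a : ℕ) (t : ℤ)
    (har : n + 1 ≤ a + r) (c : List (Fin (n + 1)) → Laur κ (Fin (n + 1)))
    (hcl : ∀ l : List (Fin (n + 1)), l.Pairwise (· < ·) → l.length = a + 1 → c l ∈ lhom κ l t)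
    (hd : ∀ l : List (Fin (n + 1)), l.Pairwise (· < ·) → l.length = a + 2 →
      cechD c l ∈ GG (I ^ N) l t) :
    ∃ b : List (Fin (n + 1)) → Laur κ (Fin (n + 1)),
      (∀ l : List (Fin (n + 1)), l.Pairwise (· < ·) → l.length = a → b l ∈ lhom κ l t) ∧
      ∀ l : List (Fin (n + 1)), l.Pairwise (· < ·) → l.length = a + 1 →
        c l - cechD b l ∈ GG (I ^ N) l t := by
  classical
  suffices H : ∀ D ≤ r, ∀ c : List (Fin (n + 1)) → Laur κ (Fin (n + 1)),
      (∀ l : List (Fin (n + 1)), l.Pairwise (· < ·) → l.length = a + 1 →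
        (∀ i ∈ l, r ≤ (i : ℕ) + D) → c l ∈ lhom κ l t) → 
      (∀ l : List (Fin (n + 1)), l.Pairwise (· < ·) → l.length = a + 2 →
        (∀ i ∈ l, r ≤ (i : ℕ) + D) → cechD c l ∈ GG (I ^ N) l t) → 
      ∃ b : List (Fin (n + 1)) → Laur κ (Fin (n + 1)),
      (∀ l : List (Fin (n + 1)), l.Pairwise (· < ·) → l.length = a → 
        (∀ i ∈ l, r ≤ (i : ℕ) + D) → b l ∈ lhom κ l t) ∧
      ∀ l : List (Fin (n + 1)), l.Pairwise (· < ·) → l.length = a + 1 → 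
        (∀ i ∈ l, r ≤ (i : ℕ) + D) → c l - cechD b l ∈ GG (I ^ N) l t by
    obtain ⟨b, hb, hb'⟩ := H r le_rfl c (fun l hl hl' _ => hcl l hl hl') (fun l hl hl' _ => hd l hl hl')
    exact ⟨b, fun l hl hl' => hb l hl hl' fun _ _ => by omega,
      fun l hl hl' => hb' l hl hl' fun _ _ => by omega⟩
  intro D
  induction D with
  | zero =>
    intro _ c _ _
    refine ⟨0, fun _ _ _ _ => AddSubgroup.zero_mem _, fun l hl hl' h => ?_⟩
    rcases length_le_of_sorted_ge r l hl (by simpa using h) with h | rfl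
    · omega
    · simp at hl'
  | succ D ih =>
    intro hD c hcl hd
    obtain ⟨b, hb, hb'⟩ := ih (by omega) c (fun l hl hl' h => hcl l hl hl' fun i hi => by
      have := h i hi; omega) (fun l hl hl' h => hd l hl hl' fun i hi => by
      have := h i hi; omega)
    set α : Fin (n + 1) := ⟨r - (D + 1), by omega⟩ with hα
    have hαv : (α : ℕ) = r - (D + 1) := rfl
    have hlt : ∀ i : Fin (n + 1), α < i ↔ r ≤ (i : ℕ) + D := fun i => by
      rw [Fin.lt_def, hαv]; omega
    have hle : ∀ i : Fin (n + 1), α ≤ i ↔ r ≤ (i : ℕ) + (D + 1) := fun i => by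
      rw [Fin.le_def, hαv]; omega
    simp only [← hlt] at hb hb'
    simp only [← hle] at hcl hd ⊢
    let bt : List (Fin (n + 1)) → Laur κ (Fin (n + 1)) := fun l => if ∀ i ∈ l, α < i then b l else 0
    have hbt : ∀ l : List (Fin (n + 1)), l.Pairwise (· < ·) → l.length = a → bt l ∈ lhom κ l t := by
      intro l hl hl'
      simp only [bt]; split_ifs with h
      · exact hb l hl hl' h
      · exact AddSubgroup.zero_mem _
    let c' : List (Fin (n + 1)) → Laur κ (Fin (n + 1)) := fun l => c l - cechD bt l
    have hc'l : ∀ l : List (Fin (n + 1)), l.Pairwise (· < ·) → l.length = a + 1 →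
        (∀ i ∈ l, α ≤ i) → c' l ∈ lhom κ l t := by
      intro l hl hl' h
      refine AddSubgroup.sub_mem _ (hcl l hl hl' h) (cechD_mem _ _ fun l' h1 h2 => ?_)
      exact lhom_mono (fun i hi => h1.subset hi) t (hbt l' (hl.sublist h1) (by omega))
    have hc'd : ∀ l : List (Fin (n + 1)), l.Pairwise (· < ·) → l.length = a + 2 →
        (∀ i ∈ l, α ≤ i) → cechD c' l ∈ GG (I ^ N) l t := by
      intro l hl hl' h
      have := cechD_sub c (cechD bt) l
      rw [cechD_cechD, sub_zero] at this
      change cechD (fun l => c l - cechD bt l) l ∈ _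
      rw [this]; exact hd l hl hl' h
    have hc'g : ∀ l : List (Fin (n + 1)), l.Pairwise (· < ·) → l.length = a + 1 →
        (∀ i ∈ l, α < i) → c' l ∈ GG (I ^ N) l t := by
      intro l hl hl' h
      have h1 : cechD bt l = cechD b l := cechD_congr _ _ _ fun l' h1 h2 =>
        if_pos fun i hi => h i (h1.subset hi)
      change c l - cechD bt l ∈ _
      rw [h1]; exact hb' l hl hl' h
    let e : List (Fin (n + 1)) → Laur κ (Fin (n + 1)) := fun l => c' (α :: l)
    have hcons : ∀ l : List (Fin (n + 1)), l.Pairwise (· < ·) → (∀ i ∈ l, α < i) →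
        (α :: l).Pairwise (· < ·) ∧ ∀ i ∈ α :: l, α ≤ i := fun l hl h =>
      ⟨List.pairwise_cons.2 ⟨h, hl⟩, fun i hi => by
        rcases List.mem_cons.1 hi with rfl | hi
        · exact le_rfl
        · exact (h i hi).le⟩
    have hel : ∀ l : List (Fin (n + 1)), l.Pairwise (· < ·) → l.length = a →
        (∀ i ∈ l, α < i) → e l ∈ lhom κ (α :: l) t := fun l hl hl' h =>
      hc'l _ (hcons l hl h).1 (by simp [hl']) (hcons l hl h).2
    have hed : ∀ l : List (Fin (n + 1)), l.Pairwise (· < ·) → l.length = a + 1 →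
        (∀ i ∈ l, α < i) → cechD e l ∈ GG (I ^ N) (α :: l) t := by
      intro l hl hl' h
      have h1 := hc'd _ (hcons l hl h).1 (by simp [hl']) (hcons l hl h).2
      rw [cechD_cons] at h1
      have h2 := GG_mono_list (fun i hi => List.mem_cons_of_mem α hi) (hc'g l hl hl' h)
      have h3 := AddSubgroup.sub_mem _ h2 h1
      rwa [sub_sub_cancel] at h3
    set T : Finset (Fin (n + 1)) := Finset.univ.filter fun i => r ≤ (i : ℕ) with hT
    have hTα : ∀ i ∈ T, α < i := fun i hi => by
      rw [hlt]; have := (Finset.mem_filter.1 hi).2; omega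
    have hins : ∀ i ∈ T, ∀ l l' : List (Fin (n + 1)), (∀ i ∈ l, α < i) →
        (∀ j, j ∈ l' ↔ j = i ∨ j ∈ l) → (∀ i ∈ l', α < i) ∧ 
        ∀ j ∈ α :: l', j ∈ i :: α :: l := by
      intro i hi l l' h h'
      refine ⟨fun j hj => ?_, fun j hj => ?_⟩
      · rcases (h' j).1 hj with rfl | hj
        · exact hTα _ hi
        · exact h j hj
      · rcases List.mem_cons.1 hj with rfl | hj
        · simp
        · rcases (h' j).1 hj with rfl | hj <;> simp [*]
    have hP1 : ∀ᶠ P : ℕ in Filter.atTop, ∀ i ∈ T, 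
        ∀ l ∈ {l : List (Fin (n + 1)) | l.length = a - 1}, l.Pairwise (· < ·) → (∀ i ∈ l, α < i) →
        toL κ n (X i ^ P) * cechH i e l ∈ lhom κ (α :: l) (t + P) := by
      rw [Filter.eventually_all_finset]
      intro i hi
      rw [Filter.eventually_all_finite (List.finite_length_eq _ _)]
      intro l hl'
      by_cases h : l.Pairwise (· < ·) ∧ (∀ i ∈ l, α < i)
      swap
      · exact Filter.Eventually.of_forall fun P h1 h2 => absurd ⟨h1, h2⟩ h
      have h1 : cechH i e l ∈ lhom κ (i :: α :: l) t := by
        refine cechH_mem i e l h.1 fun l' hl h2 h3 => ?_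
        obtain ⟨h4, h5⟩ := hins i hi l l' h.2 h3
        have hl'' : l.length = a - 1 := hl'
        exact lhom_mono h5 t (hel l' hl (by omega) h4)
      rw [← GG_top] at h1
      obtain ⟨P0, hP0⟩ := GG_clear (l := α :: l) i (fun j hj => by simpa using hj) h1
      filter_upwards [Filter.eventually_ge_atTop P0] with P hP _ _
      rw [← GG_top]; exact hP0 P hP
    have hP2 : ∀ᶠ P : ℕ in Filter.atTop, ∀ i ∈ T, 
        ∀ l ∈ {l : List (Fin (n + 1)) | l.length = a}, l.Pairwise (· < ·) → (∀ i ∈ l, α < i) →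
        toL κ n (X i ^ P) * cechH i (cechD e) l ∈ GG (I ^ N) (α :: l) (t + P) := by
      rw [Filter.eventually_all_finset]
      intro i hi
      rw [Filter.eventually_all_finite (List.finite_length_eq _ _)]
      intro l hl'
      by_cases h : l.Pairwise (· < ·) ∧ (∀ i ∈ l, α < i)
      swap
      · exact Filter.Eventually.of_forall fun P h1 h2 => absurd ⟨h1, h2⟩ h
      have h1 : cechH i (cechD e) l ∈ GG (I ^ N) (i :: α :: l) t := by
        refine cechH_mem i _ l h.1 fun l' hl h2 h3 => ?_
        obtain ⟨h4, h5⟩ := hins i hi l l' h.2 h3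
        have hl'' : l.length = a := hl'
        exact GG_mono_list h5 (hed l' hl (by omega) h4)
      obtain ⟨P0, hP0⟩ := GG_clear (l := α :: l) i (fun j hj => by simpa using hj) h1
      filter_upwards [Filter.eventually_ge_atTop P0] with P hP _ _
      exact hP0 P hP
    obtain ⟨P, hP1, hP2⟩ := (hP1.and hP2).exists
    obtain ⟨c0, hc0⟩ := hc α
    have hTs : {i : Fin (n + 1) | r ≤ (i : ℕ)} = (T : Set (Fin (n + 1))) := by ext; simp [hT]
    rw [hTs] at hc0
    obtain ⟨g, hg, hg1⟩ := exists_partition hI α c0 T hc0 N P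
    let e' : List (Fin (n + 1)) → Laur κ (Fin (n + 1)) := fun l =>
      ∑ i ∈ T, g i * toL κ n (X i ^ P) * cechH i e l
    have hsub : ∀ l : List (Fin (n + 1)), ∀ j ∈ [α], j ∈ α :: l := fun l j hj => by
      simp at hj; simp [hj]
    have he'l : ∀ l : List (Fin (n + 1)), l.Pairwise (· < ·) → l.length = a - 1 →
        (∀ i ∈ l, α < i) → e' l ∈ lhom κ (α :: l) t := by
      intro l hl hl' h
      refine AddSubgroup.sum_mem _ fun i hi => ?_
      have := lhom_mul (lhom_mono (hsub l) _ (hg i)) (hP1 i hi l hl' hl h)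
      rw [← mul_assoc] at this
      convert this using 2; ring
    have he'd : ∀ l : List (Fin (n + 1)), l.Pairwise (· < ·) → l.length = a →
        (∀ i ∈ l, α < i) → e l - cechD e' l ∈ GG (I ^ N) (α :: l) t := by
      intro l hl hl' h
      have h1 : cechD e' l = (∑ i ∈ T, g i * toL κ n (X i ^ P)) * e l
          - ∑ i ∈ T, g i * (toL κ n (X i ^ P) * cechH i (cechD e) l) := by
        simp only [e']
        rw [cechD_sum, Finset.sum_mul, ← Finset.sum_sub_distrib]
        refine Finset.sum_congr rfl fun i _ => ?_
        have h2 := cechD_map (AddMonoidHom.mulLeft (g i * toL κ n (X i ^ P))) (cechH i e) l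
        simp only [AddMonoidHom.coe_mulLeft] at h2
        rw [h2, ← cechD_cechH i e l hl]; ring
      have h2 : e l - cechD e' l = (1 - ∑ i ∈ T, g i * toL κ n (X i ^ P)) * e l
          + ∑ i ∈ T, g i * (toL κ n (X i ^ P) * cechH i (cechD e) l) := by rw [h1]; ring
      rw [h2]
      refine AddSubgroup.add_mem _ ?_ (AddSubgroup.sum_mem _ fun i hi => ?_)
      · have h3 := GG_mul_left (hel l hl hl' h) (GG_mono_list (hsub l) hg1)
        rw [mul_comm, add_zero] at h3; exact h3
      · have h3 := GG_mul_left (lhom_mono (hsub l) _ (hg i)) (hP2 i hi l hl' hl h)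
        convert h3 using 2; ring
    let b' : List (Fin (n + 1)) → Laur κ (Fin (n + 1)) := fun l =>
      match l with
      | [] => 0
      | β :: l => if β = α then - e' l else 0
    have hb'l : ∀ l : List (Fin (n + 1)), l.Pairwise (· < ·) → l.length = a → 
        b' l ∈ lhom κ l t := by
      rintro (_ | ⟨β, l⟩) hl hl'
      · exact AddSubgroup.zero_mem _
      simp only [b']; split_ifs with h
      · subst h
        exact AddSubgroup.neg_mem _ (he'l l hl.of_cons (by simp at hl'; omega)
          (List.pairwise_cons.1 hl).1)
      · exact AddSubgroup.zero_mem _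
    have hb'0 : ∀ l : List (Fin (n + 1)), (∀ i ∈ l, α < i) → b' l = 0 := by
      rintro (_ | ⟨β, l⟩) h
      · rfl
      · exact if_neg (h β (by simp)).ne'
    refine ⟨fun l => bt l + b' l, fun l hl hl' _ => AddSubgroup.add_mem _ (hbt l hl hl') (hb'l l hl hl'),
      fun l hl hl' h => ?_⟩
    rw [cechD_add, ← sub_sub]
    change c' l - cechD b' l ∈ _
    rcases l with _ | ⟨β, l⟩
    · simp at hl'
    have hp := List.pairwise_cons.1 hl
    by_cases hβ : β = α
    · subst hβ
      have h1 : cechD b' (α :: l) = cechD e' l := by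
        rw [cechD_cons, hb'0 l hp.1]
        have : (fun l' => b' (α :: l')) = fun l' => - e' l' := by
          funext l'; exact if_pos rfl
        rw [this, cechD_neg]; simp
      rw [h1]
      exact he'd l hp.2 (by simpa using hl') hp.1
    · have h0 : ∀ i ∈ β :: l, α < i := by
        intro i hi
        have hβ' : α < β := lt_of_le_of_ne (h β (by simp)) (Ne.symm hβ)
        rcases List.mem_cons.1 hi with rfl | hi
        · exact hβ'
        · exact hβ'.trans (hp.1 i hi)
      have h1 : cechD b' (β :: l) = 0 := by
        rw [cechD_congr b' (fun _ => 0) (β :: l)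
          fun l' h1 _ => hb'0 l' fun i hi => h0 i (h1.subset hi), cechD_zero]
      rw [h1, sub_zero]
      exact hc'g _ hl hl' h0

end

section

attribute [local instance] MvPolynomial.gradedAlgebra

lemma kosD_map₂ {ι V W : Type*} [AddCommGroup V] [AddCommGroup W] (φ : ι → V →+ V)
    (φ' : ι → W →+ W) (ψ ψ' : V →+ W) (h : ∀ i x, ψ' (φ i x) = φ' i (ψ x))
    (c : List ι → V) (l : List ι) :
    kosD φ' (fun l => ψ (c l)) l = ψ' (kosD φ c l) := by
  induction l generalizing c with
  | nil => simp
  | cons α l ih => simp only [kosD_cons, ih, map_sub, h]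

lemma isHomogeneous_span_range {κ : Type} [CommRing κ] {n c e : ℕ}
    {h : Fin c → MvPolynomial (Fin (n + 1)) κ} (hh : ∀ j, (h j).IsHomogeneous e) :
    (Ideal.span (Set.range h)).IsHomogeneous (homogeneousSubmodule (Fin (n + 1)) κ) := by
  refine Ideal.homogeneous_span _ _ ?_
  rintro _ ⟨j, rfl⟩
  exact ⟨e, hh j⟩

/-- Koszul exactness for powers of ideals on the standard affine charts. -/
lemma colExact_chart {κ : Type} [Field κ] {n c : ℕ}
    (h : Fin c → MvPolynomial (Fin (n + 1)) κ)
    (f : Fin (n + 1) → MvPolynomial (Fin (n + 1)) κ) (δ : ℕ) (hf : ∀ i, (f i).IsHomogeneous δ)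
    (hf0 : ∃ i, f i ≠ 0) (hfI : ∀ i, f i ∈ Ideal.span (Set.range h)) (M : ℕ)
    (hhf : ∀ a j, X a ^ M * h j ∈ Ideal.span (Set.range f)) :
    ∃ C0 : ℕ, ∀ C, C0 ≤ C → ∀ (q s : ℕ) (t : ℕ → ℤ), t (s + 1) = t s + q * δ →
      ∀ l : List (Fin (n + 1)), l ≠ [] →
      ColExact (fun i => AddMonoidHom.mulLeft (toL κ n (f i ^ q)))
        (fun s => GG (Ideal.span (Set.range h) ^ (s * q + C)) l (t s)) s := by
  classical
  obtain ⟨C0, hC0⟩ := koszul_powers f hf0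
  refine ⟨C0, fun C hC q s t ht l hl c hcm hd => ?_⟩
  set I := Ideal.span (Set.range h)
  set J := Ideal.span (Set.range f)
  obtain ⟨a, ha⟩ := List.exists_mem_of_ne_nil l hl
  have hJI : J ≤ I := Ideal.span_le.2 (by rintro _ ⟨i, rfl⟩; exact hfI i)
  have hIJ : ∀ p ∈ I, X a ^ M * p ∈ J := by
    intro p hp
    have : Ideal.span {(X a : MvPolynomial (Fin (n + 1)) κ) ^ M} * I ≤ J := by
      rw [Ideal.span_mul_span, Ideal.span_le]
      rintro _ ⟨x, hx, _, ⟨j, rfl⟩, rfl⟩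
      obtain rfl : x = _ := hx
      exact hhf a j
    exact this (Ideal.mul_mem_mul (Ideal.subset_span rfl) hp)
  have hGIJ : ∀ N u, GG (I ^ N) l u ≤ GG (J ^ N) l u := fun N u =>
    GG_le_of_pow_mul_mem M a hIJ ha N
  have hGJI : ∀ N u, GG (J ^ N) l u ≤ GG (I ^ N) l u := fun N u =>
    GG_mono_ideal (Ideal.pow_right_mono hJI N)
  have hev : ∀ᶠ M' : ℕ in Filter.atTop, ∀ m ∈ {m : List (Fin (n + 1)) | m.length = s + 1},
      m.Pairwise (· < ·) → ∃ p ∈ J ^ ((s + 1) * q + C), lmon κ l M' * c m = toL κ n p := by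
    rw [Filter.eventually_all_finite (List.finite_length_eq _ _)]
    intro m hm
    by_cases h : m.Pairwise (· < ·)
    swap
    · exact Filter.Eventually.of_forall fun P h1 => absurd h1 h
    obtain ⟨M0, hM0⟩ := exists_forall_GG (hGIJ _ _ (hcm m h hm))
    filter_upwards [Filter.eventually_ge_atTop M0] with P hP _
    exact hM0 P hP
  obtain ⟨M', hM'⟩ := hev.exists
  have hp : ∀ m : List (Fin (n + 1)), ∃ p, m.Pairwise (· < ·) → m.length = s + 1 →
      p ∈ J ^ ((s + 1) * q + C) ∧ lmon κ l M' * c m = toL κ n p := by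
    intro m
    by_cases h : m.Pairwise (· < ·) ∧ m.length = s + 1
    · obtain ⟨p, hp, hp'⟩ := hM' m h.2 h.1
      exact ⟨p, fun _ _ => ⟨hp, hp'⟩⟩
    · exact ⟨0, fun h1 h2 => absurd ⟨h1, h2⟩ h⟩
  choose p hp using hp
  obtain ⟨b, hb, hb'⟩ := hC0 C hC q s p (fun m hm hm' => (hp m hm hm').1) (by
    intro m hm hm'
    apply toL_injective
    have h1 := kosD_map (fun i => AddMonoidHom.mulLeft (f i ^ q))
      (fun i => AddMonoidHom.mulLeft (toL κ n (f i ^ q))) (toL κ n : _ →+ _)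
      (fun i x => by simp) p m
    have h2 := kosD_map (fun i => AddMonoidHom.mulLeft (toL κ n (f i ^ q)))
      (fun i => AddMonoidHom.mulLeft (toL κ n (f i ^ q))) (AddMonoidHom.mulLeft (lmon κ l M'))
      (fun i x => by simp only [AddMonoidHom.coe_mulLeft]; ring) c m
    rw [hd m hm hm', map_zero] at h2
    rw [map_zero]
    refine h1.symm.trans (Eq.trans ?_ h2)
    exact kosD_congr _ _ _ m fun m' h1 h2 => (hp m' (hm.sublist h1) (by omega)).2.symm)
  let ψ : ℤ → MvPolynomial (Fin (n + 1)) κ →+ Laur κ (Fin (n + 1)) := fun t =>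
    (lproj κ (fun u => ∑ i, u i = t)).toAddMonoidHom.comp
      ((AddMonoidHom.mulLeft (lmon κ l (-M'))).comp (toL κ n : _ →+ _))
  have hψ : ∀ t p, ψ t p = lproj κ (fun u => ∑ i, u i = t) (lmon κ l (-M') * toL κ n p) :=
    fun _ _ => rfl
  refine ⟨fun m => ψ (t s) (b m), fun m hm hm' => hGJI _ _ ?_, fun m hm hm' => ?_⟩
  · refine lproj_mem_GG (M := M') (isHomogeneous_ideal_pow (isHomogeneous_span_range hf) _)
      (hb m hm hm') ?_
    change lmon κ l M' * (lmon κ l (-M') * toL κ n (b m)) = _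
    rw [← mul_assoc, mul_comm (lmon κ l _), lmon_mul_neg, one_mul]
  · have h1 := kosD_map₂ (fun i => AddMonoidHom.mulLeft (f i ^ q))
      (fun i => AddMonoidHom.mulLeft (toL κ n (f i ^ q))) (ψ (t s)) (ψ (t (s + 1))) (by
        intro i x
        rw [hψ, hψ]
        simp only [AddMonoidHom.coe_mulLeft, map_mul]
        have h2 : toL κ n (f i ^ q) ∈ lsup κ fun u : Fin (n + 1) → ℤ => ∑ i, u i = ((q * δ : ℕ) : ℤ) := by
          have := toL_mem_lhom ((hf i).pow q) []
          rw [mul_comm] at this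
          exact lsup_mono (fun u hu => hu.1) this
        have h3 := lproj_mul (t s) _ (lmon κ l (-M') * toL κ n x) _ h2
        push_cast at h3
        rw [← ht] at h3
        rw [mul_comm _ (lproj κ _ _), ← h3]
        congr 1; ring) b m
    rw [h1, hb' m hm hm', hψ, ← (hp m hm hm').2, ← mul_assoc, lmon_mul_neg, one_mul]
    exact lproj_eq_self (lsup_mono (fun u hu => hu.1) (GG_le_lhom (hcm m hm hm')))

lemma exists_cechD_eq_of_nonneg {κ : Type} [CommRing κ] {n : ℕ} {t : ℤ} (L : List (Fin (n + 1)))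
    (hL : L.Pairwise (· < ·)) (hlen : L.length = n + 1) (x : Laur κ (Fin (n + 1)))
    (hx : x ∈ lsup κ fun u => ∑ i, u i = t ∧ ∃ i, 0 ≤ u i) :
    ∃ b : List (Fin (n + 1)) → Laur κ (Fin (n + 1)),
      (∀ l : List (Fin (n + 1)), l.Pairwise (· < ·) → l.length = n → b l ∈ lhom κ l t) ∧
      cechD b L = x := by
  classical
  refine lsup_induction (motive := fun x => ∃ b : List (Fin (n + 1)) → Laur κ (Fin (n + 1)),
      (∀ l : List (Fin (n + 1)), l.Pairwise (· < ·) → l.length = n → b l ∈ lhom κ l t) ∧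
      cechD b L = x) x hx ⟨0, fun _ _ _ => AddSubgroup.zero_mem _, cechD_zero L⟩ ?_ ?_
  · rintro _ _ ⟨b, hb, rfl⟩ ⟨b', hb', rfl⟩
    exact ⟨fun l => b l + b' l, fun l hl hl' => AddSubgroup.add_mem _ (hb l hl hl') (hb' l hl hl'),
      cechD_add b b' L⟩
  rintro u y ⟨hu, i, hi⟩
  let c : List (Fin (n + 1)) → Laur κ (Fin (n + 1)) := fun _ => AddMonoidAlgebra.single u y
  refine ⟨cechH i c, fun l hl hl' => ?_, ?_⟩
  · refine cechH_mem i c l hl fun l' h1 h2 h3 => single_mem_lsup _ ⟨hu, fun j hj => ?_⟩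
    have h4 := all_mem_of_sorted l' h1 (by omega) j
    rcases (h3 j).1 h4 with rfl | h
    · exact hi
    · exact absurd h hj
  · have h1 := cechD_cechH i c L hL
    have h2 : cechH i (cechD c) L ∈ (⊥ : AddSubgroup (Laur κ (Fin (n + 1)))) :=
      cechH_mem i _ L hL fun l' h1 h2 _ => by
        have := length_le_of_sorted l' h1; omega
    rw [AddSubgroup.mem_bot.1 h2, add_zero] at h1
    exact h1

lemma cechD_mem_nonneg {κ : Type} [CommRing κ] {n : ℕ} (hn : 1 ≤ n) {t : ℤ}
    (L : List (Fin (n + 1))) (hL : L.Pairwise (· < ·)) (hlen : L.length = n + 1)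
    (b : List (Fin (n + 1)) → Laur κ (Fin (n + 1)))
    (hb : ∀ l : List (Fin (n + 1)), l.Pairwise (· < ·) → l.length = n → b l ∈ lhom κ l t) :
    cechD b L ∈ lsup κ fun u => ∃ i, 0 ≤ u i := by
  refine cechD_mem _ _ fun l h1 h2 => ?_
  refine lsup_mono (fun u hu => ?_) (hb l (hL.sublist h1) (by omega))
  exact exists_nonneg_of_degPred (a := n - 1) (by omega) (Or.inl (by omega)) hu

end

section

attribute [local instance] MvPolynomial.gradedAlgebra

section Chase
variable {V : Type} [AddCommGroup V] {n : ℕ} {E : List (Fin (n + 1)) → ℕ → AddSubgroup V}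
  {φ : Fin (n + 1) → V →+ V}

/-- One step of the double complex chase. -/
lemma chase_step (hE : ∀ l l' : List (Fin (n + 1)), l'.Sublist l → ∀ s, E l' s ≤ E l s)
    (hcol : ∀ l : List (Fin (n + 1)), l ≠ [] → ∀ s, ColExact φ (E l) s)
    {a s : ℕ} {c c' : List (Fin (n + 1)) → List (Fin (n + 1)) → V}
    (hc : DCoch E (a + 1) (s + 1) c)
    (hcc' : DEq (a + 1) (s + 2) (fun l => kosD φ (c l)) (cechD c'))
    {b b2 : List (Fin (n + 1)) → List (Fin (n + 1)) → V} (hb : DCoch E a (s + 1) b)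
    (h : DEq a (s + 2) c' (fun l m => kosD φ (b l) m + cechD b2 l m)) :
    ∃ b', DCoch E (a + 1) s b' ∧
      DEq (a + 1) (s + 1) c (fun l m => kosD φ (b' l) m + cechD b l m) := by
  have h1 : DEq (a + 1) (s + 2) (cechD c') (cechD fun l => kosD φ (b l)) := by
    refine h.cech.trans fun l hl hl' m hm hm' => ?_
    rw [cechD_apply, cechD_apply (fun l => kosD φ (b l)), cechD_add, add_eq_left]
    have := congrFun (cechD_cechD b2 l) m
    rwa [cechD_apply] at this
  have h2 : DEq (a + 1) (s + 2) (fun l => kosD φ (c l)) (fun l => kosD φ (cechD b l)) :=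
    hcc'.trans (h1.trans DEq.cech_kos)
  obtain ⟨b', hb', hb'c⟩ := ColExact.double (c := fun l m => c l m - cechD b l m)
    (fun l _ hl => hcol l (by rintro rfl; simp at hl) s) (hc.sub (hb.cech hE)) (by
      intro l hl hl' m hm hm'
      dsimp only
      have h3 := h2 l hl hl' m hm hm'
      dsimp only at h3
      rw [kosD_sub, h3, sub_self]; rfl)
  exact ⟨b', hb', fun l hl hl' m hm hm' => by
    have := hb'c l hl hl' m hm hm'
    dsimp only at this ⊢
    rw [this]; abel⟩

/-- Splitting of Koszul–Čech closed cochains on the antidiagonal. -/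
lemma chase (hE : ∀ l l' : List (Fin (n + 1)), l'.Sublist l → ∀ s, E l' s ≤ E l s)
    (hφ : ∀ l s i, ∀ x ∈ E l s, φ i x ∈ E l (s + 1))
    (hcomm : ∀ i j x, φ i (φ j x) = φ j (φ i x))
    (hcol : ∀ l : List (Fin (n + 1)), l ≠ [] → ∀ s, ColExact φ (E l) s)
    (hrow : ∀ s a, 3 ≤ s → a + s = n + 2 → RowExact E a s) {a s : ℕ} (hs : 2 ≤ s)
    (has : a + s = n + 2) {c : List (Fin (n + 1)) → List (Fin (n + 1)) → V}
    (hc : DCoch E a s c) (hd : DEq (a + 1) (s + 1) (cechD fun l => kosD φ (c l)) 0) :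
    ∃ b b', DCoch E a (s - 1) b ∧ DCoch E (a - 1) s b' ∧
      DEq a s c (fun l m => kosD φ (b l) m + cechD b' l m) := by
  induction a generalizing s c with
  | zero =>
    refine ⟨0, 0, fun _ _ _ _ _ _ => AddSubgroup.zero_mem _, fun _ _ _ _ _ _ => AddSubgroup.zero_mem _,
      fun l hl hl' m hm hm' => ?_⟩
    have := length_le_of_sorted m hm
    omega
  | succ a ih =>
    obtain ⟨s, rfl⟩ : ∃ s', s = s' + 1 := ⟨s - 1, by omega⟩
    obtain ⟨c', hc', hcc'⟩ := (hrow (s + 2) a (by omega) (by omega)).double (hc.kos hφ) hd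
    obtain ⟨b, b2, hb, -, h⟩ := ih (s := s + 2) (by omega) (by omega) hc' (by
      refine DEq.cech_kos.trans (hcc'.kos.trans fun l hl hl' m hm hm' => ?_)
      exact kosD_kosD φ hcomm (c l) m)
    obtain ⟨b', hb', h'⟩ := chase_step hE hcol hc hcc'.symm hb h
    exact ⟨b', b, hb', hb, h'⟩

end Chase


/-- The local cohomology statement dual to Koszul exactness. -/
theorem exists_lift {κ : Type} [Field κ] {n c : ℕ}
    (h : Fin c → MvPolynomial (Fin (n + 1)) κ) (e : ℕ) (he : 1 ≤ e)
    (hh : ∀ j, (h j).IsHomogeneous e)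
    (f : Fin (n + 1) → MvPolynomial (Fin (n + 1)) κ) (δ : ℕ) (hf : ∀ i, (f i).IsHomogeneous δ)
    (hf0 : ∃ i, f i ≠ 0) (hfI : ∀ i, f i ∈ Ideal.span (Set.range h)) (M : ℕ)
    (hhf : ∀ a j, X a ^ M * h j ∈ Ideal.span (Set.range f))
    (r : ℕ) (hr2 : 2 ≤ r) (hrn : r ≤ n)
    (hc : ∀ α : Fin (n + 1), ∃ c : ℕ, 
      X α ^ c ∈ Ideal.span (Set.range h) ⊔ Ideal.span (X '' {i : Fin (n + 1) | r ≤ (i : ℕ)}))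
    (k : ℕ) (hk : ∀ s, r + 1 ≤ s → s * e + k + 1 ≤ s * δ) :
    ∃ Q0 : ℕ, ∀ q, Q0 ≤ q → ∀ v : Fin (n + 1) → Laur κ (Fin (n + 1)),
      (∀ i, v i ∈ lsup κ fun u => ∑ i, u i = (q * δ - q * k - n - 1 : ℤ)) →
      (∀ i j, toL κ n (f i ^ q) * v j - toL κ n (f j ^ q) * v i ∈ lsup κ fun u => ∃ i, 0 ≤ u i) →
      ∃ b ∈ lsup κ fun u => ∑ i, u i = (- q * k - n - 1 : ℤ),
        ∀ i, v i - toL κ n (f i ^ q) * b ∈ lsup κ fun u => ∃ i, 0 ≤ u i := by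
  classical
  obtain ⟨C0, hC0⟩ := colExact_chart h f δ hf hf0 hfI M hhf
  obtain ⟨u0, hu0⟩ := serre_powers h e he hh
  refine ⟨(u0 + n + 1 + e * C0).toNat, fun q hq v hv hvv => ?_⟩
  have hq' : u0 + n + 1 + e * C0 ≤ q := by omega
  set I := Ideal.span (Set.range h)
  have hI : I.IsHomogeneous (homogeneousSubmodule (Fin (n + 1)) κ) := isHomogeneous_span_range hh
  let t : ℕ → ℤ := fun s => s * q * δ - q * k - n - 1
  have ht : ∀ s, t (s + 1) = t s + q * δ := fun s => by simp only [t]; push_cast; ring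
  let E : List (Fin (n + 1)) → ℕ → AddSubgroup (Laur κ (Fin (n + 1))) :=
    fun l s => GG (I ^ (s * q + C0)) l (t s)
  let φ : Fin (n + 1) → Laur κ (Fin (n + 1)) →+ Laur κ (Fin (n + 1)) :=
    fun i => AddMonoidHom.mulLeft (toL κ n (f i ^ q))
  have hφa : ∀ i x, φ i x = toL κ n (f i ^ q) * x := fun _ _ => rfl
  have hE : ∀ l l' : List (Fin (n + 1)), l'.Sublist l → ∀ s, E l' s ≤ E l s :=
    fun l l' hl s => GG_mono_list fun i hi => hl.subset hi
  have hφl : ∀ l s i, ∀ x ∈ lhom κ l (t s), φ i x ∈ lhom κ l (t (s + 1)) := by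
    intro l s i x hx
    have h1 := lhom_mul (toL_mem_lhom ((hf i).pow q) l) hx
    rw [hφa]
    convert h1 using 2
    rw [ht]; push_cast; ring
  have hφ : ∀ l s i, ∀ x ∈ E l s, φ i x ∈ E l (s + 1) := by
    intro l s i x hx
    have h1 := GG_mul (toL_mem_GG (l := l) ((hf i).pow q) (Ideal.pow_mem_pow (hfI i) q)) hx
    rw [hφa]
    simp only [E]
    rw [← pow_add] at h1
    convert h1 using 2
    · congr 1; ring
    · rw [ht]; push_cast; ring
  have hcomm : ∀ i j x, φ i (φ j x) = φ j (φ i x) := fun i j x => by simp only [hφa]; ring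
  have hcol : ∀ l : List (Fin (n + 1)), l ≠ [] → ∀ s, ColExact φ (E l) s :=
    fun l hl s => hC0 C0 le_rfl q s t (ht s) l hl
  have hrow : ∀ s a, 3 ≤ s → a + s = n + 2 → RowExact E a s := by
    intro s a hs has
    by_cases hsr : r + 1 ≤ s
    · have h1 := hk s hsr
      have h2 : u0 ≤ t s - e * (s * q + C0 : ℕ) := by
        have h3 : ((s * e + k + 1 : ℕ) : ℤ) * q ≤ (s * δ : ℕ) * q :=
          mul_le_mul_of_nonneg_right (by exact_mod_cast h1) (by positivity)
        simp only [t]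
        push_cast at h3 ⊢
        nlinarith
      have h4 := hu0 _ h2 (s * q + C0) s a
      simp only [add_sub_cancel] at h4
      exact h4
    · intro c hcl hd
      obtain ⟨b, hb, hbc⟩ := cech_free a (t s) (Or.inl (by omega)) c
        (fun l hl hl' => GG_le_lhom (hcl l hl hl')) hd
      obtain ⟨a, rfl⟩ : ∃ a', a = a' + 1 := ⟨a - 1, by omega⟩
      obtain ⟨b', hb', hbb'⟩ := cech_dimension hI r hrn hc (s * q + C0) a (t s) (by omega) b hb
        (fun l hl hl' => by rw [hbc l hl hl']; exact hcl l hl hl')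
      refine ⟨fun l => b l - cechD b' l, hbb', fun l hl hl' => ?_⟩
      rw [cechD_sub, cechD_cechD, sub_zero]
      exact hbc l hl hl'
  let L : List (Fin (n + 1)) := List.finRange (n + 1)
  have hL : L.Pairwise (· < ·) := List.pairwise_lt_finRange _
  have hLlen : L.length = n + 1 := by simp [L]
  have huniq : ∀ l : List (Fin (n + 1)), l.Pairwise (· < ·) → l.length = n + 1 → l = L := by
    intro l hl hl'
    refine List.Perm.eq_of_pairwise (le := (· < ·)) (fun a b _ _ h1 h2 => absurd h2 h1.asymm) hl hL ?_
    refine (List.perm_ext_iff_of_nodup (hl.imp fun h => h.ne) (hL.imp fun h => h.ne)).2 fun i => ?_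
    exact ⟨fun _ => all_mem_of_sorted L hL (by omega) i, fun _ => all_mem_of_sorted l hl (by omega) i⟩
  have hv1 : ∀ i, ∃ b : List (Fin (n + 1)) → Laur κ (Fin (n + 1)),
      (∀ l : List (Fin (n + 1)), l.Pairwise (· < ·) → l.length = n → b l ∈ lhom κ l (t 1)) ∧
      ∀ l : List (Fin (n + 1)), l.Pairwise (· < ·) → l.length = n + 1 →
        v i - cechD b l ∈ GG (I ^ (1 * q + C0)) l (t 1) := by
    intro i
    refine cech_dimension hI r hrn hc (1 * q + C0) n (t 1) (by omega) (fun _ => v i) ?_ ?_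
    · intro l hl hl'
      refine lsup_mono (fun u hu => ⟨?_, fun j hj => absurd (all_mem_of_sorted l hl (by omega) j) hj⟩) (hv i)
      rw [hu]; simp only [t]; push_cast; ring
    · intro l hl hl'
      have := length_le_of_sorted l hl; omega
  choose bv hbv hbv' using hv1
  let c0 : List (Fin (n + 1)) → List (Fin (n + 1)) → Laur κ (Fin (n + 1)) := fun l m =>
    match m with
    | [i] => v i - cechD (bv i) l
    | _ => 0
  have hc0 : DCoch E (n + 1) 1 c0 := by
    intro l hl hl' m hm hm'
    obtain ⟨i, rfl⟩ := List.length_eq_one_iff.1 hm'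
    exact hbv' i l hl hl'
  have hkos : ∀ i j l, kosD φ (c0 l) [i, j] = (toL κ n (f i ^ q) * v j - toL κ n (f j ^ q) * v i)
      - (cechD (fun l => φ i (bv j l)) l - cechD (fun l => φ j (bv i l)) l) := by
    intro i j l
    rw [kosD_cons, kosD_cons, kosD_nil, cechD_map, cechD_map]
    simp only [c0, hφa]
    ring
  have hc1 : ∀ m : List (Fin (n + 1)), ∃ b : List (Fin (n + 1)) → Laur κ (Fin (n + 1)),
      m.Pairwise (· < ·) → m.length = 2 → 
      (∀ l : List (Fin (n + 1)), l.Pairwise (· < ·) → l.length = n → b l ∈ E l 2) ∧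
      cechD b L = kosD φ (c0 L) m := by
    intro m
    by_cases hm : m.Pairwise (· < ·) ∧ m.length = 2
    swap
    · exact ⟨0, fun h1 h2 => absurd ⟨h1, h2⟩ hm⟩
    have hE2 : kosD φ (c0 L) m ∈ E L 2 := hc0.kos hφ L hL hLlen m hm.1 hm.2
    obtain ⟨i, j, rfl⟩ := List.length_eq_two.1 hm.2
    have h1 : kosD φ (c0 L) [i, j] ∈ lsup κ fun u => ∃ i, 0 ≤ u i := by
      rw [hkos]
      refine AddSubgroup.sub_mem _ (hvv i j) (AddSubgroup.sub_mem _ ?_ ?_) <;>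
      exact cechD_mem_nonneg (by omega) L hL hLlen _ fun l hl hl' => hφl l 1 _ _ (hbv _ l hl hl')
    obtain ⟨b0, hb0, hb0'⟩ := exists_cechD_eq_of_nonneg (t := t 2) L hL hLlen _
      (fun u hu => ⟨(GG_le_lhom hE2 u hu).1, h1 u hu⟩)
    obtain ⟨a, rfl⟩ : ∃ a, n = a + 1 := ⟨n - 1, by omega⟩
    obtain ⟨b1, hb1, hb1'⟩ := cech_dimension hI r hrn hc (2 * q + C0) a (t 2) (by omega) b0 hb0
      (fun l hl hl' => by rw [huniq l hl hl', hb0']; exact hE2)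
    refine ⟨fun l => b0 l - cechD b1 l, fun _ _ => ⟨hb1', ?_⟩⟩
    rw [cechD_sub, cechD_cechD, sub_zero, hb0']
  choose c1 hc1 using hc1
  have hc1E : DCoch E n 2 (fun l m => c1 m l) := fun l hl hl' m hm hm' => (hc1 m hm hm').1 l hl hl'
  have hc01 : DEq (n + 1) 2 (fun l => kosD φ (c0 l)) (cechD fun l m => c1 m l) := by
    intro l hl hl' m hm hm'
    rw [huniq l hl hl', cechD_apply]
    exact (hc1 m hm hm').2.symm
  obtain ⟨b, b2, hb, -, hbb⟩ := chase hE hφ hcomm hcol hrow (a := n) (s := 2) le_rfl rfl hc1E (by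
    refine DEq.cech_kos.trans (hc01.symm.kos.trans fun l hl hl' m hm hm' => ?_)
    exact kosD_kosD φ hcomm (c0 l) m)
  obtain ⟨b', hb', hfin⟩ := chase_step hE hcol hc0 hc01 hb hbb
  refine ⟨b' L [], ?_, fun i => ?_⟩
  · refine lsup_mono (fun u hu => ?_) (GG_le_lhom (hb' L hL hLlen [] List.Pairwise.nil rfl))
    rw [hu.1]; simp only [t]; push_cast; ring
  · have h1 := hfin L hL hLlen [i] (by simp) rfl
    simp only [c0, kosD_cons, kosD_nil, sub_zero, hφa] at h1
    rw [cechD_apply] at h1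
    have h2 : v i - toL κ n (f i ^ q) * b' L [] = cechD (fun l => b l [i]) L + cechD (bv i) L := by
      linear_combination h1
    rw [h2]
    refine AddSubgroup.add_mem _ (cechD_mem_nonneg (by omega) L hL hLlen _ (t := t 1) ?_)
      (cechD_mem_nonneg (by omega) L hL hLlen _ (hbv i))
    exact fun l hl hl' => GG_le_lhom (hb l hl hl' [i] (by simp) rfl)

end

section

/-- The module of Koszul (trivial) syzygies of a tuple. -/
def kosRel {R ι : Type*} [CommRing R] [DecidableEq ι] (F : ι → R) : Submodule R (ι → R) :=
  Submodule.span R (Set.range fun p : ι × ι => Pi.single p.1 (F p.2) - Pi.single p.2 (F p.1))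

section Pairing
variable {κ : Type} [Field κ] {n : ℕ}

/-- The residue pairing of Laurent polynomials with polynomials. -/
def resPair (v : Laur κ (Fin (n + 1))) (g : MvPolynomial (Fin (n + 1)) κ) : κ :=
  (v * toL κ n g).coeff fun _ => -1

lemma resPair_add_left (v w : Laur κ (Fin (n + 1))) (g : MvPolynomial (Fin (n + 1)) κ) :
    resPair (v + w) g = resPair v g + resPair w g := by
  simp [resPair, add_mul]

lemma resPair_sub_left (v w : Laur κ (Fin (n + 1))) (g : MvPolynomial (Fin (n + 1)) κ) :
    resPair (v - w) g = resPair v g - resPair w g := by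
  simp [resPair, sub_mul]

lemma resPair_add_right (v : Laur κ (Fin (n + 1))) (g h : MvPolynomial (Fin (n + 1)) κ) :
    resPair v (g + h) = resPair v g + resPair v h := by
  simp [resPair, mul_add]

lemma resPair_sum_right {α : Type} (s : Finset α) (v : Laur κ (Fin (n + 1)))
    (g : α → MvPolynomial (Fin (n + 1)) κ) :
    resPair v (∑ i ∈ s, g i) = ∑ i ∈ s, resPair v (g i) := by
  classical
  induction s using Finset.induction_on with
  | empty => simp [resPair]
  | insert a s h ih => rw [Finset.sum_insert h, Finset.sum_insert h, resPair_add_right, ih]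

lemma resPair_toL_mul (v : Laur κ (Fin (n + 1))) (f g : MvPolynomial (Fin (n + 1)) κ) :
    resPair (toL κ n f * v) g = resPair v (f * g) := by
  rw [resPair, resPair, map_mul, mul_comm (toL κ n f), mul_assoc]

lemma resPair_monomial (v : Laur κ (Fin (n + 1))) (w : Fin (n + 1) →₀ ℕ) (c : κ) :
    resPair v (monomial w c) = v.coeff (fun i => -1 - (w i : ℤ)) * c := by
  rw [resPair, toL_monomial]
  refine lsup_induction (P := fun _ => True) (motive := fun v => (v * AddMonoidAlgebra.single
    (fun i => (w i : ℤ)) c : Laur κ (Fin (n + 1))).coeff (fun _ => -1) =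
      v.coeff (fun i => -1 - (w i : ℤ)) * c) v (fun _ _ => trivial) (by simp) ?_ ?_
  · intro a b h h'; rw [add_mul]; simp only [AddMonoidAlgebra.coeff_add, Finsupp.add_apply]
    rw [h, h', add_mul]
  · intro u b _
    classical
    rw [AddMonoidAlgebra.single_mul_single, AddMonoidAlgebra.coeff_single,
      AddMonoidAlgebra.coeff_single, Finsupp.single_apply, Finsupp.single_apply]
    have : (u + (fun i => (w i : ℤ)) = fun _ => -1) ↔ u = fun i => -1 - (w i : ℤ) := by
      constructor
      · intro h; funext i; have := congrFun h i; simp at this; omega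
      · rintro rfl; funext i; simp
    simp [this]

lemma resPair_of_nonneg {v : Laur κ (Fin (n + 1))} (hv : v ∈ lsup κ fun u => ∃ i, 0 ≤ u i)
    (g : MvPolynomial (Fin (n + 1)) κ) : resPair v g = 0 := by
  induction g using MvPolynomial.induction_on' with
  | monomial w c =>
    rw [resPair_monomial]
    by_contra h
    obtain ⟨i, hi⟩ := hv _ (left_ne_zero_of_mul h)
    have hi : (0 : ℤ) ≤ -1 - (w i : ℤ) := hi
    omega
  | add p q hp hq => rw [resPair_add_right, hp, hq, add_zero]

end Pairing

open Classical in
theorem mem_kosRel_of_lift {κ : Type} [Field κ] {n : ℕ}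
    (F : Fin (n + 1) → MvPolynomial (Fin (n + 1)) κ) (E D : ℕ) (hF : ∀ i, (F i).IsHomogeneous E)
    (hlift : ∀ v : Fin (n + 1) → Laur κ (Fin (n + 1)),
      (∀ i, v i ∈ lsup κ fun u => ∑ i, u i = (- D - n - 1 : ℤ)) →
      (∀ i j, toL κ n (F i) * v j - toL κ n (F j) * v i ∈ lsup κ fun u => ∃ i, 0 ≤ u i) →
      ∃ b, ∀ i, v i - toL κ n (F i) * b ∈ lsup κ fun u => ∃ i, 0 ≤ u i)
    (a : Fin (n + 1) → MvPolynomial (Fin (n + 1)) κ) (ha : ∀ i, (a i).IsHomogeneous D)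
    (hsum : ∑ i, a i * F i = 0) : a ∈ kosRel F := by
  by_contra hcon
  obtain ⟨φ, hφa, hφ⟩ := Submodule.exists_le_ker_of_notMem (p := (kosRel F).restrictScalars κ)
    (v := a) (by simpa using hcon)
  set T : Finset (Fin (n + 1) →₀ ℕ) := Finset.univ.finsuppAntidiag D with hT
  have hTm : ∀ u, u ∈ T ↔ ∑ i, u i = D := by intro u; simp [hT]
  let v : Fin (n + 1) → Laur κ (Fin (n + 1)) := fun i =>
    ∑ u ∈ T, AddMonoidAlgebra.single (fun t => -1 - (u t : ℤ)) (φ (Pi.single i (monomial u 1)))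
  have hv : ∀ i, v i ∈ lsup κ fun u => ∑ i, u i = (- D - n - 1 : ℤ) := by
    intro i
    refine AddSubgroup.sum_mem _ fun u hu => single_mem_lsup _ ?_
    have := (hTm u).1 hu
    rw [Finset.sum_sub_distrib, ← Nat.cast_sum, this]
    simp; ring
  have hpair : ∀ i, ∀ g : MvPolynomial (Fin (n + 1)) κ, g.IsHomogeneous D →
      resPair (v i) g = φ (Pi.single i g) := by
    intro i g hg
    have hmon : ∀ w ∈ g.support, resPair (v i) (monomial w (g.coeff w)) =
        φ (Pi.single i (monomial w (g.coeff w))) := by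
      intro w hw
      have hwT : w ∈ T := by
        rw [hTm]
        have := hg (MvPolynomial.mem_support_iff.1 hw)
        rw [Finsupp.weight_apply, Finsupp.sum_fintype _ _ (by simp)] at this
        simpa using this
      rw [resPair_monomial]
      have h1 : (v i).coeff (fun t => -1 - (w t : ℤ)) = φ (Pi.single i (monomial w 1)) := by
        simp only [v, AddMonoidAlgebra.coeff_sum, Finsupp.coe_finsetSum, Finset.sum_apply,
          AddMonoidAlgebra.coeff_single, Finsupp.single_apply]
        rw [Finset.sum_eq_single w]
        · simp
        · intro u _ hne
          rw [if_neg]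
          intro h
          apply hne
          ext t
          have := congrFun h t
          simp at this
          omega
        · intro h; exact absurd hwT h
      have h2 : (Pi.single i (monomial w (g.coeff w)) : Fin (n + 1) → MvPolynomial (Fin (n + 1)) κ)
          = g.coeff w • Pi.single i (monomial w 1) := by
        rw [← Pi.single_smul]; congr 1; simp [MvPolynomial.smul_monomial]
      rw [h1, h2, map_smul, smul_eq_mul, mul_comm]
    have h3 : (Pi.single i g : Fin (n + 1) → MvPolynomial (Fin (n + 1)) κ) =
        ∑ w ∈ g.support, Pi.single i (monomial w (g.coeff w)) := by
      conv_lhs => rw [g.as_sum]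
      exact map_sum (AddMonoidHom.single (fun _ => MvPolynomial (Fin (n + 1)) κ) i) _ _
    rw [h3, map_sum]
    conv_lhs => rw [g.as_sum]
    rw [resPair_sum_right]
    exact Finset.sum_congr rfl hmon
  have hrel : ∀ i j, toL κ n (F i) * v j - toL κ n (F j) * v i ∈ lsup κ fun u => ∃ i, 0 ≤ u i := by
    intro i j u hu
    by_contra hneg
    push Not at hneg
    apply hu
    let w : Fin (n + 1) →₀ ℕ := Finsupp.equivFunOnFinite.symm fun t => (-1 - u t).toNat
    have huw : u = fun t => -1 - (w t : ℤ) := by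
      funext t; have := hneg t; simp [w]; omega
    have hdeg : ∑ i, u i = E + (- D - n - 1 : ℤ) := by
      have h1 : ∀ i j, toL κ n (F i) * v j ∈ lsup κ fun u => ∑ i, u i = E + (- D - n - 1 : ℤ) :=
        fun i j => mul_mem_lsup (fun u u' h h' => by
          simp only [Pi.add_apply, Finset.sum_add_distrib, h, h'])
          (lsup_mono (fun u h => h.1) (toL_mem_lhom (hF i) [])) (hv j)
      exact AddSubgroup.sub_mem _ (h1 i j) (h1 j i) u hu
    have hwdeg : E + ∑ t, w t = D := by
      rw [huw, Finset.sum_sub_distrib, ← Nat.cast_sum] at hdeg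
      simp at hdeg; zify; push_cast at hdeg ⊢; linarith
    have hwh : ∀ i, (F i * monomial w (1 : κ)).IsHomogeneous D := by
      intro i
      rw [← hwdeg]
      refine (hF i).mul (isHomogeneous_monomial _ ?_)
      rw [Finsupp.degree_eq_sum]
    have h2 := resPair_monomial (toL κ n (F i) * v j - toL κ n (F j) * v i) w 1
    rw [mul_one, ← huw] at h2
    rw [← h2, resPair_sub_left, resPair_toL_mul, resPair_toL_mul, hpair _ _ (hwh i),
      hpair _ _ (hwh j), ← map_sub]
    apply LinearMap.mem_ker.1
    apply hφ
    have h3 : (Pi.single j (F i) - Pi.single i (F j) : Fin (n + 1) → MvPolynomial (Fin (n + 1)) κ)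
        ∈ kosRel F := Submodule.subset_span ⟨(j, i), rfl⟩
    have h4 := (kosRel F).smul_mem (monomial w (1 : κ)) h3
    rw [smul_sub, ← Pi.single_smul, ← Pi.single_smul, smul_eq_mul, smul_eq_mul,
      mul_comm, mul_comm _ (F j)] at h4
    exact h4
  obtain ⟨b, hb⟩ := hlift v hv hrel
  apply hφa
  have h1 : a = ∑ i, Pi.single i (a i) := (Finset.univ_sum_single a).symm
  rw [h1, map_sum]
  calc ∑ i, φ (Pi.single i (a i)) = ∑ i, resPair b (F i * a i) := by
        refine Finset.sum_congr rfl fun i _ => ?_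
        rw [← hpair i _ (ha i), ← resPair_toL_mul, ← sub_eq_zero, ← resPair_sub_left]
        exact resPair_of_nonneg (hb i) _
    _ = resPair b (∑ i, a i * F i) := by
        rw [resPair_sum_right]
        exact Finset.sum_congr rfl fun i _ => by rw [mul_comm]
    _ = 0 := by rw [hsum]; simp [resPair]

end

section

section Frobenius
variable {κ : Type} [Field κ] {n : ℕ}

open Classical in
/-- The left inverse of `MvPolynomial.expand q`: keep the monomials which are `q`-th powers. -/
def contractPow (κ : Type) [Field κ] (n q : ℕ) :
    MvPolynomial (Fin (n + 1)) κ →ₗ[κ] MvPolynomial (Fin (n + 1)) κ :=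
  (basisMonomials (Fin (n + 1)) κ).constr κ fun u =>
    if ∃ v : Fin (n + 1) →₀ ℕ, u = q • v then
      monomial (Finsupp.equivFunOnFinite.symm fun i => u i / q) 1 else 0

lemma contractPow_monomial_smul {q : ℕ} (hq : q ≠ 0) (v : Fin (n + 1) →₀ ℕ) (c : κ) :
    contractPow κ n q (monomial (q • v) c) = monomial v c := by
  have h1 : monomial (q • v) c = c • basisMonomials (Fin (n + 1)) κ (q • v) := by
    simp [MvPolynomial.smul_monomial]
  rw [h1, map_smul, contractPow, Module.Basis.constr_basis, if_pos ⟨v, rfl⟩, smul_monomial]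
  simp only [smul_eq_mul, mul_one]
  congr 1
  ext i
  simp [Nat.pos_of_ne_zero hq]

lemma contractPow_monomial_not {q : ℕ} (u : Fin (n + 1) →₀ ℕ) (c : κ)
    (hu : ¬ ∃ v : Fin (n + 1) →₀ ℕ, u = q • v) :
    contractPow κ n q (monomial u c) = 0 := by
  have h1 : monomial u c = c • basisMonomials (Fin (n + 1)) κ u := by
    simp [MvPolynomial.smul_monomial]
  rw [h1, map_smul, contractPow, Module.Basis.constr_basis, if_neg hu, smul_zero]

lemma contractPow_expand_mul {q : ℕ} (hq : q ≠ 0) (g s : MvPolynomial (Fin (n + 1)) κ) :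
    contractPow κ n q (expand q g * s) = g * contractPow κ n q s := by
  induction g using MvPolynomial.induction_on' with
  | add g g' h h' => rw [map_add, add_mul, map_add, h, h', add_mul]
  | monomial v c =>
  induction s using MvPolynomial.induction_on' with
  | add g g' h h' => rw [mul_add, map_add, h, h', map_add, mul_add]
  | monomial u b =>
  rw [expand_monomial, monomial_mul]
  by_cases hu : ∃ w : Fin (n + 1) →₀ ℕ, u = q • w
  · obtain ⟨w, rfl⟩ := hu
    rw [← smul_add, contractPow_monomial_smul hq, contractPow_monomial_smul hq, monomial_mul]
  · rw [contractPow_monomial_not u b hu, mul_zero, contractPow_monomial_not]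
    rintro ⟨w, hw⟩
    apply hu
    refine ⟨w - v, ?_⟩
    ext i
    have := DFunLike.congr_fun hw i
    simp only [Finsupp.add_apply, Finsupp.smul_apply, smul_eq_mul, Finsupp.tsub_apply] at this ⊢
    rw [Nat.mul_sub, ← this]; omega

lemma contractPow_expand {q : ℕ} (hq : q ≠ 0) (g : MvPolynomial (Fin (n + 1)) κ) :
    contractPow κ n q (expand q g) = g := by
  have h1 : contractPow κ n q 1 = 1 := by
    have := contractPow_monomial_smul (κ := κ) (n := n) hq 0 1
    simpa using this
  have := contractPow_expand_mul hq g 1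
  rwa [mul_one, h1, mul_one] at this

lemma expand_card_pow [Fintype κ] (N : ℕ) (g : MvPolynomial (Fin (n + 1)) κ) :
    expand (Fintype.card κ ^ N) g = g ^ (Fintype.card κ ^ N) := by
  obtain ⟨p, hp⟩ := CharP.exists κ
  haveI := hp
  obtain ⟨m, hprime, hm⟩ := FiniteField.card κ p
  haveI : Fact p.Prime := ⟨hprime⟩
  have h1 : ∀ g : MvPolynomial (Fin (n + 1)) κ, expand (Fintype.card κ) g = g ^ Fintype.card κ := by
    intro g
    have h2 : ((expand (Fintype.card κ) : MvPolynomial (Fin (n + 1)) κ →ₐ[κ] _) :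
        MvPolynomial (Fin (n + 1)) κ →+* MvPolynomial (Fin (n + 1)) κ) =
        iterateFrobenius (MvPolynomial (Fin (n + 1)) κ) p m := by
      apply MvPolynomial.ringHom_ext
      · intro a
        rw [iterateFrobenius_def, ← hm, ← C_pow, FiniteField.pow_card]
        simp
      · intro i
        rw [iterateFrobenius_def, ← hm]
        simp
    have := congrArg (fun φ => φ g) h2
    simp only [iterateFrobenius_def, ← hm] at this
    exact this
  induction N generalizing g with
  | zero => simp
  | succ N ih => rw [pow_succ, expand_mul, h1, map_pow, ih, ← pow_mul]

open Classical in
lemma mem_kosRel_of_pow [Fintype κ] (N : ℕ) (f a : Fin (n + 1) → MvPolynomial (Fin (n + 1)) κ)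
    (h : (fun i => a i ^ (Fintype.card κ ^ N)) ∈ kosRel fun i => f i ^ (Fintype.card κ ^ N)) :
    a ∈ kosRel f := by
  set q := Fintype.card κ ^ N with hq
  have hq0 : q ≠ 0 := pow_ne_zero _ Fintype.card_ne_zero
  have key : ∀ b ∈ kosRel (fun i => f i ^ q), (fun i => contractPow κ n q (b i)) ∈ kosRel f := by
    intro b hb
    obtain ⟨c, rfl⟩ := (Submodule.mem_span_range_iff_exists_fun _).1 hb
    have : (fun i => contractPow κ n q ((∑ p, c p • (fun p : Fin (n + 1) × Fin (n + 1) =>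
        (Pi.single p.1 (f p.2 ^ q) - Pi.single p.2 (f p.1 ^ q) :
          Fin (n + 1) → MvPolynomial (Fin (n + 1)) κ)) p) i)) =
        ∑ p, contractPow κ n q (c p) •
          (Pi.single p.1 (f p.2) - Pi.single p.2 (f p.1) : Fin (n + 1) → MvPolynomial (Fin (n + 1)) κ) := by
      funext i
      rw [Finset.sum_apply, map_sum, Finset.sum_apply]
      refine Finset.sum_congr rfl fun p _ => ?_
      have hs : ∀ (j : Fin (n + 1)) (g : MvPolynomial (Fin (n + 1)) κ),
          contractPow κ n q (c p * (Pi.single j (g ^ q) : Fin (n + 1) → _) i) =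
          contractPow κ n q (c p) * (Pi.single j g : Fin (n + 1) → _) i := by
        intro j g
        by_cases hj : i = j
        · subst hj
          rw [Pi.single_eq_same, Pi.single_eq_same, ← expand_card_pow, ← hq, mul_comm,
            contractPow_expand_mul hq0, mul_comm]
        · rw [Pi.single_eq_of_ne hj, Pi.single_eq_of_ne hj, mul_zero, map_zero, mul_zero]
      simp only [Pi.smul_apply, Pi.sub_apply, smul_eq_mul, mul_sub, map_sub, hs]
    rw [this]
    exact Submodule.sum_mem _ fun p _ => Submodule.smul_mem _ _ (Submodule.subset_span ⟨p, rfl⟩)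
  have := key _ h
  simp only [hq] at this
  simp only [← expand_card_pow] at this
  simp only [← hq, contractPow_expand hq0] at this
  exact this

end Frobenius

open Classical in
/-- Over a finite field, the Koszul complex of forms generating the ideal sheaf of a complete
intersection-like scheme is exact at the first spot in low degrees. -/
theorem koszul_exact_finite {κ : Type} [Field κ] [Finite κ] {n c : ℕ}
    (h : Fin c → MvPolynomial (Fin (n + 1)) κ) (e : ℕ) (he : 1 ≤ e) (hh : ∀ j, (h j).IsHomogeneous e)
    (f : Fin (n + 1) → MvPolynomial (Fin (n + 1)) κ) (δ : ℕ) (hf : ∀ i, (f i).IsHomogeneous δ)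
    (hfI : ∀ i, f i ∈ Ideal.span (Set.range h)) (M : ℕ)
    (hhf : ∀ a j, X a ^ M * h j ∈ Ideal.span (Set.range f))
    (r : ℕ) (hr2 : 2 ≤ r) (hrn : r ≤ n)
    (hc : ∀ α : Fin (n + 1), ∃ c : ℕ,
      X α ^ c ∈ Ideal.span (Set.range h) ⊔ Ideal.span (X '' {i : Fin (n + 1) | r ≤ (i : ℕ)}))
    (D : ℕ) (hk : ∀ s, r + 1 ≤ s → s * e + (D + δ) + 1 ≤ s * δ)
    (a : Fin (n + 1) → MvPolynomial (Fin (n + 1)) κ) (ha : ∀ i, (a i).IsHomogeneous D)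
    (hsum : ∑ i, a i * f i = 0) : a ∈ kosRel f := by
  haveI := Fintype.ofFinite κ
  have hf0 : ∃ i, f i ≠ 0 := by
    by_contra hcon
    push Not at hcon
    have hspan : Ideal.span (Set.range f) = ⊥ := by
      rw [Ideal.span_eq_bot]; rintro _ ⟨i, rfl⟩; exact hcon i
    have hz : ∀ j, h j = 0 := by
      intro j
      have := hhf 0 j
      rw [hspan, Ideal.mem_bot] at this
      exact (mul_eq_zero.1 this).resolve_left (pow_ne_zero _ (X_ne_zero _))
    obtain ⟨N, hN⟩ := hc 0
    have hle : Ideal.span (Set.range h) ⊔ Ideal.span (X '' {i : Fin (n + 1) | r ≤ (i : ℕ)}) ≤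
        RingHom.ker (eval (Pi.single 0 1 : Fin (n + 1) → κ)) := by
      refine sup_le ?_ ?_ <;> rw [Ideal.span_le]
      · rintro _ ⟨j, rfl⟩; simp [hz j]
      · rintro _ ⟨i, hi, rfl⟩
        have : i ≠ 0 := by rintro rfl; simp at hi; omega
        simp [RingHom.mem_ker, this]
    have := hle hN
    simp [RingHom.mem_ker] at this
  obtain ⟨Q0, hQ⟩ := exists_lift h e he hh f δ hf hf0 hfI M hhf r hr2 hrn hc (D + δ) hk
  have hQc : Q0 ≤ Fintype.card κ ^ Q0 := (Nat.lt_pow_self Fintype.one_lt_card).le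
  refine mem_kosRel_of_pow Q0 f a ?_
  set q := Fintype.card κ ^ Q0 with hq
  refine mem_kosRel_of_lift (fun i => f i ^ q) (δ * q) (D * q) (fun i => (hf i).pow q) ?_ _
    (fun i => (ha i).pow q) ?_
  · intro v hv hrel
    obtain ⟨b, -, hb⟩ := hQ q hQc v (fun i => by
      refine lsup_mono (fun u hu => ?_) (hv i)
      rw [hu]; push_cast; ring) hrel
    exact ⟨b, hb⟩
  · have := congrArg (expand q) hsum
    rw [map_sum, map_zero] at this
    rw [← this]
    refine Finset.sum_congr rfl fun i _ => ?_
    rw [map_mul, hq, expand_card_pow, expand_card_pow]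

end

section

section Rank

lemma exists_mul_mul_eq_one {κ a b : Type*} [Field κ] [Fintype a] [Fintype b] [DecidableEq a]
    [DecidableEq b] (M : Matrix a b κ) :
    ∃ (P : Matrix (Fin M.rank) a κ) (Q : Matrix b (Fin M.rank) κ), P * M * Q = 1 := by
  let φ : (b → κ) →ₗ[κ] (a → κ) := Matrix.toLin' M
  let ε : LinearMap.range φ ≃ₗ[κ] (Fin M.rank → κ) :=
    (Module.finBasis κ (LinearMap.range φ)).equivFun
  obtain ⟨g, hg⟩ := LinearMap.exists_leftInverse_of_injective (LinearMap.range φ).subtype (by simp)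
  obtain ⟨t, ht⟩ := LinearMap.exists_rightInverse_of_surjective φ.rangeRestrict
    (LinearMap.range_rangeRestrict φ)
  refine ⟨LinearMap.toMatrix' (ε.toLinearMap ∘ₗ g), LinearMap.toMatrix' (t ∘ₗ ε.symm.toLinearMap), ?_⟩
  have hM : M = LinearMap.toMatrix' φ := (LinearMap.toMatrix'_toLin' M).symm
  conv_lhs => rw [show LinearMap.toMatrix' (ε.toLinearMap ∘ₗ g) * M =
    LinearMap.toMatrix' (ε.toLinearMap ∘ₗ g) * LinearMap.toMatrix' φ by rw [← hM]]
  rw [← LinearMap.toMatrix'_comp, ← LinearMap.toMatrix'_comp, ← LinearMap.toMatrix'_id]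
  congr 1
  ext x : 2
  · have h1 : ∀ y, φ (t y) = y := fun y => by
      have := congrArg (fun ψ => ((ψ y : LinearMap.range φ) : a → κ)) ht
      simpa using this
    have h2 : ∀ y : LinearMap.range φ, g y = y := fun y => by
      have := congrArg (fun ψ => ψ y) hg
      simpa using this
    simp [h1, h2]

lemma rank_map_le_rank_map {A κ K a b : Type*} [CommRing A] [Field κ] [Field K] [Fintype a] [Fintype b]
    [DecidableEq a] [DecidableEq b] (σ : A →+* κ) (hσ : Function.Surjective σ) (τ : A →+* K)
    (hτ : Function.Injective τ) (M : Matrix a b A) : (M.map σ).rank ≤ (M.map τ).rank := by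
  obtain ⟨P, Q, hPQ⟩ := exists_mul_mul_eq_one (M.map σ)
  choose s hs using hσ
  have hP : (P.map s).map σ = P := by ext i j; simp [hs]
  have hQ : (Q.map s).map σ = Q := by ext i j; simp [hs]
  have h1 : σ ((P.map s * M * Q.map s).det) = 1 := by
    rw [RingHom.map_det, RingHom.mapMatrix_apply, Matrix.map_mul, Matrix.map_mul, hP, hQ, hPQ,
      Matrix.det_one]
  have h2 : ((P.map s * M * Q.map s).map τ).det ≠ 0 := by
    rw [← RingHom.mapMatrix_apply, ← RingHom.map_det]
    intro h
    rw [map_eq_zero_iff τ hτ] at h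
    rw [h] at h1
    simp at h1
  have h3 := Matrix.rank_of_isUnit _ ((Matrix.isUnit_iff_isUnit_det _).2 (isUnit_iff_ne_zero.2 h2))
  rw [Fintype.card_fin] at h3
  rw [← h3, Matrix.map_mul, Matrix.map_mul]
  exact (Matrix.rank_mul_le_left _ _).trans (Matrix.rank_mul_le_right _ _)

lemma exact_of_exact_residue {A κ K a b c : Type*} [CommRing A] [Field κ] [Field K]
    [Fintype a] [Fintype b] [Fintype c]
    [DecidableEq a] [DecidableEq b] [DecidableEq c] (σ : A →+* κ) (hσ : Function.Surjective σ)
    (τ : A →+* K) (hτ : Function.Injective τ) (M₁ : Matrix a b A) (M₂ : Matrix b c A)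
    (h0 : ∀ y, (M₁.map τ).mulVec ((M₂.map τ).mulVec y) = 0)
    (h : ∀ x, (M₁.map σ).mulVec x = 0 → ∃ y, (M₂.map σ).mulVec y = x)
    (x : b → K) (hx : (M₁.map τ).mulVec x = 0) : ∃ y, (M₂.map τ).mulVec y = x := by
  have e1 : (M₁.map σ).rank + Module.finrank κ (LinearMap.ker (M₁.map σ).mulVecLin) = Fintype.card b := by
    rw [Matrix.rank, LinearMap.finrank_range_add_finrank_ker, Module.finrank_fintype_fun_eq_card]
  have e2 : (M₁.map τ).rank + Module.finrank K (LinearMap.ker (M₁.map τ).mulVecLin) = Fintype.card b := by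
    rw [Matrix.rank, LinearMap.finrank_range_add_finrank_ker, Module.finrank_fintype_fun_eq_card]
  have i1 : Module.finrank κ (LinearMap.ker (M₁.map σ).mulVecLin) ≤ (M₂.map σ).rank := by
    apply Submodule.finrank_mono
    intro x hx
    obtain ⟨y, hy⟩ := h x (by simpa using hx)
    exact ⟨y, by simpa using hy⟩
  have i2 := rank_map_le_rank_map σ hσ τ hτ M₁
  have i3 := rank_map_le_rank_map σ hσ τ hτ M₂
  have hle : LinearMap.range (M₂.map τ).mulVecLin ≤ LinearMap.ker (M₁.map τ).mulVecLin := by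
    rintro _ ⟨y, rfl⟩
    simpa using h0 y
  have heq := Submodule.eq_of_le_of_finrank_le hle (by
    change _ ≤ (M₂.map τ).rank
    omega)
  have : x ∈ LinearMap.range (M₂.map τ).mulVecLin := by rw [heq]; simpa using hx
  obtain ⟨y, hy⟩ := this
  exact ⟨y, by simpa using hy⟩

end Rank

instance isJacobsonRing_int : IsJacobsonRing ℤ := by
  rw [isJacobsonRing_iff_prime_eq]
  intro P hP
  by_cases hbot : P = ⊥
  · subst hbot
    rw [eq_bot_iff]
    intro x hx
    by_contra hx0
    rw [Ideal.mem_bot] at hx0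
    obtain ⟨p, hp, hprime⟩ := Nat.exists_infinite_primes (x.natAbs + 1)
    have hmax : (Ideal.span {(p : ℤ)}).IsMaximal :=
      PrincipalIdealRing.isMaximal_of_irreducible (Nat.prime_iff_prime_int.1 hprime).irreducible
    have h1 : x ∈ Ideal.span {(p : ℤ)} := (Ideal.mem_sInf.1 hx) ⟨bot_le, hmax⟩
    have h2 := Int.natAbs_dvd_natAbs.2 (Ideal.mem_span_singleton.1 h1)
    rw [Int.natAbs_natCast] at h2
    have := Nat.le_of_dvd (Int.natAbs_pos.2 hx0) h2
    omega
  · have := Ring.DimensionLEOne.maximalOfPrime hbot hP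
    exact Ideal.jacobson_eq_self_of_isMaximal

lemma finite_of_finiteType_int {κ : Type*} [Field κ] {f : ℤ →+* κ} (hf : f.FiniteType) : Finite κ := by
  rw [Subsingleton.elim f (algebraMap ℤ κ), RingHom.finiteType_algebraMap] at hf
  have : Module.Finite ℤ κ := finite_of_finite_type_of_isJacobsonRing ℤ κ
  obtain ⟨p, hp⟩ := CharP.exists κ
  rcases CharP.char_is_prime_or_zero κ p with h | h
  · have : Fact p.Prime := ⟨h⟩
    let _ := ZMod.algebra κ p
    have : Module.Finite (ZMod p) κ := Module.Finite.of_restrictScalars_finite ℤ _ _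
    exact Module.finite_of_finite (ZMod p)
  · subst h
    have : CharZero κ := CharP.charP_to_charZero κ
    exact absurd (isField_of_isIntegral_of_isField (R := ℤ) (S := κ)
      (by simpa using (algebraMap ℤ κ).injective_int) (Field.toIsField κ)) Int.not_isField

lemma exists_reduction {σ : Type} (P : Set (MvPolynomial σ ℂ)) (hfin : P.Finite) :
    ∃ (A : Type) (_ : CommRing A) (κ : Type) (_ : Field κ) (_ : Finite κ) (s : A →+* κ) (t : A →+* ℂ),
      Function.Surjective s ∧ Function.Injective t ∧ ∀ p ∈ P, ∃ p', MvPolynomial.map t p' = p := by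
  classical
  let T : Finset ℂ := hfin.toFinset.biUnion fun p => p.coeffs
  let A := Algebra.adjoin ℤ (T : Set ℂ)
  have hft : Algebra.FiniteType ℤ A := (Subalgebra.fg_iff_finiteType _).1 ⟨T, rfl⟩
  obtain ⟨m, hm⟩ := Ideal.exists_maximal A
  letI := Ideal.Quotient.field m
  have hfin' : Finite (A ⧸ m) := by
    exact finite_of_finiteType_int
      ((RingHom.FiniteType.of_surjective _ Ideal.Quotient.mk_surjective).comp
        (RingHom.finiteType_algebraMap.2 hft) : ((Ideal.Quotient.mk m).comp (algebraMap ℤ A)).FiniteType)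
  refine ⟨A, inferInstance, A ⧸ m, inferInstance, hfin', Ideal.Quotient.mk m,
    A.subtype, Ideal.Quotient.mk_surjective, Subtype.coe_injective, ?_⟩
  intro p hp
  have : p ∈ Set.range (MvPolynomial.map (σ := σ) (A.subtype : A →+* ℂ)) := by
    rw [mem_range_map_iff_coeffs_subset]
    intro x hx
    refine ⟨⟨x, Algebra.subset_adjoin ?_⟩, rfl⟩
    simp only [T, Finset.coe_biUnion, Set.mem_iUnion]
    exact ⟨p, by simpa using hp, hx⟩
  exact this

end

section

section Matrices
variable {B B' : Type} [CommRing B] [CommRing B'] {n : ℕ}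

/-- Exponents of degree `D`. -/
abbrev Mon (n D : ℕ) : Type := {u : Fin (n + 1) →₀ ℕ // u ∈ Finset.univ.finsuppAntidiag D}

/-- Exponents whose degree added to `δ` is `D`. -/
abbrev MonSub (n D δ : ℕ) : Type :=
  {u : Fin (n + 1) →₀ ℕ // u ∈ if δ ≤ D then Finset.univ.finsuppAntidiag (D - δ) else ∅}

lemma mem_mon {D : ℕ} {u : Fin (n + 1) →₀ ℕ} :
    u ∈ (Finset.univ : Finset (Fin (n + 1))).finsuppAntidiag D ↔ u.degree = D := by
  simp [Finsupp.degree_eq_sum]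

lemma mem_monSub {D δ : ℕ} {u : Fin (n + 1) →₀ ℕ} :
    (u ∈ if δ ≤ D then (Finset.univ : Finset (Fin (n + 1))).finsuppAntidiag (D - δ) else ∅) ↔
      u.degree + δ = D := by
  split_ifs with h
  · rw [mem_mon]; omega
  · simp; omega

/-- The matrix of `(a_i) ↦ ∑ a_i f_i`, for `a_i` of degree `D`. -/
def kosMat₁ (f : Fin (n + 1) → MvPolynomial (Fin (n + 1)) B) (D δ : ℕ) :
    Matrix (Mon n (D + δ)) (Fin (n + 1) × Mon n D) B :=
  Matrix.of fun u q => coeff u.1 (monomial q.2.1 1 * f q.1)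

/-- The matrix of the Koszul relations with values in degree `D`. -/
def kosMat₂ (f : Fin (n + 1) → MvPolynomial (Fin (n + 1)) B) (D δ : ℕ) :
    Matrix (Fin (n + 1) × Mon n D) ((Fin (n + 1) × Fin (n + 1)) × MonSub n D δ) B :=
  Matrix.of fun q p => coeff q.2.1 (monomial p.2.1 1 *
    (Pi.single p.1.1 (f p.1.2) - Pi.single p.1.2 (f p.1.1) :
      Fin (n + 1) → MvPolynomial (Fin (n + 1)) B) q.1)

lemma kosMat₁_map (s : B →+* B') (f : Fin (n + 1) → MvPolynomial (Fin (n + 1)) B) (D δ : ℕ) :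
    (kosMat₁ f D δ).map s = kosMat₁ (fun i => MvPolynomial.map s (f i)) D δ := by
  ext u q
  simp [kosMat₁, ← coeff_map]

lemma kosMat₂_map (s : B →+* B') (f : Fin (n + 1) → MvPolynomial (Fin (n + 1)) B) (D δ : ℕ) :
    (kosMat₂ f D δ).map s = kosMat₂ (fun i => MvPolynomial.map s (f i)) D δ := by
  ext u q
  have h : ∀ i j k, (Pi.single i (MvPolynomial.map s (f j)) : Fin (n + 1) → MvPolynomial (Fin (n + 1)) B') k
      = MvPolynomial.map s ((Pi.single i (f j) : Fin (n + 1) → _) k) := by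
    intro i j k
    by_cases hk : k = i
    · subst hk; simp
    · simp [hk]
  simp only [kosMat₂, Matrix.map_apply, Matrix.of_apply, ← coeff_map, map_mul, map_monomial, map_one,
    Pi.sub_apply, map_sub, h]

/-- The tuple of forms of degree `D` with given coefficients. -/
def vecPoly {D : ℕ} {ι : Type} (x : ι × Mon n D → B) (i : ι) : MvPolynomial (Fin (n + 1)) B :=
  ∑ w : Mon n D, monomial w.1 (x (i, w))

lemma vecPoly_isHomogeneous {D : ℕ} {ι : Type} (x : ι × Mon n D → B) (i : ι) :
    (vecPoly x i).IsHomogeneous D :=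
  IsHomogeneous.sum _ _ _ fun w _ => isHomogeneous_monomial _ (mem_mon.1 w.2)

lemma exists_vecPoly {D : ℕ} {ι : Type} (a : ι → MvPolynomial (Fin (n + 1)) B)
    (ha : ∀ i, (a i).IsHomogeneous D) : vecPoly (fun q : ι × Mon n D => coeff q.2.1 (a q.1)) = a := by
  funext i
  ext u
  rw [vecPoly, coeff_sum]
  simp only [coeff_monomial]
  by_cases hu : u ∈ Finset.univ.finsuppAntidiag D
  · rw [Finset.sum_eq_single ⟨u, hu⟩]
    · simp
    · intro w _ hw
      rw [if_neg]
      intro h; exact hw (Subtype.ext h)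
    · simp
  · rw [(ha i).coeff_eq_zero (by rwa [mem_mon] at hu)]
    refine Finset.sum_eq_zero fun w _ => if_neg ?_
    rintro rfl
    exact hu w.2

lemma coeff_vecPoly {D : ℕ} {ι : Type} (x : ι × Mon n D → B) (q : ι × Mon n D) :
    coeff q.2.1 (vecPoly x q.1) = x q := by
  rw [vecPoly, coeff_sum, Finset.sum_eq_single q.2]
  · simp
  · intro w _ hw
    rw [coeff_monomial, if_neg]
    intro h; exact hw (Subtype.ext h)
  · simp

lemma coeff_monomial_mul_smul (w u : Fin (n + 1) →₀ ℕ) (c : B) (g : MvPolynomial (Fin (n + 1)) B) :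
    coeff u (monomial w 1 * g) * c = coeff u (monomial w c * g) := by
  have : (monomial w c : MvPolynomial (Fin (n + 1)) B) = C c * monomial w 1 := by simp [C_mul_monomial]
  rw [this, mul_assoc, coeff_C_mul, mul_comm]

lemma kosMat₁_mulVec (f : Fin (n + 1) → MvPolynomial (Fin (n + 1)) B) (D δ : ℕ)
    (x : Fin (n + 1) × Mon n D → B) (u : Mon n (D + δ)) :
    (kosMat₁ f D δ).mulVec x u = coeff u.1 (∑ i, vecPoly x i * f i) := by
  rw [Matrix.mulVec, dotProduct, coeff_sum, Fintype.sum_prod_type]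
  refine Finset.sum_congr rfl fun i _ => ?_
  rw [vecPoly, Finset.sum_mul, coeff_sum]
  exact Finset.sum_congr rfl fun w _ => coeff_monomial_mul_smul _ _ _ _

lemma kosMat₁_mulVec_eq_zero (f : Fin (n + 1) → MvPolynomial (Fin (n + 1)) B) (D δ : ℕ)
    (hf : ∀ i, (f i).IsHomogeneous δ) (x : Fin (n + 1) × Mon n D → B) :
    (kosMat₁ f D δ).mulVec x = 0 ↔ ∑ i, vecPoly x i * f i = 0 := by
  constructor
  · intro h
    have hh : (∑ i, vecPoly x i * f i).IsHomogeneous (D + δ) :=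
      IsHomogeneous.sum _ _ _ fun i _ => (vecPoly_isHomogeneous x i).mul (hf i)
    ext u
    by_cases hu : u.degree = D + δ
    · have := congrFun h ⟨u, mem_mon.2 hu⟩
      rw [kosMat₁_mulVec] at this
      simpa using this
    · rw [hh.coeff_eq_zero hu]; simp
  · intro h
    funext u
    rw [kosMat₁_mulVec, h]; simp

open Classical in
/-- The tuple of forms `b_p` with prescribed coefficients, combined into a Koszul relation. -/
lemma kosMat₂_mulVec (f : Fin (n + 1) → MvPolynomial (Fin (n + 1)) B) (D δ : ℕ)
    (y : (Fin (n + 1) × Fin (n + 1)) × MonSub n D δ → B) (q : Fin (n + 1) × Mon n D) :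
    (kosMat₂ f D δ).mulVec y q = coeff q.2.1 ((∑ p : Fin (n + 1) × Fin (n + 1),
      (∑ w : MonSub n D δ, monomial w.1 (y (p, w))) • (Pi.single p.1 (f p.2) - Pi.single p.2 (f p.1) :
      Fin (n + 1) → MvPolynomial (Fin (n + 1)) B)) q.1) := by
  rw [Matrix.mulVec, dotProduct, Finset.sum_apply, coeff_sum, Fintype.sum_prod_type]
  refine Finset.sum_congr rfl fun p _ => ?_
  rw [Pi.smul_apply, smul_eq_mul, Finset.sum_mul, coeff_sum]
  refine Finset.sum_congr rfl fun w _ => ?_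
  rw [← coeff_monomial_mul_smul]
  congr!

lemma rel_isHomogeneous {f : Fin (n + 1) → MvPolynomial (Fin (n + 1)) B} {δ : ℕ}
    (hf : ∀ i, (f i).IsHomogeneous δ) (i j k : Fin (n + 1)) :
    ((Pi.single i (f j) - Pi.single j (f i) : Fin (n + 1) → MvPolynomial (Fin (n + 1)) B) k).IsHomogeneous
      δ := by
  have h : ∀ i j k, ((Pi.single i (f j) : Fin (n + 1) → MvPolynomial (Fin (n + 1)) B) k).IsHomogeneous δ := by
    intro i j k
    by_cases hk : k = i
    · subst hk; simpa using hf j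
    · simpa [hk] using isHomogeneous_zero _ _ _
  exact (h i j k).sub (h j i k)

open Classical in
lemma mem_kosRel_iff (f : Fin (n + 1) → MvPolynomial (Fin (n + 1)) B) (D δ : ℕ)
    (hf : ∀ i, (f i).IsHomogeneous δ) (x : Fin (n + 1) × Mon n D → B) :
    vecPoly x ∈ kosRel f ↔ ∃ y, (kosMat₂ f D δ).mulVec y = x := by
  set rel : Fin (n + 1) × Fin (n + 1) → Fin (n + 1) → MvPolynomial (Fin (n + 1)) B := fun p =>
    Pi.single p.1 (f p.2) - Pi.single p.2 (f p.1) with hrel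
  constructor
  · intro h
    obtain ⟨c, hc⟩ := (Submodule.mem_span_range_iff_exists_fun _).1 h
    refine ⟨fun p => coeff p.2.1 (c p.1), ?_⟩
    funext q
    rw [kosMat₂_mulVec, ← coeff_vecPoly x q, ← hc, Finset.sum_apply, Finset.sum_apply, coeff_sum,
      coeff_sum]
    refine Finset.sum_congr rfl fun p _ => ?_
    rw [Pi.smul_apply, Pi.smul_apply, smul_eq_mul, smul_eq_mul, coeff_mul, coeff_mul]
    refine Finset.sum_congr rfl fun uv huv => ?_
    by_cases hv : uv.2.degree = δ
    · congr 1
      have hdeg : uv.1.degree + δ = D := by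
        rw [← hv, ← map_add, Finset.HasAntidiagonal.mem_antidiagonal.1 huv]
        exact mem_mon.1 q.2.2
      rw [coeff_sum, Finset.sum_eq_single ⟨uv.1, mem_monSub.2 hdeg⟩]
      · simp
      · intro w _ hw
        rw [coeff_monomial, if_neg]
        intro h; exact hw (Subtype.ext h)
      · simp
    · have := (rel_isHomogeneous hf p.1 p.2 q.1).coeff_eq_zero hv
      rw [this, mul_zero, mul_zero]
  · rintro ⟨y, rfl⟩
    have h1 : vecPoly ((kosMat₂ f D δ).mulVec y) = ∑ p : Fin (n + 1) × Fin (n + 1),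
      (∑ w : MonSub n D δ, monomial w.1 (y (p, w))) • rel p := by
      conv_rhs => rw [← exists_vecPoly (D := D) (∑ p : Fin (n + 1) × Fin (n + 1),
        (∑ w : MonSub n D δ, monomial w.1 (y (p, w))) • rel p) (by
          intro i
          rw [Finset.sum_apply]
          refine IsHomogeneous.sum _ _ _ fun p _ => ?_
          rw [Pi.smul_apply, smul_eq_mul, Finset.sum_mul]
          refine IsHomogeneous.sum _ _ _ fun w _ => ?_
          have := (isHomogeneous_monomial (y (p, w)) (rfl : w.1.degree = _)).mul
            (rel_isHomogeneous hf p.1 p.2 i)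
          rwa [mem_monSub.1 w.2] at this)]
      congr 1
      funext q
      exact kosMat₂_mulVec f D δ y q
    rw [h1]
    exact Submodule.sum_mem _ fun p _ => Submodule.smul_mem _ _ (Submodule.subset_span ⟨p, rfl⟩)

end Matrices

lemma sum_mul_eq_zero_of_mem_kosRel {R ι : Type*} [CommRing R] [Fintype ι] [DecidableEq ι]
    {f a : ι → R} (h : a ∈ kosRel f) : ∑ i, a i * f i = 0 := by
  refine Submodule.span_induction (p := fun a _ => ∑ i, a i * f i = 0) ?_ (by simp) ?_ ?_ h
  · rintro _ ⟨p, rfl⟩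
    simp only [Pi.sub_apply, sub_mul, Finset.sum_sub_distrib, Pi.single_apply, ite_mul, zero_mul,
      Finset.sum_ite_eq', Finset.mem_univ, if_true]
    ring
  · intro a b _ _ ha hb; simp [add_mul, Finset.sum_add_distrib, ha, hb]
  · intro c a _ ha; simp [mul_assoc, ← Finset.mul_sum, ha]

open Classical in
theorem koszul_exact_transfer {A κ K : Type} [CommRing A] [Field κ] [Field K] {n : ℕ}
    (s : A →+* κ) (hs : Function.Surjective s) (t : A →+* K) (ht : Function.Injective t)
    (f : Fin (n + 1) → MvPolynomial (Fin (n + 1)) A) (δ D : ℕ) (hf : ∀ i, (f i).IsHomogeneous δ)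
    (h : ∀ a : Fin (n + 1) → MvPolynomial (Fin (n + 1)) κ, (∀ i, (a i).IsHomogeneous D) →
      ∑ i, a i * MvPolynomial.map s (f i) = 0 → a ∈ kosRel fun i => MvPolynomial.map s (f i))
    (a : Fin (n + 1) → MvPolynomial (Fin (n + 1)) K) (ha : ∀ i, (a i).IsHomogeneous D)
    (hsum : ∑ i, a i * MvPolynomial.map t (f i) = 0) :
    a ∈ kosRel fun i => MvPolynomial.map t (f i) := by
  have hfs : ∀ i, (MvPolynomial.map s (f i)).IsHomogeneous δ := fun i => (hf i).map s
  have hft : ∀ i, (MvPolynomial.map t (f i)).IsHomogeneous δ := fun i => (hf i).map t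
  rw [← exists_vecPoly a ha] at hsum ⊢
  rw [mem_kosRel_iff _ D δ hft, ← kosMat₂_map]
  refine exact_of_exact_residue s hs t ht (kosMat₁ f D δ) _ ?_ ?_ _ ?_
  · intro y
    rw [kosMat₁_map, kosMat₂_map, kosMat₁_mulVec_eq_zero _ _ _ hft]
    exact sum_mul_eq_zero_of_mem_kosRel ((mem_kosRel_iff _ D δ hft _).2 ⟨y, rfl⟩)
  · intro x hx
    rw [kosMat₁_map, kosMat₁_mulVec_eq_zero _ _ _ hfs] at hx
    rw [kosMat₂_map, ← mem_kosRel_iff _ D δ hfs]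
    exact h _ (vecPoly_isHomogeneous x) hx
  · rw [kosMat₁_map, kosMat₁_mulVec_eq_zero _ _ _ hft]
    exact hsum

open Classical in
theorem koszul_exact_complex {n c : ℕ}
    (h : Fin c → MvPolynomial (Fin (n + 1)) ℂ) (e : ℕ) (he : 1 ≤ e) (hh : ∀ j, (h j).IsHomogeneous e)
    (f : Fin (n + 1) → MvPolynomial (Fin (n + 1)) ℂ) (δ : ℕ) (hf : ∀ i, (f i).IsHomogeneous δ)
    (hfI : ∀ i, f i ∈ Ideal.span (Set.range h)) (M : ℕ)
    (hhf : ∀ a j, X a ^ M * h j ∈ Ideal.span (Set.range f))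
    (r : ℕ) (hr2 : 2 ≤ r) (hrn : r ≤ n)
    (hc : ∀ α : Fin (n + 1), ∃ c : ℕ,
      X α ^ c ∈ Ideal.span (Set.range h) ⊔ Ideal.span (X '' {i : Fin (n + 1) | r ≤ (i : ℕ)}))
    (D : ℕ) (hk : ∀ s, r + 1 ≤ s → s * e + (D + δ) + 1 ≤ s * δ)
    (a : Fin (n + 1) → MvPolynomial (Fin (n + 1)) ℂ) (ha : ∀ i, (a i).IsHomogeneous D)
    (hsum : ∑ i, a i * f i = 0) : a ∈ kosRel f := by
  choose c1 hc1 using fun i => (Ideal.mem_span_range_iff_exists_fun).1 (hfI i)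
  choose c2 hc2 using fun a j => (Ideal.mem_span_range_iff_exists_fun).1 (hhf a j)
  have hc' : ∀ α : Fin (n + 1), ∃ (N : ℕ) (p : Fin c → MvPolynomial (Fin (n + 1)) ℂ)
      (q : {i : Fin (n + 1) // r ≤ (i : ℕ)} → MvPolynomial (Fin (n + 1)) ℂ),
      ∑ j, p j * h j + ∑ i, q i * X i.1 = X α ^ N := by
    intro α
    obtain ⟨N, hN⟩ := hc α
    obtain ⟨y, hy, z, hz, hyz⟩ := Submodule.mem_sup.1 hN
    obtain ⟨p, hp⟩ := (Ideal.mem_span_range_iff_exists_fun).1 hy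
    rw [Set.image_eq_range] at hz
    obtain ⟨q, hq⟩ := (Ideal.mem_span_range_iff_exists_fun).1 hz
    exact ⟨N, p, q, by rw [← hyz, ← hp, ← hq]; rfl⟩
  choose N p q hpq using hc'
  obtain ⟨A, _, κ, _, _, s, t, hs, ht, hlift⟩ := exists_reduction
    (Set.range h ∪ (Set.range f ∪ (Set.range (fun x : _ × _ => c1 x.1 x.2) ∪
      (Set.range (fun x : _ × _ × _ => c2 x.1 x.2.1 x.2.2) ∪ (Set.range (fun x : _ × _ => p x.1 x.2) ∪
        Set.range (fun x : _ × _ => q x.1 x.2))))))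
    ((Set.finite_range _).union ((Set.finite_range _).union ((Set.finite_range _).union
      ((Set.finite_range _).union ((Set.finite_range _).union (Set.finite_range _))))))
  choose h' hh' using fun j => hlift (h j) (Or.inl ⟨j, rfl⟩)
  choose f' hf' using fun j => hlift (f j) (Or.inr (Or.inl ⟨j, rfl⟩))
  choose c1' hc1' using fun i j => hlift (c1 i j) (Or.inr (Or.inr (Or.inl ⟨(i, j), rfl⟩)))
  choose c2' hc2' using fun i j l => hlift (c2 i j l)
    (Or.inr (Or.inr (Or.inr (Or.inl ⟨(i, j, l), rfl⟩))))
  choose p' hp' using fun i j => hlift (p i j)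
    (Or.inr (Or.inr (Or.inr (Or.inr (Or.inl ⟨(i, j), rfl⟩)))))
  choose q' hq' using fun i j => hlift (q i j)
    (Or.inr (Or.inr (Or.inr (Or.inr (Or.inr ⟨(i, j), rfl⟩)))))
  have hinj : Function.Injective (MvPolynomial.map t : MvPolynomial (Fin (n + 1)) A →+* _) :=
    MvPolynomial.map_injective t ht
  have hfe : f = fun i => MvPolynomial.map t (f' i) := funext fun i => (hf' i).symm
  have hf'h : ∀ i, (f' i).IsHomogeneous δ := fun i => .of_map ht (by rw [hf']; exact hf i)
  rw [hfe] at hsum ⊢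
  refine koszul_exact_transfer s hs t ht f' δ D hf'h ?_ a ha hsum
  intro b hb hbs
  refine koszul_exact_finite (fun j => MvPolynomial.map s (h' j)) e he
    (fun j => (IsHomogeneous.of_map ht (by rw [hh']; exact hh j)).map s)
    (fun i => MvPolynomial.map s (f' i)) δ (fun i => (hf'h i).map s) ?_ M ?_ r hr2 hrn ?_ D hk b hb hbs
  · intro i
    have : f' i = ∑ j, c1' i j * h' j := hinj (by simp [hf', hc1', hh', hc1])
    rw [this, map_sum]
    refine Ideal.sum_mem _ fun j _ => ?_
    rw [map_mul]
    exact Ideal.mul_mem_left _ _ (Ideal.subset_span ⟨j, rfl⟩)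
  · intro i j
    have : X i ^ M * h' j = ∑ l, c2' i j l * f' l := hinj (by simp [hf', hc2', hh', hc2])
    have := congrArg (MvPolynomial.map s) this
    rw [map_mul, map_pow, map_X, map_sum] at this
    rw [this]
    refine Ideal.sum_mem _ fun j _ => ?_
    rw [map_mul]
    exact Ideal.mul_mem_left _ _ (Ideal.subset_span ⟨j, rfl⟩)
  · intro α
    refine ⟨N α, ?_⟩
    have : X α ^ N α = ∑ j, p' α j * h' j + ∑ i, q' α i * X i.1 :=
      hinj (by simp [hp', hq', hh', hpq])
    have := congrArg (MvPolynomial.map s) this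
    rw [map_add, map_pow, map_X, map_sum, map_sum] at this
    rw [this]
    refine Submodule.add_mem_sup (Ideal.sum_mem _ fun j _ => ?_) (Ideal.sum_mem _ fun j _ => ?_)
    · rw [map_mul]
      exact Ideal.mul_mem_left _ _ (Ideal.subset_span ⟨j, rfl⟩)
    · rw [map_mul, map_X]
      exact Ideal.mul_mem_left _ _ (Ideal.subset_span ⟨j.1, j.2, rfl⟩)

end

section

lemma exists_of_mem_kosRel_succ {R : Type*} [CommRing R] {m : ℕ} {f a : Fin (m + 1) → R}
    (h : a ∈ kosRel f) : ∃ b : Fin m → R, a 0 + ∑ i, b i * f i.succ = 0 ∧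
      (fun i => a i.succ - b i * f 0) ∈ kosRel fun i => f i.succ := by
  refine Submodule.span_induction (p := fun a _ => ∃ b : Fin m → R, a 0 + ∑ i, b i * f i.succ = 0 ∧
      (fun i => a i.succ - b i * f 0) ∈ kosRel fun i => f i.succ) ?_ ?_ ?_ ?_ h
  · rintro _ ⟨⟨p, q⟩, rfl⟩
    cases p using Fin.cases with
    | zero =>
      cases q using Fin.cases with
      | zero => exact ⟨0, by simp, by convert Submodule.zero_mem _ using 1; funext i; simp⟩
      | succ q =>
        refine ⟨fun i => if i = q then -1 else 0, by simp, ?_⟩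
        convert Submodule.zero_mem _ using 1
        funext i
        by_cases hi : i = q <;> simp [hi]
    | succ p =>
      cases q using Fin.cases with
      | zero =>
        refine ⟨fun i => if i = p then 1 else 0, by simp, ?_⟩
        convert Submodule.zero_mem _ using 1
        funext i
        by_cases hi : i = p <;> simp [hi]
      | succ q =>
        refine ⟨0, by simp, ?_⟩
        have : (Pi.single p (f q.succ) - Pi.single q (f p.succ) : Fin m → R) ∈ kosRel fun i => f i.succ :=
          Submodule.subset_span ⟨(p, q), rfl⟩
        convert this using 1
        funext i
        simp [Pi.single_apply]
  · exact ⟨0, by simp, by convert Submodule.zero_mem _ using 1; funext i; simp⟩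
  · rintro a a' _ _ ⟨b, hb, hb'⟩ ⟨c, hc, hc'⟩
    refine ⟨b + c, ?_, ?_⟩
    · simp only [Pi.add_apply, add_mul, Finset.sum_add_distrib]
      linear_combination hb + hc
    · convert Submodule.add_mem _ hb' hc' using 1
      funext i; simp; ring
  · rintro r a _ ⟨b, hb, hb'⟩
    refine ⟨r • b, ?_, ?_⟩
    · simp only [Pi.smul_apply, smul_eq_mul, mul_assoc, ← Finset.mul_sum]
      linear_combination r * hb
    · convert Submodule.smul_mem _ r hb' using 1
      funext i; simp; ring

section Components
variable {K σ : Type} [Field K]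

/-- The homogeneous component of degree `D - δ`, zero if `D < δ`. -/
def compSub (D δ : ℕ) (p : MvPolynomial σ K) : MvPolynomial σ K :=
  if δ ≤ D then homogeneousComponent (D - δ) p else 0

lemma homogeneousComponent_mul_right (D δ : ℕ) (p g : MvPolynomial σ K) (hg : g.IsHomogeneous δ) :
    homogeneousComponent D (p * g) = compSub D δ p * g := by
  induction p using MvPolynomial.induction_on' with
  | add p q hp hq =>
    rw [add_mul, map_add, hp, hq, ← add_mul]
    congr 1
    unfold compSub
    split_ifs <;> simp
  | monomial u c =>
    have h1 : (monomial u c * g).IsHomogeneous (u.degree + δ) := (isHomogeneous_monomial _ rfl).mul hg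
    have h2 := isHomogeneous_monomial (R := K) (n := u.degree) c (rfl : u.degree = u.degree)
    rw [homogeneousComponent_of_mem h1]
    unfold compSub
    rw [homogeneousComponent_of_mem h2]
    by_cases h : D = u.degree + δ
    · rw [if_pos h, if_pos (by omega), if_pos (by omega)]
    · rw [if_neg h]
      split_ifs
      · omega
      · simp
      · simp

lemma compSub_isHomogeneous {D δ : ℕ} (h : δ ≤ D) (p : MvPolynomial σ K) :
    (compSub D δ p).IsHomogeneous (D - δ) := by
  rw [compSub, if_pos h]; exact homogeneousComponent_isHomogeneous _ _

lemma homogeneousComponent_mem_kosRel {m : ℕ} {f a : Fin m → MvPolynomial σ K} {δ : ℕ}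
    (hf : ∀ i, (f i).IsHomogeneous δ) (h : a ∈ kosRel f) (D : ℕ) :
    (fun i => homogeneousComponent D (a i)) ∈ kosRel f := by
  obtain ⟨c, rfl⟩ := (Submodule.mem_span_range_iff_exists_fun _).1 h
  have : (fun i => homogeneousComponent D ((∑ p, c p • (fun p : Fin m × Fin m =>
      (Pi.single p.1 (f p.2) - Pi.single p.2 (f p.1) : Fin m → MvPolynomial σ K)) p) i)) =
      ∑ p, compSub D δ (c p) • (Pi.single p.1 (f p.2) - Pi.single p.2 (f p.1) :
        Fin m → MvPolynomial σ K) := by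
    funext i
    rw [Finset.sum_apply, map_sum, Finset.sum_apply]
    refine Finset.sum_congr rfl fun p _ => ?_
    rw [Pi.smul_apply, smul_eq_mul, Pi.smul_apply, smul_eq_mul]
    refine homogeneousComponent_mul_right _ _ _ _ ?_
    have h : ∀ i j k, ((Pi.single i (f j) : Fin m → MvPolynomial σ K) k).IsHomogeneous δ := by
      intro i j k
      by_cases hk : k = i
      · subst hk; simpa using hf j
      · simpa [hk] using isHomogeneous_zero _ _ _
    exact (h _ _ _).sub (h _ _ _)
  rw [this]
  exact Submodule.sum_mem _ fun p _ => Submodule.smul_mem _ _ (Submodule.subset_span ⟨p, rfl⟩)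

/-- All syzygies with entries of degree `D`, `D + δ ≤ k`, are Koszul. -/
def SyzKoszul {m : ℕ} (f : Fin m → MvPolynomial σ K) (δ k : ℕ) : Prop :=
  ∀ D, D + δ ≤ k → ∀ a : Fin m → MvPolynomial σ K, (∀ i, (a i).IsHomogeneous D) →
    ∑ i, a i * f i = 0 → a ∈ kosRel f

lemma SyzKoszul.tail {m : ℕ} {f : Fin (m + 1) → MvPolynomial σ K} {δ k : ℕ} (hδ : 1 ≤ δ)
    (hf : ∀ i, (f i).IsHomogeneous δ) (h : SyzKoszul f δ k) : SyzKoszul (fun i => f i.succ) δ k := by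
  intro D
  induction D using Nat.strong_induction_on with
  | _ D ih =>
  intro hD a ha hsum
  obtain ⟨b, hb, hb'⟩ := exists_of_mem_kosRel_succ (h D hD (Fin.cons 0 a) (by
    intro i
    cases i using Fin.cases with
    | zero => simpa using isHomogeneous_zero _ _ _
    | succ i => simpa using ha i) (by simpa [Fin.sum_univ_succ] using hsum))
  simp only [Fin.cons_zero, zero_add, Fin.cons_succ] at hb hb'
  have h1 := homogeneousComponent_mem_kosRel (fun i => hf i.succ) hb' D
  have h2 : ∀ i, homogeneousComponent D (a i - b i * f 0) = a i - compSub D δ (b i) * f 0 := by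
    intro i
    rw [map_sub, homogeneousComponent_mul_right _ _ _ _ (hf 0),
      homogeneousComponent_of_mem (m := D) (ha i), if_pos rfl]
  simp only [h2] at h1
  by_cases hle : δ ≤ D
  · have h3 := ih (D - δ) (by omega) (by omega) (fun i => compSub D δ (b i))
      (fun i => compSub_isHomogeneous hle _) (by
        have := congrArg (homogeneousComponent D) hb
        rw [map_sum, map_zero] at this
        rw [← this]
        exact Finset.sum_congr rfl fun i _ => (homogeneousComponent_mul_right _ _ _ _ (hf _)).symm)
    convert Submodule.add_mem _ h1 (Submodule.smul_mem _ (f 0) h3) using 1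
    funext i
    simp; ring
  · convert h1 using 1
    funext i
    simp [compSub, hle]

lemma SyzKoszul.mem_span {m : ℕ} {f : Fin (m + 1) → MvPolynomial σ K} {δ k : ℕ}
    (hf : ∀ i, (f i).IsHomogeneous δ) (h : SyzKoszul f δ k) {D : ℕ} (hD : D + δ ≤ k)
    {g : MvPolynomial σ K} (hg : g.IsHomogeneous D)
    (hgf : g * f 0 ∈ Ideal.span (Set.range fun i : Fin m => f i.succ)) :
    g ∈ Ideal.span (Set.range fun i : Fin m => f i.succ) := by
  obtain ⟨c, hc⟩ := Ideal.mem_span_range_iff_exists_fun.1 hgf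
  have hc' : ∑ i, homogeneousComponent D (c i) * f i.succ = g * f 0 := by
    have := congrArg (homogeneousComponent (D + δ)) hc
    rw [homogeneousComponent_of_mem (m := D + δ) (hg.mul (hf 0)), if_pos rfl, map_sum] at this
    rw [← this]
    refine Finset.sum_congr rfl fun i _ => ?_
    rw [homogeneousComponent_mul_right _ _ _ _ (hf _), compSub, if_pos (by omega), Nat.add_sub_cancel]
  obtain ⟨b, hb, -⟩ := exists_of_mem_kosRel_succ (h D hD
    (Fin.cons g fun i => - homogeneousComponent D (c i)) (by
      intro i
      cases i using Fin.cases with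
      | zero => simpa using hg
      | succ i => simpa using (homogeneousComponent_isHomogeneous D (c i)).neg)
    (by simp [Fin.sum_univ_succ, hc']))
  rw [Fin.cons_zero] at hb
  rw [eq_neg_of_add_eq_zero_left hb]
  exact Ideal.neg_mem_iff _ |>.2 (Ideal.sum_mem _ fun i _ =>
    Ideal.mul_mem_left _ _ (Ideal.subset_span ⟨i, rfl⟩))

end Components

section Hilbert
variable {K : Type} [Field K] {n : ℕ}

/-- The homogeneous elements of degree `j` in the ideal `I`. -/
def idealPiece (I : Ideal (MvPolynomial (Fin (n + 1)) K)) (j : ℕ) :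
    Submodule K (homogeneousSubmodule (Fin (n + 1)) K j) :=
  (I.restrictScalars K).comap (homogeneousSubmodule (Fin (n + 1)) K j).subtype

/-- The Hilbert function of the quotient by `I`. -/
def hilb (I : Ideal (MvPolynomial (Fin (n + 1)) K)) (j : ℕ) : ℕ :=
  Module.finrank K (homogeneousSubmodule (Fin (n + 1)) K j ⧸ idealPiece I j)

/-- Forms of degree `j` are determined by their coefficients. -/
def homogeneousEquiv (K : Type) [Field K] (n j : ℕ) :
    homogeneousSubmodule (Fin (n + 1)) K j ≃ₗ[K] (Mon n j → K) :=
  LinearEquiv.ofBijective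
    { toFun := fun p u => coeff u.1 p.1
      map_add' := fun p q => by funext u; simp
      map_smul' := fun c p => by funext u; simp }
    ⟨fun p q h => by
      apply Subtype.ext
      ext u
      by_cases hu : u.degree = j
      · exact congrFun h ⟨u, mem_mon.2 hu⟩
      · rw [IsHomogeneous.coeff_eq_zero p.2 hu, IsHomogeneous.coeff_eq_zero q.2 hu],
    fun x => ⟨⟨∑ w : Mon n j, monomial w.1 (x w),
      IsHomogeneous.sum _ _ _ fun w _ => isHomogeneous_monomial _ (mem_mon.1 w.2)⟩, by
      funext u
      exact coeff_vecPoly (ι := Unit) (fun q => x q.2) ((), u)⟩⟩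

instance (j : ℕ) : Module.Finite K (homogeneousSubmodule (Fin (n + 1)) K j) :=
  Module.Finite.equiv (homogeneousEquiv K n j).symm

lemma finrank_homogeneous (j : ℕ) :
    Module.finrank K (homogeneousSubmodule (Fin (n + 1)) K j) = (j + n).choose n := by
  rw [(homogeneousEquiv K n j).finrank_eq, Module.finrank_fintype_fun_eq_card, Fintype.card_coe,
    Finset.card_finsuppAntidiag_nat_eq_choose]
  rw [Finset.card_univ, Fintype.card_fin]
  have : n + 1 + j - 1 = j + n := by omega
  rw [this, Nat.choose_symm_add]

lemma hilb_bot (j : ℕ) : hilb (⊥ : Ideal (MvPolynomial (Fin (n + 1)) K)) j = (j + n).choose n := by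
  have : idealPiece (⊥ : Ideal (MvPolynomial (Fin (n + 1)) K)) j = ⊥ := by
    rw [eq_bot_iff]
    rintro ⟨x, hx⟩ h
    have : x = 0 := h
    subst this
    rfl
  rw [hilb, this, (Submodule.quotEquivOfEqBot _ rfl).finrank_eq, finrank_homogeneous]

lemma hilb_succ {m : ℕ} {f : Fin (m + 1) → MvPolynomial (Fin (n + 1)) K} {δ k : ℕ}
    (hf : ∀ i, (f i).IsHomogeneous δ) (h : SyzKoszul f δ k) {j : ℕ} (hj : j ≤ k) :
    (hilb (Ideal.span (Set.range f)) j : ℤ) =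
      hilb (Ideal.span (Set.range fun i : Fin m => f i.succ)) j -
      if δ ≤ j then (hilb (Ideal.span (Set.range fun i : Fin m => f i.succ)) (j - δ) : ℤ) else 0 := by
  set I' := Ideal.span (Set.range fun i : Fin m => f i.succ) with hI'
  have hI : Ideal.span (Set.range f) = Ideal.span {f 0} ⊔ I' := by
    rw [hI', ← Ideal.span_union]
    congr 1
    ext x
    constructor
    · rintro ⟨i, rfl⟩
      cases i using Fin.cases with
      | zero => exact Or.inl rfl
      | succ i => exact Or.inr ⟨i, rfl⟩
    · rintro (rfl | ⟨i, rfl⟩)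
      exacts [⟨0, rfl⟩, ⟨i.succ, rfl⟩]
  have hle : idealPiece I' j ≤ idealPiece (Ideal.span (Set.range f)) j := by
    intro x hx
    change x.1 ∈ Ideal.span (Set.range f)
    rw [hI]
    exact Ideal.mem_sup_right hx
  have hI'comp : ∀ x ∈ I', homogeneousComponent j x ∈ I' := by
    intro x hx
    obtain ⟨c, rfl⟩ := Ideal.mem_span_range_iff_exists_fun.1 hx
    rw [map_sum]
    refine Ideal.sum_mem _ fun i _ => ?_
    rw [homogeneousComponent_mul_right _ _ _ _ (hf _)]
    exact Ideal.mul_mem_left _ _ (Ideal.subset_span ⟨i, rfl⟩)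
  -- elements of degree `j` in the big ideal
  have hdec : ∀ x : homogeneousSubmodule (Fin (n + 1)) K j, x ∈ idealPiece (Ideal.span (Set.range f)) j →
      ∃ g, x.1 - compSub j δ g * f 0 ∈ I' := by
    intro x hx
    have hx' : x.1 ∈ Ideal.span {f 0} ⊔ I' := by rw [← hI]; exact hx
    obtain ⟨y, hy, z, hz, hyz⟩ := Submodule.mem_sup.1 hx'
    obtain ⟨g, rfl⟩ := Ideal.mem_span_singleton'.1 hy
    refine ⟨g, ?_⟩
    rw [← homogeneousComponent_mul_right _ _ _ _ (hf 0)]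
    have : x.1 = homogeneousComponent j x.1 := by
      rw [homogeneousComponent_of_mem (m := j) x.2, if_pos rfl]
    rw [this, ← map_sub, ← hyz, add_sub_cancel_left]
    exact hI'comp z hz
  by_cases hjd : δ ≤ j
  · rw [if_pos hjd]
    let μ : homogeneousSubmodule (Fin (n + 1)) K (j - δ) →ₗ[K] homogeneousSubmodule (Fin (n + 1)) K j :=
      { toFun := fun g => ⟨g.1 * f 0, by
          have := IsHomogeneous.mul g.2 (hf 0)
          rwa [Nat.sub_add_cancel hjd] at this⟩
        map_add' := fun a b => Subtype.ext (by simp [add_mul])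
        map_smul' := fun c a => Subtype.ext (by simp) }
    let θ := (idealPiece I' j).mkQ ∘ₗ μ
    have hker : LinearMap.ker θ = idealPiece I' (j - δ) := by
      ext g
      rw [LinearMap.mem_ker]
      change (idealPiece I' j).mkQ (μ g) = 0 ↔ _
      rw [Submodule.mkQ_apply, Submodule.Quotient.mk_eq_zero]
      constructor
      · intro hg
        exact h.mem_span hf (by omega : j - δ + δ ≤ k) g.2 hg
      · intro hg
        exact I'.mul_mem_right _ hg
    have hrange : LinearMap.range θ =
        (idealPiece (Ideal.span (Set.range f)) j).map (idealPiece I' j).mkQ := by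
      apply le_antisymm
      · rintro _ ⟨g, rfl⟩
        refine ⟨μ g, (?_ : g.1 * f 0 ∈ Ideal.span (Set.range f)), rfl⟩
        exact Ideal.mul_mem_left _ _ (Ideal.subset_span ⟨0, rfl⟩)
      · rintro _ ⟨x, hx, rfl⟩
        obtain ⟨g, hg⟩ := hdec x hx
        refine ⟨(⟨compSub j δ g, compSub_isHomogeneous hjd g⟩ :
          homogeneousSubmodule (Fin (n + 1)) K (j - δ)), ?_⟩
        rw [LinearMap.comp_apply]
        rw [← sub_eq_zero, ← map_sub, Submodule.mkQ_apply, Submodule.Quotient.mk_eq_zero]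
        change (compSub j δ g * f 0 - x.1) ∈ I'
        rw [← neg_sub]
        exact I'.neg_mem hg
    have e1 := (Submodule.quotientQuotientEquivQuotient (idealPiece I' j)
      (idealPiece (Ideal.span (Set.range f)) j) hle).finrank_eq
    have e2 := Submodule.finrank_quotient_add_finrank
      ((idealPiece (Ideal.span (Set.range f)) j).map (idealPiece I' j).mkQ)
    have e3 := θ.quotKerEquivRange.finrank_eq
    rw [hker, hrange] at e3
    rw [e1, ← e3] at e2
    unfold hilb
    rw [← e2]; push_cast; ring
  · rw [if_neg hjd, sub_zero]
    have : idealPiece (Ideal.span (Set.range f)) j = idealPiece I' j := by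
      refine le_antisymm ?_ hle
      intro x hx
      obtain ⟨g, hg⟩ := hdec x hx
      rw [compSub, if_neg hjd, zero_mul, sub_zero] at hg
      exact hg
    rw [hilb, this, hilb]

theorem hilb_koszul {m : ℕ} (f : Fin m → MvPolynomial (Fin (n + 1)) K) {δ k : ℕ} (hδ : 1 ≤ δ)
    (hf : ∀ i, (f i).IsHomogeneous δ) (h : SyzKoszul f δ k) {j : ℕ} (hj : j ≤ k) :
    (hilb (Ideal.span (Set.range f)) j : ℤ) =
      ∑ i ∈ Finset.range (m + 1), (-1 : ℤ) ^ i * (m.choose i) *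
        (if i * δ ≤ j then (((j - i * δ) + n).choose n : ℤ) else 0) := by
  induction m generalizing j with
  | zero =>
    have : Ideal.span (Set.range f) = ⊥ := by rw [Set.range_eq_empty, Ideal.span_empty]
    rw [this, hilb_bot]; simp
  | succ m ih =>
    have h' := h.tail hδ hf
    rw [hilb_succ hf h hj, ih _ (fun i => hf i.succ) h' hj]
    set F : ℕ → ℤ := fun i => if i * δ ≤ j then (((j - i * δ) + n).choose n : ℤ) else 0 with hF
    have hsub : (if δ ≤ j then (hilb (Ideal.span (Set.range fun i : Fin m => f i.succ)) (j - δ) : ℤ) else 0)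
        = ∑ i ∈ Finset.range (m + 1), (-1 : ℤ) ^ i * (m.choose i) * F (i + 1) := by
      by_cases hjd : δ ≤ j
      · rw [if_pos hjd, ih _ (fun i => hf i.succ) h' (by omega : j - δ ≤ k)]
        refine Finset.sum_congr rfl fun i _ => ?_
        congr 1
        have : i * δ ≤ j - δ ↔ (i + 1) * δ ≤ j := by rw [add_mul]; omega
        simp only [hF, this]
        congr 4
        rw [add_mul]; omega
      · rw [if_neg hjd]
        symm
        refine Finset.sum_eq_zero fun i _ => ?_
        rw [hF]
        simp only
        rw [if_neg (by rw [add_mul]; omega), mul_zero]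
    rw [hsub]
    change ∑ i ∈ Finset.range (m + 1), (-1 : ℤ) ^ i * (m.choose i) * F i - _ =
      ∑ i ∈ Finset.range (m + 1 + 1), (-1 : ℤ) ^ i * ((m + 1).choose i) * F i
    rw [Finset.sum_range_succ' _ (m + 1)]
    have hpascal : ∀ i, (-1 : ℤ) ^ (i + 1) * ((m + 1).choose (i + 1)) * F (i + 1) =
        (-1 : ℤ) ^ (i + 1) * (m.choose (i + 1)) * F (i + 1) - (-1 : ℤ) ^ i * (m.choose i) * F (i + 1) := by
      intro i
      rw [Nat.choose_succ_succ]; push_cast; ring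
    simp only [hpascal, Finset.sum_sub_distrib]
    have hlast := Finset.sum_range_succ' (fun i => (-1 : ℤ) ^ i * (m.choose i) * F i) (m + 1)
    rw [Finset.sum_range_succ, Nat.choose_succ_self] at hlast
    simp only [Nat.choose_zero_right] at hlast ⊢
    push_cast at hlast
    linear_combination hlast

end Hilbert

end

section

section Dimension
open Topology

lemma dimH_fiber_le {E F : Type*} [NormedAddCommGroup E] [NormedSpace ℂ E] [FiniteDimensional ℂ E]
    [NormedAddCommGroup F] [NormedSpace ℂ F] [FiniteDimensional ℂ F] {f : E → F} {f' : E →L[ℂ] F}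
    {a : E} (hf : HasStrictFDerivAt f f' a) :
    ∃ t ∈ 𝓝 a, dimH (t ∩ {x | f x = f a}) ≤ (2 * Module.finrank ℂ (f' : E →ₗ[ℂ] F).ker : ℕ) := by
  have : CompleteSpace E := FiniteDimensional.complete ℂ E
  -- project to the range of the differential
  obtain ⟨π, hπ⟩ := (LinearMap.range (f' : E →ₗ[ℂ] F)).subtype.exists_leftInverse_of_injective
    (Submodule.ker_subtype _)
  let π' := LinearMap.toContinuousLinearMap π
  have hg : HasStrictFDerivAt (fun x => π' (f x)) (π'.comp f') a :=
    π'.hasStrictFDerivAt.comp a hf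
  have hπ1 : ∀ x, π (f' x) = (⟨f' x, ⟨x, rfl⟩⟩ : LinearMap.range (f' : E →ₗ[ℂ] F)) := fun x =>
    LinearMap.congr_fun hπ ⟨f' x, ⟨x, rfl⟩⟩
  have hsurj : (π'.comp f').toLinearMap.range = ⊤ := by
    rw [LinearMap.range_eq_top]
    rintro ⟨_, x, rfl⟩
    exact ⟨x, hπ1 x⟩
  have hker : (π'.comp f').toLinearMap.ker = (f' : E →ₗ[ℂ] F).ker := by
    ext x
    rw [LinearMap.mem_ker, LinearMap.mem_ker]
    change π (f' x) = 0 ↔ f' x = 0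
    rw [hπ1, Subtype.ext_iff]; rfl
  obtain ⟨K, s, hs, hK⟩ := (hg.to_implicitFunction hsurj).exists_lipschitzOnWith
  have h1 := hg.eq_implicitFunction hsurj
  have h2 : ∀ᶠ x in 𝓝 a, (hg.implicitToOpenPartialHomeomorph _ _ hsurj x).2 ∈ s := by
    have hc := (hg.implicitToOpenPartialHomeomorph _ _ hsurj).continuousAt
      (hg.mem_implicitToOpenPartialHomeomorph_source hsurj)
    have hc' := continuous_snd.continuousAt.comp hc
    refine hc'.eventually ?_
    simp only [Function.comp, HasStrictFDerivAt.implicitToOpenPartialHomeomorph_self]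
    exact hs
  refine ⟨_, h1.and h2, ?_⟩
  rw [← hker]
  let _ : NormedSpace ℝ (π'.comp f').toLinearMap.ker := NormedSpace.complexToReal
  have : FiniteDimensional ℝ (π'.comp f').toLinearMap.ker :=
    FiniteDimensional.complexToReal _
  rw [← finrank_real_of_complex, ← Real.dimH_univ_eq_finrank]
  refine le_trans (dimH_mono ?_) (hK.dimH_image_le.trans (dimH_mono (Set.subset_univ s)))
  rintro x ⟨⟨hx1, hx2⟩, hx3⟩
  refine ⟨_, hx2, ?_⟩
  rw [Set.mem_setOf_eq] at hx3
  rw [← hx3]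
  exact hx1

lemma exists_nonmem_image {E F G : Type*} [NormedAddCommGroup E] [NormedSpace ℂ E]
    [FiniteDimensional ℂ E] [NormedAddCommGroup F] [NormedSpace ℂ F] [FiniteDimensional ℂ F]
    [NormedAddCommGroup G] [NormedSpace ℂ G] [FiniteDimensional ℂ G]
    {f : E → F} {f' : E → E →L[ℂ] F} (hf : ∀ a, HasStrictFDerivAt f (f' a) a) {q : ℕ}
    (hq : ∀ a, a ≠ 0 → f a = 0 → Module.finrank ℂ ((f' a : E →L[ℂ] F) : E →ₗ[ℂ] F).ker ≤ q)
    (L : E →ₗ[ℂ] G) (hL : q < Module.finrank ℂ G) :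
    ∃ y, ∀ x, f x = 0 → L x ≠ y := by
  by_contra! hcon
  let _ : NormedSpace ℝ G := NormedSpace.complexToReal
  have : FiniteDimensional ℝ G := FiniteDimensional.complexToReal _
  let _ : NormedSpace ℝ E := NormedSpace.complexToReal
  have : FiniteDimensional ℝ E := FiniteDimensional.complexToReal _
  have : SecondCountableTopology E := by
    have := FiniteDimensional.proper_real E
    infer_instance
  have h1 : dimH (Set.univ : Set G) ≤ (2 * q : ℕ) := by
    have h2 : (Set.univ : Set G) ⊆ (LinearMap.toContinuousLinearMap L) '' ({x | x ≠ 0 ∧ f x = 0} ∪ {0}) := by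
      intro y _
      obtain ⟨x, hx, rfl⟩ := hcon y
      refine ⟨x, ?_, rfl⟩
      by_cases h0 : x = 0
      · exact Or.inr h0
      · exact Or.inl ⟨h0, hx⟩
    refine (dimH_mono h2).trans (((LinearMap.toContinuousLinearMap L).lipschitz.dimH_image_le _).trans ?_)
    rw [dimH_union, dimH_singleton, max_eq_left (zero_le)]
    by_contra! hlt
    obtain ⟨x, hx, ht⟩ := exists_mem_nhdsWithin_lt_dimH_of_lt_dimH hlt
    obtain ⟨t, htx, hdt⟩ := dimH_fiber_le (hf x)
    refine absurd (ht (t ∩ {y | f y = f x}) ?_) (not_lt.2 (hdt.trans ?_))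
    · refine Filter.inter_mem (mem_nhdsWithin_of_mem_nhds htx) ?_
      refine Filter.mem_of_superset self_mem_nhdsWithin ?_
      rintro y ⟨-, hy⟩
      exact hy.trans hx.2.symm
    · exact_mod_cast Nat.mul_le_mul_left 2 (hq x hx.1 hx.2)
  rw [Real.dimH_univ_eq_finrank, finrank_real_of_complex] at h1
  have : 2 * Module.finrank ℂ G ≤ 2 * q := by exact_mod_cast h1
  omega

end Dimension

end

section

section Coordinates
variable {n : ℕ}

lemma hasStrictFDerivAt_eval {σ : Type*} [Fintype σ] [DecidableEq σ] (p : MvPolynomial σ ℂ) (v : σ → ℂ) :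
    HasStrictFDerivAt (fun v => eval v p)
      (∑ i, eval v (pderiv i p) • (ContinuousLinearMap.proj i : (σ → ℂ) →L[ℂ] ℂ)) v := by
  induction p using MvPolynomial.induction_on with
  | C a =>
    have := (hasStrictFDerivAt_const (𝕜 := ℂ) (F := ℂ) a v).congr_fderiv (g' := ∑ i, eval v (pderiv i (MvPolynomial.C a)) •
      (ContinuousLinearMap.proj i : (σ → ℂ) →L[ℂ] ℂ)) (by ext w; simp)
    convert! this using 1
    funext w
    exact eval_C a
  | add p q hp hq =>
    have := (hp.add hq).congr_fderiv (g' := ∑ i, eval v (pderiv i (p + q)) •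
      (ContinuousLinearMap.proj i : (σ → ℂ) →L[ℂ] ℂ)) (by
        ext w
        simp [add_mul, Finset.sum_add_distrib])
    convert! this using 1
    funext w
    exact map_add _ _ _
  | mul_X p i hp =>
    have := (hp.mul (ContinuousLinearMap.proj (R := ℂ) (φ := fun _ : σ => ℂ) i).hasStrictFDerivAt
      (x := v)).congr_fderiv (g' := ∑ j, eval v (pderiv j (p * X i)) •
      (ContinuousLinearMap.proj j : (σ → ℂ) →L[ℂ] ℂ)) (by
        ext w
        simp [pderiv_X, Pi.single_apply, Finset.sum_add_distrib, Finset.mul_sum, add_mul, apply_ite,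
          mul_assoc])
    convert! this using 1
    funext w
    simp

lemma eval_smul_of_isHomogeneous {σ : Type*} {p : MvPolynomial σ ℂ} {d : ℕ} (hp : p.IsHomogeneous d)
    (t : ℂ) (v : σ → ℂ) : eval (t • v) p = t ^ d * eval v p := by
  rw [eval_eq, eval_eq, Finset.mul_sum]
  refine Finset.sum_congr rfl fun u hu => ?_
  have hd : u.degree = d := by
    have := hp (mem_support_iff.1 hu)
    rw [Finsupp.degree_eq_weight_one]
    exact this
  simp only [Pi.smul_apply, smul_eq_mul, mul_pow, Finset.prod_mul_distrib]
  rw [Finset.prod_pow_eq_pow_sum, ← hd, Finsupp.degree_apply]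
  ring

lemma exists_linear_section {c : ℕ} {h : Fin c → MvPolynomial (Fin (n + 1)) ℂ} {e : Fin c → ℕ}
    (hhom : ∀ j, (h j).IsHomogeneous (e j)) (h0 : ∀ j, eval 0 (h j) = 0) {r : ℕ} (hr : r ≤ n)
    (hsmooth : ∀ v : Fin (n + 1) → ℂ, v ≠ 0 → (∀ j, eval v (h j) = 0) →
      (Matrix.of (fun j i => eval v (pderiv i (h j))) :
        Matrix (Fin c) (Fin (n + 1)) ℂ).rank = r) :
    ∃ W : Submodule ℂ (Fin (n + 1) → ℂ), r ≤ Module.finrank ℂ W ∧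
      ∀ v ∈ W, (∀ j, eval v (h j) = 0) → v = 0 := by
  have main : ∀ w, w ≤ r → ∃ W : Submodule ℂ (Fin (n + 1) → ℂ), w ≤ Module.finrank ℂ W ∧
      ∀ v ∈ W, (∀ j, eval v (h j) = 0) → v = 0 := by
    intro w
    induction w with
    | zero => exact fun _ => ⟨⊥, Nat.zero_le _, fun v hv _ => by simpa using hv⟩
    | succ w ih =>
      intro hw
      obtain ⟨W, hW, hWV⟩ := ih (by omega)
      by_cases hlt : w + 1 ≤ Module.finrank ℂ W
      · exact ⟨W, hlt, hWV⟩
      obtain ⟨W', hc⟩ := W.exists_isCompl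
      have hdim := Submodule.finrank_add_eq_of_isCompl hc
      rw [Module.finrank_fin_fun] at hdim
      let J : (Fin (n + 1) → ℂ) → Matrix (Fin c) (Fin (n + 1)) ℂ := fun v =>
        Matrix.of (fun j i => eval v (pderiv i (h j)))
      have hder : ∀ v, HasStrictFDerivAt (fun v => fun j => eval v (h j))
          (LinearMap.toContinuousLinearMap (J v).mulVecLin) v := by
        intro v
        rw [hasStrictFDerivAt_pi']
        intro j
        convert! hasStrictFDerivAt_eval (h j) v using 1
        ext w
        simp [J, Matrix.mulVec, dotProduct]
      obtain ⟨y, hy⟩ := exists_nonmem_image hder (q := n + 1 - r) (by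
        intro v hv hv'
        have h1 := LinearMap.finrank_range_add_finrank_ker (J v).mulVecLin
        have h2 : Module.finrank ℂ (LinearMap.range (J v).mulVecLin) = r :=
          hsmooth v hv (fun j => congrFun hv' j)
        rw [h2, Module.finrank_fin_fun] at h1
        change Module.finrank ℂ (LinearMap.ker (J v).mulVecLin) ≤ _
        omega) (W'.projectionOnto W hc.symm) (by omega)
      have hy0 : y ≠ 0 := by
        intro h00
        refine hy 0 (funext fun j => h0 j) ?_
        rw [map_zero, h00]
      refine ⟨W ⊔ Submodule.span ℂ {(y : Fin (n + 1) → ℂ)}, ?_, ?_⟩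
      · refine Nat.succ_le_of_lt (lt_of_le_of_lt hW (Submodule.finrank_lt_finrank_of_lt ?_))
        refine lt_of_le_of_ne le_sup_left fun heq => hy0 ?_
        have : (y : Fin (n + 1) → ℂ) ∈ W := by
          rw [heq]
          exact Submodule.mem_sup_right (Submodule.mem_span_singleton_self _)
        exact Subtype.ext (Submodule.disjoint_def.1 hc.disjoint _ this y.2)
      · intro v hv hvV
        obtain ⟨u, hu, z, hz, rfl⟩ := Submodule.mem_sup.1 hv
        obtain ⟨t, rfl⟩ := Submodule.mem_span_singleton.1 hz
        by_cases ht : t = 0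
        · subst ht
          rw [zero_smul, add_zero] at hvV ⊢
          exact hWV u hu hvV
        · exfalso
          refine hy (t⁻¹ • (u + t • (y : Fin (n + 1) → ℂ))) ?_ ?_
          · funext j
            rw [eval_smul_of_isHomogeneous (hhom j), hvV j, mul_zero]; rfl
          · rw [smul_add, smul_smul, inv_mul_cancel₀ ht, one_smul, map_add, map_smul,
              Submodule.projectionOnto_apply_left]
            have : W'.projectionOnto W hc.symm u = 0 := by
              rw [← LinearMap.mem_ker, Submodule.ker_projectionOnto]; exact hu
            rw [this, smul_zero, zero_add]
  exact main r le_rfl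

/-- Substitution of a linear map: `linSub T p` is the polynomial function `p ∘ T`. -/
def linSub (T : (Fin (n + 1) → ℂ) →ₗ[ℂ] (Fin (n + 1) → ℂ)) :
    MvPolynomial (Fin (n + 1)) ℂ →ₐ[ℂ] MvPolynomial (Fin (n + 1)) ℂ :=
  aeval fun i => ∑ j, MvPolynomial.C (T (Pi.single j 1) i) * X j

lemma eval_linSub (T : (Fin (n + 1) → ℂ) →ₗ[ℂ] (Fin (n + 1) → ℂ)) (v : Fin (n + 1) → ℂ)
    (p : MvPolynomial (Fin (n + 1)) ℂ) : eval v (linSub T p) = eval (T v) p := by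
  have hT : ∀ i, T v i = ∑ j, T (Pi.single j 1) i * v j := by
    intro i
    conv_lhs => rw [← Finset.univ_sum_single v, map_sum, Finset.sum_apply]
    refine Finset.sum_congr rfl fun j _ => ?_
    have : (Pi.single j (v j) : Fin (n + 1) → ℂ) = v j • Pi.single j 1 := by
      rw [← Pi.single_smul, smul_eq_mul, mul_one]
    rw [this, map_smul, Pi.smul_apply, smul_eq_mul, mul_comm]
  rw [linSub, aeval_def, eval_eval₂]
  rw [← eval₂_id]
  congr 1
  · ext; simp
  · funext i
    simp [hT]

lemma linSub_linSub (T T' : (Fin (n + 1) → ℂ) →ₗ[ℂ] (Fin (n + 1) → ℂ)) (hT : ∀ v, T' (T v) = v)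
    (p : MvPolynomial (Fin (n + 1)) ℂ) : linSub T (linSub T' p) = p := by
  refine MvPolynomial.funext fun v => ?_
  rw [eval_linSub, eval_linSub, hT]

lemma linSub_isHomogeneous (T : (Fin (n + 1) → ℂ) →ₗ[ℂ] (Fin (n + 1) → ℂ))
    {p : MvPolynomial (Fin (n + 1)) ℂ} {d : ℕ} (hp : p.IsHomogeneous d) :
    (linSub T p).IsHomogeneous d := by
  have := hp.aeval (fun i => ∑ j, MvPolynomial.C (T (Pi.single j 1) i) * X j) (n := 1)
    (fun i => IsHomogeneous.sum _ _ _ fun j _ => by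
      simpa using (isHomogeneous_C _ _).mul (isHomogeneous_X ℂ j))
  rwa [one_mul] at this

theorem exists_coordinates {c : ℕ} {h : Fin c → MvPolynomial (Fin (n + 1)) ℂ} {r : ℕ}
    {W : Submodule ℂ (Fin (n + 1) → ℂ)} (hW : r ≤ Module.finrank ℂ W)
    (hWV : ∀ v ∈ W, (∀ j, eval v (h j) = 0) → v = 0) :
    ∃ T : (Fin (n + 1) → ℂ) ≃ₗ[ℂ] (Fin (n + 1) → ℂ), ∀ α : Fin (n + 1), ∃ N : ℕ,
      X α ^ N ∈ Ideal.span (Set.range fun j => linSub (T : _ →ₗ[ℂ] _) (h j)) ⊔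
        Ideal.span (X '' {i : Fin (n + 1) | r ≤ (i : ℕ)}) := by
  obtain ⟨W', hc⟩ := W.exists_isCompl
  have hdim := Submodule.finrank_add_eq_of_isCompl hc
  rw [Module.finrank_fin_fun] at hdim
  let B : Module.Basis (Fin (n + 1)) ℂ (Fin (n + 1) → ℂ) :=
    ((((Module.finBasis ℂ W).prod (Module.finBasis ℂ W')).map
      (Submodule.prodEquivOfIsCompl W W' hc)).reindex finSumFinEquiv).reindex (finCongr hdim)
  have hB : ∀ i : Fin (n + 1), (i : ℕ) < r → B i ∈ W := by
    intro i hi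
    have : i = finCongr hdim (finSumFinEquiv (Sum.inl ⟨i, by omega⟩)) := by
      ext; simp
    rw [this]
    have h2 : B (finCongr hdim (finSumFinEquiv (Sum.inl ⟨i, by omega⟩))) =
        Module.finBasis ℂ W ⟨i, by omega⟩ := by
      simp only [B]
      rw [Module.Basis.reindex_apply, Equiv.symm_apply_apply, Module.Basis.reindex_apply,
        Equiv.symm_apply_apply]
      simp
    rw [h2]
    exact Submodule.coe_mem _
  let T := (Pi.basisFun ℂ (Fin (n + 1))).equiv B (Equiv.refl _)
  refine ⟨T, fun α => ?_⟩
  have hTv : ∀ v : Fin (n + 1) → ℂ, T v = ∑ i, v i • B i := by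
    intro v
    conv_lhs => rw [← (Pi.basisFun ℂ (Fin (n + 1))).sum_repr v, map_sum]
    refine Finset.sum_congr rfl fun i _ => ?_
    rw [map_smul, Module.Basis.equiv_apply]
    simp
  change _ ∈ Ideal.radical _
  rw [← MvPolynomial.vanishingIdeal_zeroLocus_eq_radical (K := ℂ)]
  rw [mem_vanishingIdeal_iff]
  intro v hv
  rw [mem_zeroLocus_iff] at hv
  have h1 : T v = 0 := by
    refine hWV _ ?_ fun j => ?_
    · rw [hTv]
      refine Submodule.sum_mem _ fun i _ => ?_
      by_cases hi : (i : ℕ) < r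
      · exact Submodule.smul_mem _ _ (hB i hi)
      · have := hv (X i) (Ideal.mem_sup_right (Ideal.subset_span ⟨i, not_lt.1 hi, rfl⟩))
        rw [aeval_X] at this
        rw [this, zero_smul]; exact Submodule.zero_mem _
    · have := hv _ (Ideal.mem_sup_left (Ideal.subset_span ⟨j, rfl⟩))
      rw [aeval_eq_eval] at this
      exact (eval_linSub _ _ _).symm.trans this
  have h2 : v = 0 := by simpa using h1
  rw [h2]; simp

end Coordinates

end

section

lemma map_mem_kosRel {R R' ι : Type*} [CommRing R] [CommRing R'] [Fintype ι] [DecidableEq ι]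
    (φ : R →+* R') {F a : ι → R} (h : a ∈ kosRel F) : (fun i => φ (a i)) ∈ kosRel fun i => φ (F i) := by
  refine Submodule.span_induction
    (p := fun a _ => (fun i => φ (a i)) ∈ kosRel fun i => φ (F i)) ?_ ?_ ?_ ?_ h
  · rintro _ ⟨p, rfl⟩
    refine Submodule.subset_span ⟨p, ?_⟩
    funext i
    by_cases h1 : i = p.1 <;> by_cases h2 : i = p.2 <;>
      simp only [Pi.sub_apply, Pi.single_apply, h1, h2, if_true, if_false, map_sub, map_zero] <;>
      split_ifs <;> simp
  · convert Submodule.zero_mem (kosRel fun i => φ (F i)) using 1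
    funext i; simp
  · intro a b _ _ ha hb
    convert Submodule.add_mem _ ha hb using 1
    funext i; simp
  · intro r a _ ha
    convert Submodule.smul_mem _ (φ r) ha using 1
    funext i; simp

lemma exists_le_of_le_degree {σ : Type*} {v : σ →₀ ℕ} {t : ℕ} (h : t ≤ v.degree) :
    ∃ u ≤ v, u.degree = t := by
  induction t with
  | zero => exact ⟨0, zero_le, by simp⟩
  | succ t ih =>
    obtain ⟨u, hu, hut⟩ := ih (by omega)
    have : ∃ i, u i < v i := by
      by_contra! hc
      have : u = v := le_antisymm hu hc
      subst this
      omega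
    obtain ⟨i, hi⟩ := this
    classical
    refine ⟨u + Finsupp.single i 1, fun j => ?_, by simp [hut]⟩
    by_cases hj : i = j
    · subst hj; simpa using hi
    · simpa [Finsupp.single_apply, hj] using hu j

section Saturate
variable {K : Type} [Field K] {n c : ℕ}

/-- Multiples of the forms `g j` by all monomials of degree `E - e j`. -/
def monMul (g : Fin c → MvPolynomial (Fin (n + 1)) K) (e : Fin c → ℕ) (E : ℕ)
    (p : Σ j : Fin c, Mon n (E - e j)) : MvPolynomial (Fin (n + 1)) K :=
  monomial p.2.1 1 * g p.1

variable {g : Fin c → MvPolynomial (Fin (n + 1)) K} {e : Fin c → ℕ} {E : ℕ}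

lemma mul_mem_span_monMul {j : Fin c} {p : MvPolynomial (Fin (n + 1)) K} {D : ℕ}
    (hp : p.IsHomogeneous D) (hD : E - e j ≤ D) :
    p * g j ∈ Ideal.span (Set.range (monMul g e E)) := by
  rw [p.as_sum, Finset.sum_mul]
  refine Ideal.sum_mem _ fun v hv => ?_
  have hd : v.degree = D := by
    have := hp (mem_support_iff.1 hv)
    rw [Finsupp.degree_eq_weight_one]
    exact this
  obtain ⟨u, huv, hu⟩ := exists_le_of_le_degree (v := v) (t := E - e j) (by omega)
  have : monomial v (coeff v p) * g j = monomial (v - u) (coeff v p) * (monomial u 1 * g j) := by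
    rw [← mul_assoc, monomial_mul, tsub_add_cancel_of_le huv, mul_one]
  rw [this]
  exact Ideal.mul_mem_left _ _ (Ideal.subset_span ⟨⟨j, ⟨u, mem_mon.2 hu⟩⟩, rfl⟩)

lemma mem_span_monMul {f : MvPolynomial (Fin (n + 1)) K} {δ : ℕ} (hf : f.IsHomogeneous δ)
    (hg : ∀ j, (g j).IsHomogeneous (e j)) (he : ∀ j, e j ≤ E) (hE : E ≤ δ)
    (hfg : f ∈ Ideal.span (Set.range g)) : f ∈ Ideal.span (Set.range (monMul g e E)) := by
  obtain ⟨a, ha⟩ := Ideal.mem_span_range_iff_exists_fun.1 hfg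
  have := congrArg (homogeneousComponent δ) ha
  rw [homogeneousComponent_of_mem (m := δ) hf, if_pos rfl, map_sum] at this
  rw [← this]
  refine Ideal.sum_mem _ fun j _ => ?_
  rw [homogeneousComponent_mul_right _ _ _ _ (hg j)]
  have := he j
  exact mul_mem_span_monMul (compSub_isHomogeneous (by omega) _) (by omega)

lemma pow_mem_span_monMul {I : Ideal (MvPolynomial (Fin (n + 1)) K)} {α : Fin (n + 1)} {N : ℕ}
    (h : X α ^ N ∈ Ideal.span (Set.range g) ⊔ I) :
    X α ^ (E + N) ∈ Ideal.span (Set.range (monMul g e E)) ⊔ I := by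
  obtain ⟨y, hy, z, hz, hyz⟩ := Submodule.mem_sup.1 h
  rw [pow_add, ← hyz, mul_add]
  refine Ideal.add_mem _ (Ideal.mem_sup_left ?_) (Ideal.mem_sup_right (Ideal.mul_mem_left _ _ hz))
  obtain ⟨a, rfl⟩ := Ideal.mem_span_range_iff_exists_fun.1 hy
  rw [Finset.mul_sum]
  refine Ideal.sum_mem _ fun j _ => ?_
  rw [mul_left_comm]
  refine Ideal.mul_mem_left _ _ (mul_mem_span_monMul (D := E) ?_ (by omega))
  simpa using isHomogeneous_X_pow (R := K) α E

end Saturate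

theorem syzKoszul_of_smooth {n c : ℕ} {h : Fin c → MvPolynomial (Fin (n + 1)) ℂ} {e : Fin c → ℕ}
    (hhom : ∀ j, (h j).IsHomogeneous (e j)) {E : ℕ} (hE : 1 ≤ E) (he : ∀ j, e j ≤ E)
    (h0 : ∀ j, eval 0 (h j) = 0) {r : ℕ} (hr2 : 2 ≤ r) (hr : r ≤ n)
    (hsmooth : ∀ v : Fin (n + 1) → ℂ, v ≠ 0 → (∀ j, eval v (h j) = 0) →
      (Matrix.of (fun j i => eval v (pderiv i (h j))) :
        Matrix (Fin c) (Fin (n + 1)) ℂ).rank = r)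
    {f : Fin (n + 1) → MvPolynomial (Fin (n + 1)) ℂ} {δ : ℕ} (hf : ∀ i, (f i).IsHomogeneous δ)
    (hEδ : E ≤ δ) (hfI : ∀ i, f i ∈ Ideal.span (Set.range h)) {N : ℕ}
    (hN : ∀ μ : MvPolynomial (Fin (n + 1)) ℂ, μ.IsHomogeneous N →
      ∀ j, μ * h j ∈ Ideal.span (Set.range f)) {k : ℕ}
    (hk : ∀ s, r + 1 ≤ s → s * E + k + 1 ≤ s * δ) : SyzKoszul f δ k := by
  intro D hD a ha hsum
  obtain ⟨W, hW, hWV⟩ := exists_linear_section hhom h0 hr hsmooth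
  obtain ⟨T, hT⟩ := exists_coordinates hW hWV
  set φ := linSub (T : (Fin (n + 1) → ℂ) →ₗ[ℂ] (Fin (n + 1) → ℂ)) with hφ
  set ψ := linSub (T.symm : (Fin (n + 1) → ℂ) →ₗ[ℂ] (Fin (n + 1) → ℂ)) with hψ
  have hφψ : ∀ p, φ (ψ p) = p := linSub_linSub _ _ fun v => T.symm_apply_apply v
  have hψφ : ∀ p, ψ (φ p) = p := linSub_linSub _ _ fun v => T.apply_symm_apply v
  set g : Fin c → MvPolynomial (Fin (n + 1)) ℂ := fun j => φ (h j) with hg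
  have hghom : ∀ j, (g j).IsHomogeneous (e j) := fun j => linSub_isHomogeneous _ (hhom j)
  have hspan : ∀ {m : ℕ} (F : Fin m → MvPolynomial (Fin (n + 1)) ℂ) (p),
      p ∈ Ideal.span (Set.range F) → φ p ∈ Ideal.span (Set.range fun j => φ (F j)) := by
    intro m F p hp
    obtain ⟨b, rfl⟩ := Ideal.mem_span_range_iff_exists_fun.1 hp
    rw [map_sum]
    refine Ideal.sum_mem _ fun j _ => ?_
    rw [map_mul]
    exact Ideal.mul_mem_left _ _ (Ideal.subset_span ⟨j, rfl⟩)
  let q := Fintype.equivFin (Σ j : Fin c, Mon n (E - e j))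
  let h' := fun i => monMul g e E (q.symm i)
  have hrange : Set.range h' = Set.range (monMul g e E) := q.symm.surjective.range_comp (monMul g e E)
  have key := koszul_exact_complex h' E hE (by
      intro i
      have := (isHomogeneous_monomial (1 : ℂ) (mem_mon.1 (q.symm i).2.2)).mul (hghom (q.symm i).1)
      rwa [Nat.sub_add_cancel (he _)] at this)
    (fun i => φ (f i)) δ (fun i => linSub_isHomogeneous _ (hf i))
    (by
      intro i
      rw [hrange]
      exact mem_span_monMul (linSub_isHomogeneous _ (hf i)) hghom he hEδ (hspan _ _ (hfI i)))
    N (by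
      intro α i
      have h1 : X α ^ N * g (q.symm i).1 ∈ Ideal.span (Set.range fun i => φ (f i)) := by
        have h2 : (ψ (X α ^ N)).IsHomogeneous N :=
          linSub_isHomogeneous _ (by simpa using isHomogeneous_X_pow (R := ℂ) α N)
        have h3 := hspan f _ (hN _ h2 (q.symm i).1)
        rwa [map_mul, hφψ] at h3
      change X α ^ N * (monomial _ 1 * g _) ∈ _
      rw [mul_left_comm]
      exact Ideal.mul_mem_left _ _ h1)
    r hr2 hr (by
      intro α
      obtain ⟨M, hM⟩ := hT α
      rw [hrange]
      exact ⟨E + M, pow_mem_span_monMul hM⟩)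
    D (by
      intro s hs
      have := hk s hs
      omega)
    (fun i => φ (a i)) (fun i => linSub_isHomogeneous _ (ha i)) (by
      have := congrArg φ hsum
      rw [map_sum, map_zero] at this
      simpa only [map_mul] using this)
  have := map_mem_kosRel ψ.toRingHom (by convert key)
  simpa only [AlgHom.toRingHom_eq_coe, RingHom.coe_coe, hψφ] using this

lemma finrank_map_mk {K : Type} [Field K] {n : ℕ} (I : Ideal (MvPolynomial (Fin (n + 1)) K)) (k : ℕ) :
    Module.finrank K ((homogeneousSubmodule (Fin (n + 1)) K k).map
      (Ideal.Quotient.mkₐ K I).toLinearMap) = hilb I k := by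
  let L := (Ideal.Quotient.mkₐ K I).toLinearMap ∘ₗ (homogeneousSubmodule (Fin (n + 1)) K k).subtype
  have h1 : LinearMap.range L = (homogeneousSubmodule (Fin (n + 1)) K k).map
      (Ideal.Quotient.mkₐ K I).toLinearMap := by
    rw [LinearMap.range_comp, Submodule.range_subtype]
  have h2 : LinearMap.ker L = idealPiece I k := by
    ext x
    rw [LinearMap.mem_ker]
    exact Ideal.Quotient.eq_zero_iff_mem
  rw [← h1, ← L.quotKerEquivRange.finrank_eq, h2, hilb]

end

end JacSing

/-- Proposition: dimension of `R_f^k` for `f` singular along `Z`.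
`Z ⊂ ℙⁿ` is a smooth subvariety of dimension `m`, with homogeneous ideal generated by
forms `h j` of degrees `e j ≤ (d+1)/2` (smoothness of pure dimension `m` is expressed by
the Jacobian criterion on the affine cone minus the origin); `f` is a degree-`d` form
singular along `Z` whose partial derivatives generate the ideal sheaf of `Z`
(expressed by: some power of the irrelevant ideal multiplies `I_Z` into `J_f`).
Then for `k < (n - dim Z + 1)(d-3)/2`, `dim R_f^k` is given by the Koszul alternating
sum, i.e. agrees with the value for a generic degree-`d` polynomial. -/
theorem dimension_jacobian_ring_singular (n d : ℕ) (f : S n) (hf : f.IsHomogeneous d)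
    (c m : ℕ) (hmn : m ≤ n)
    (h : Fin c → S n) (e : Fin c → ℕ)
    (hhom : ∀ j, (h j).IsHomogeneous (e j))
    (hdeg : ∀ j, 2 * e j ≤ d + 1)
    -- `span h` is the full homogeneous ideal of `Z`:
    (hIZ : ∀ g : S n,
      (∀ v : Fin (n + 1) → ℂ, (∀ j, MvPolynomial.eval v (h j) = 0) → MvPolynomial.eval v g = 0) →
      g ∈ Ideal.span (Set.range h))
    -- `Z` is nonempty:
    (hne : ∃ v : Fin (n + 1) → ℂ, v ≠ 0 ∧ ∀ j, MvPolynomial.eval v (h j) = 0)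
    -- `Z` is smooth of pure dimension `m` (Jacobian criterion on the cone minus `0`):
    (hsmooth : ∀ v : Fin (n + 1) → ℂ, v ≠ 0 → (∀ j, MvPolynomial.eval v (h j) = 0) →
      (Matrix.of (fun j i => MvPolynomial.eval v (MvPolynomial.pderiv i (h j))) :
        Matrix (Fin c) (Fin (n + 1)) ℂ).rank = n - m)
    -- `f` is singular along `Z`:
    (hsing : ∀ v : Fin (n + 1) → ℂ, (∀ j, MvPolynomial.eval v (h j) = 0) →
      ∀ i, MvPolynomial.eval v (MvPolynomial.pderiv i f) = 0)
    -- the partial derivatives of `f` generate the ideal sheaf of `Z`: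
    (hsheaf : ∃ N : ℕ, ∀ μ : S n, μ.IsHomogeneous N →
      ∀ g ∈ Ideal.span (Set.range h), μ * g ∈ jacobianIdeal f)
    (k : ℕ) (hk : 2 * k < (n - m + 1) * (d - 3)) :
    (Module.finrank ℂ ↥(Rpiece f k) : ℤ) =
      ∑ i ∈ Finset.range (n + 2), (-1 : ℤ) ^ i * ((n + 1).choose i) *
        (if i * (d - 1) ≤ k then (((k - i * (d - 1)) + n).choose n : ℤ) else 0) := by
  have hd : 3 < d := by
    by_contra! hd
    rw [Nat.sub_eq_zero_of_le hd, mul_zero] at hk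
    omega
  have h0 : ∀ j, eval (0 : Fin (n + 1) → ℂ) (h j) = 0 := by
    obtain ⟨v, -, hv⟩ := hne
    intro j
    have := JacSing.eval_smul_of_isHomogeneous (hhom j) 0 v
    rwa [zero_smul, hv j, mul_zero] at this
  have hpd : ∀ i, (pderiv i f).IsHomogeneous (d - 1) := fun i => hf.pderiv
  obtain ⟨N, hN⟩ := hsheaf
  have hsyz : JacSing.SyzKoszul (fun i => pderiv i f) (d - 1) k := by
    by_cases hkd : k < d - 1
    · intro D hD
      omega
    have hr2 : 2 ≤ n - m := by
      by_contra! hlt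
      have : (n - m + 1) * (d - 3) ≤ 2 * (d - 3) := Nat.mul_le_mul_right _ (by omega)
      omega
    refine JacSing.syzKoszul_of_smooth hhom (E := (d + 1) / 2) (by omega)
      (fun j => by have := hdeg j; omega) h0 hr2 (Nat.sub_le n m) hsmooth hpd (by omega)
      (fun i => hIZ _ fun v hv => hsing v hv i)
      (fun μ hμ j => hN μ hμ _ (Ideal.subset_span ⟨j, rfl⟩)) ?_
    intro s hs
    have h1 : (n - m + 1) * (d - 3) ≤ s * (d - 3) := Nat.mul_le_mul_right _ hs
    have h2 : s * (d - 3) + s * (2 * ((d + 1) / 2)) ≤ s * (2 * (d - 1)) := by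
      rw [← mul_add]
      exact Nat.mul_le_mul_left _ (by omega)
    have h3 : s * (2 * ((d + 1) / 2)) = 2 * (s * ((d + 1) / 2)) := mul_left_comm _ _ _
    have h4 : s * (2 * (d - 1)) = 2 * (s * (d - 1)) := mul_left_comm _ _ _
    omega
  have := JacSing.hilb_koszul (fun i => pderiv i f) (by omega) hpd hsyz le_rfl
  rw [← JacSing.finrank_map_mk] at this
  exact this

end
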